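/- Let M be a compact 3-manifold that is aspherical and boundary irreducible. Then ‖M,∂M‖ ≥ (5/4)·‖∂M‖, and this inequality is sharp (equality holds for products of closed orientable surfaces of genus ≥ 2 with the interval). -/

import Mathlib

open scoped BigOperators
set_option maxSynthPendingDepth 3
noncomputable section

/-! ## The standard topological simplex and singular chains -/

/-- The standard topological `n`-simplex. -/
def TSimplex (n : ℕ) : Type :=
  {x : Fin (n + 1) → ℝ // (∀ i, 0 ≤ x i) ∧ ∑ i, x i = 1}

instance (n : ℕ) : TopologicalSpace (TSimplex n) := instTopologicalSpaceSubtype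

/-- The affine inclusion of the `i`-th face of the standard `(n+1)`-simplex. -/
def faceMap {n : ℕ} (i : Fin (n + 2)) : C(TSimplex n, TSimplex (n + 1)) where
  toFun x := ⟨fun j => ∑ k ∈ Finset.univ.filter (fun k => i.succAbove k = j), x.1 k, by
    constructor
    · intro j
      exact Finset.sum_nonneg fun k _ => x.2.1 k
    · rw [Finset.sum_fiberwise_of_maps_to (fun k _ => Finset.mem_univ (i.succAbove k)), x.2.2]⟩
  continuous_toFun := by
    apply Continuous.subtype_mk
    exact continuous_pi fun j => continuous_finset_sum _ fun k _ =>
      (continuous_apply k).comp continuous_subtype_val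

/-- The `j`-th vertex of the standard simplex. -/
def vertexPt {m : ℕ} (j : Fin (m + 1)) : TSimplex m :=
  ⟨fun i => if i = j then 1 else 0, by
    constructor
    · intro i; dsimp only; split <;> norm_num
    · simp⟩

set_option linter.unnecessarySeqFocus false in
/-- The affine map of the standard `1`-simplex onto the edge of the standard `k`-simplex
joining the vertices `a` and `b`. -/
def segMap {k : ℕ} (a b : Fin (k + 1)) : C(TSimplex 1, TSimplex k) where
  toFun x := ⟨fun j => (if j = a then x.1 0 else 0) + (if j = b then x.1 1 else 0), by
    constructor
    · intro j
      have h0 := x.2.1 0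
      have h1 := x.2.1 1
      dsimp only
      split <;> split <;> simp_all <;> positivity
    · have := x.2.2
      rw [Finset.sum_add_distrib]
      simp [Finset.sum_ite_eq', ← this, Fin.sum_univ_two]⟩
  continuous_toFun := by
    apply Continuous.subtype_mk
    apply continuous_pi
    intro j
    apply Continuous.add
    · split
      · exact (continuous_apply (0 : Fin 2)).comp continuous_subtype_val
      · exact continuous_const
    · split
      · exact (continuous_apply (1 : Fin 2)).comp continuous_subtype_val
      · exact continuous_const

/-- A singular `n`-simplex in `X`. -/
abbrev SingSimplex (n : ℕ) (X : Type) [TopologicalSpace X] : Type := C(TSimplex n, X)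

/-- Singular `n`-chains in `X` with coefficients in `R`. -/
abbrev SChain (R : Type) [Zero R] (n : ℕ) (X : Type) [TopologicalSpace X] : Type :=
  SingSimplex n X →₀ R

/-- The singular boundary operator. -/
def sbdry (R : Type) [CommRing R] {n : ℕ} {X : Type} [TopologicalSpace X] :
    SChain R (n + 1) X →ₗ[R] SChain R n X :=
  Finsupp.lsum R fun σ => LinearMap.toSpanSingleton R _
    (∑ i : Fin (n + 2), ((-1 : ℤ) ^ (i : ℕ)) • Finsupp.single (σ.comp (faceMap i)) (1 : R))

/-- The singular boundary operator, from degree `n` to degree `n - 1`. -/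
def sbdryN (R : Type) [CommRing R] (n : ℕ) {X : Type} [TopologicalSpace X] :
    SChain R n X →ₗ[R] SChain R (n - 1) X :=
  match n with
  | 0 => 0
  | (_ + 1) => sbdry R

/-- The `j`-th face of a singular `n`-simplex. -/
def faceOf {X : Type} [TopologicalSpace X] :
    (n : ℕ) → Fin (n + 1) → SingSimplex n X → SingSimplex (n - 1) X
  | 0, _, σ => σ
  | (_ + 1), k, σ => σ.comp (faceMap k)

/-- The edge of a singular `k`-simplex joining its `a`-th and `b`-th vertices. -/
def edgeOf {X : Type} [TopologicalSpace X] {k : ℕ} (a b : Fin (k + 1))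
    (σ : SingSimplex k X) : SingSimplex 1 X :=
  σ.comp (segMap a b)

/-- The submodule of chains supported on a subspace `A`. -/
def suppOn (R : Type) [CommRing R] (n : ℕ) {X : Type} [TopologicalSpace X] (A : Set X) :
    Submodule R (SChain R n X) :=
  Finsupp.supported R R {σ : SingSimplex n X | Set.range ⇑σ ⊆ A}

/-- `z` is a relative cycle of the pair `(X, A)`. -/
def IsRelCycle (R : Type) [CommRing R] (n : ℕ) {X : Type} [TopologicalSpace X] (A : Set X)
    (z : SChain R n X) : Prop :=
  sbdryN R n z ∈ suppOn R (n - 1) A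

/-- Two chains are homologous relative to `A`. -/
def RelHomologous (R : Type) [CommRing R] (n : ℕ) {X : Type} [TopologicalSpace X] (A : Set X)
    (z z' : SChain R n X) : Prop :=
  ∃ w : SChain R (n + 1) X, z - z' - sbdry R w ∈ suppOn R n A

/-- The ℓ¹-norm of a relative chain: the sum of the norms of the coefficients of the
simplices not contained in `A`. -/
def relNorm {R : Type} [NormedCommRing R] {n : ℕ} {X : Type} [TopologicalSpace X]
    (A : Set X) (z : SChain R n X) : ℝ :=
  letI : DecidablePred fun σ : SingSimplex n X => ¬ Set.range ⇑σ ⊆ A :=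
    fun _ => Classical.dec _
  ∑ σ ∈ z.support.filter (fun σ : SingSimplex n X => ¬ Set.range ⇑σ ⊆ A), ‖z σ‖

/-- `c` is an integral fundamental cycle of the pair `(X, A)` in degree `n`: it is a relative
cycle whose class generates `H_n(X, A; ℤ)`.  For a compact connected oriented `n`-manifold
`X` with boundary `A`, this holds exactly for the representatives of `±[X, A]`. -/
def IsFundCycle (n : ℕ) {X : Type} [TopologicalSpace X] (A : Set X) (c : SChain ℤ n X) : Prop :=
  IsRelCycle ℤ n A c ∧
    ∀ z : SChain ℤ n X, IsRelCycle ℤ n A z → ∃ k : ℤ, RelHomologous ℤ n A z (k • c)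

/-- Change of coefficients `ℤ → ℝ` on chains. -/
def intToReal {n : ℕ} {X : Type} [TopologicalSpace X] (c : SChain ℤ n X) : SChain ℝ n X :=
  Finsupp.mapRange (fun k : ℤ => (k : ℝ)) (by norm_num) c

/-- Change of coefficients `ℤ → ℚ` on chains. -/
def intToRat {n : ℕ} {X : Type} [TopologicalSpace X] (c : SChain ℤ n X) : SChain ℚ n X :=
  Finsupp.mapRange (fun k : ℤ => (k : ℚ)) (by norm_num) c

/-- Change of coefficients `ℚ → ℝ` on chains. -/
def ratToReal {n : ℕ} {X : Type} [TopologicalSpace X] (c : SChain ℚ n X) : SChain ℝ n X :=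
  Finsupp.mapRange (fun k : ℚ => (k : ℝ)) (by norm_num) c

/-- The pair `(X, A)` is homologically orientable in degree `n`: the `n`-th relative
integral homology has a generator which is not trivial. -/
def HomOrientable (n : ℕ) (X : Type) [TopologicalSpace X] (A : Set X) : Prop :=
  ∃ c : SChain ℤ n X, IsFundCycle n A c ∧ ¬ RelHomologous ℤ n A c 0

/-- The simplicial volume of a pair `(X, A)`, where `X` is a compact connected oriented
`n`-manifold with boundary `A`: the infimum of the ℓ¹-norms of the real relative cycles
representing (the real image of) an integral fundamental class. -/
def simVolOr (n : ℕ) (X : Type) [TopologicalSpace X] (A : Set X) : ℝ :=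
  sInf {r : ℝ | ∃ z : SChain ℝ n X,
    (∃ c : SChain ℤ n X, IsFundCycle n A c ∧ RelHomologous ℝ n A z (intToReal c)) ∧
    r = relNorm A z}

/-- Rational version of `simVolOr`. -/
def simVolOrQ (n : ℕ) (X : Type) [TopologicalSpace X] (A : Set X) : ℝ :=
  sInf {r : ℝ | ∃ z : SChain ℚ n X,
    (∃ c : SChain ℤ n X, IsFundCycle n A c ∧ RelHomologous ℚ n A z (intToRat c)) ∧
    r = relNorm A z}

/-- `p` is a two-sheeted covering map. -/
def IsDoubleCover {Y X : Type} [TopologicalSpace Y] [TopologicalSpace X] (p : Y → X) : Prop :=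
  IsCoveringMap p ∧ ∀ x : X, Nat.card (p ⁻¹' {x}) = 2

/-- Simplicial volume of a connected pair: the norm of the fundamental class if the pair is
(homologically) orientable, and one half of the simplicial volume of the orientable double
cover otherwise. -/
def simVolConn (n : ℕ) (X : Type) [TopologicalSpace X] (A : Set X) : ℝ :=
  letI := Classical.propDecidable (HomOrientable n X A)
  if HomOrientable n X A then simVolOr n X A
  else (1 / 2) * sInf {r : ℝ | ∃ (Y : TopCat.{0}) (p : ↥Y → X), IsDoubleCover p ∧
    HomOrientable n ↥Y (p ⁻¹' A) ∧ r = simVolOr n ↥Y (p ⁻¹' A)}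

/-- The simplicial volume `‖X, A‖` of a compact manifold `X` with boundary `A`:
the sum over the connected components. -/
def SimVol (n : ℕ) (X : Type) [TopologicalSpace X] (A : Set X) : ℝ :=
  ∑ᶠ c : ConnectedComponents X,
    simVolConn n {x : X // ConnectedComponents.mk x = c} {x | ↑x ∈ A}

/-- Rational simplicial volume (for orientable manifolds). -/
def SimVolQ (n : ℕ) (X : Type) [TopologicalSpace X] (A : Set X) : ℝ :=
  ∑ᶠ c : ConnectedComponents X,
    simVolOrQ n {x : X // ConnectedComponents.mk x = c} {x | ↑x ∈ A}

/-! ## Topological manifolds with boundary -/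

/-- `X` is a topological `n`-manifold, possibly with boundary. -/
def IsManifoldWithBoundary (n : ℕ) (X : Type) [TopologicalSpace X] : Prop :=
  T2Space X ∧ SecondCountableTopology X ∧ ∀ x : X, ∃ U : Set X, x ∈ U ∧ IsOpen U ∧
    (Nonempty (U ≃ₜ EuclideanSpace ℝ (Fin n)) ∨
      Nonempty (U ≃ₜ {y : EuclideanSpace ℝ (Fin n) // 0 ≤ ∑ i, y i}))

/-- The boundary of a topological `n`-manifold: the points having no neighbourhood
homeomorphic to `ℝⁿ`. -/
def intBoundary (n : ℕ) (X : Type) [TopologicalSpace X] : Set X :=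
  {x | ¬ ∃ U : Set X, x ∈ U ∧ IsOpen U ∧ Nonempty (U ≃ₜ EuclideanSpace ℝ (Fin n))}

/-! ## Asphericity and boundary irreducibility -/

/-- A space is aspherical if all its homotopy groups `π_k`, `k ≥ 2`, at all basepoints,
are trivial. -/
def Aspherical (X : Type) [TopologicalSpace X] : Prop :=
  ∀ k : ℕ, 2 ≤ k → ∀ x : X, Subsingleton (HomotopyGroup (Fin k) X x)

/-- An `n`-manifold is boundary irreducible if the inclusion of each connected component of
its boundary is `π₁`-injective:  every loop in a boundary component which is null-homotopic
in `X` is already null-homotopic in the component. -/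
def BoundaryIrreducible (n : ℕ) (X : Type) [TopologicalSpace X] : Prop :=
  ∀ (x : X) (hx : x ∈ intBoundary n X)
    (γ : Path (X := ↥(connectedComponentIn (intBoundary n X) x))
      ⟨x, mem_connectedComponentIn hx⟩ ⟨x, mem_connectedComponentIn hx⟩),
    (γ.map continuous_subtype_val).Homotopic (Path.refl x) →
      γ.Homotopic (Path.refl _)

section Surfaces

/-- A chain of `g` pairwise tangent circles in `ℝ³`, a spine of the genus-`g`
handlebody. -/
def spine (g : ℕ) : Set (EuclideanSpace ℝ (Fin 3)) :=
  {p | p 2 = 0 ∧ ∃ k : ℕ, k < g ∧ (p 0 - 2 * k) ^ 2 + (p 1) ^ 2 = 1}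

/-- The standard genus-`g` handlebody, realized as the closed `1/4`-neighbourhood in `ℝ³`
of a chain of `g` tangent circles. -/
def HgSet (g : ℕ) : Set (EuclideanSpace ℝ (Fin 3)) :=
  {p | ∃ q ∈ spine g, dist p q ≤ 1 / 4}

/-- The orientable handlebody of genus `g`. -/
abbrev Handlebody (g : ℕ) : Type := ↥(HgSet g)

/-- The closed orientable surface of genus `g`, realized as the boundary of the standard
genus-`g` handlebody in `ℝ³`. -/
abbrev SurfaceG (g : ℕ) : Type := ↥(frontier (HgSet g))

end Surfaces

section
set_option maxSynthPendingDepth 1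
set_option linter.all false
noncomputable section
open Finset

/-! ### P1 : chain toolkit -/
section Toolkit
variable {R : Type} [CommRing R] {X Y Z : Type} [TopologicalSpace X] [TopologicalSpace Y]
  [TopologicalSpace Z] {n : ℕ}

/-- push-forward of chains -/
def cmap (R : Type) [CommRing R] (f : C(X, Y)) : SChain R n X →ₗ[R] SChain R n Y :=
  Finsupp.lmapDomain R R (fun σ : SingSimplex n X => f.comp σ)

@[simp] lemma cmap_single (f : C(X, Y)) (σ : SingSimplex n X) (a : R) :
    cmap R f (Finsupp.single σ a) = Finsupp.single (f.comp σ) a := by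
  simp [cmap]

@[simp] lemma sbdry_single (σ : SingSimplex (n + 1) X) (a : R) :
    sbdry R (Finsupp.single σ a) =
      ∑ i : Fin (n + 2), ((-1 : ℤ) ^ (i : ℕ)) • Finsupp.single (σ.comp (faceMap i)) a := by
  simp only [sbdry, Finsupp.lsum_single, LinearMap.toSpanSingleton_apply, Finset.smul_sum,
    smul_comm a, Finsupp.smul_single, smul_eq_mul, mul_one]

lemma chain_ext {M : Type*} [AddCommMonoid M] [Module R M] {f g : SChain R n X →ₗ[R] M}
    (h : ∀ σ, f (Finsupp.single σ 1) = g (Finsupp.single σ 1)) : f = g :=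
  Finsupp.lhom_ext' fun σ => LinearMap.ext_ring (h σ)

lemma cmap_cmap (f : C(X, Y)) (g : C(Y, Z)) (c : SChain R n X) :
    cmap R g (cmap R f c) = cmap R (g.comp f) c := by
  have : (cmap R g).comp (cmap R f) = (cmap R (g.comp f) : SChain R n X →ₗ[R] _) :=
    chain_ext fun σ => by simp [ContinuousMap.comp_assoc]
  exact LinearMap.congr_fun this c

lemma cmap_id (c : SChain R n X) : cmap R (ContinuousMap.id X) c = c := by
  have : cmap R (ContinuousMap.id X) = (LinearMap.id : SChain R n X →ₗ[R] _) :=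
    chain_ext fun σ => by simp
  exact LinearMap.congr_fun this c

lemma sbdry_cmap (f : C(X, Y)) (c : SChain R (n + 1) X) :
    sbdry R (cmap R f c) = cmap R f (sbdry R c) := by
  have : (sbdry R).comp (cmap R f) = (cmap R f).comp (sbdry R : SChain R (n + 1) X →ₗ[R] _) :=
    chain_ext fun σ => by simp [ContinuousMap.comp_assoc, map_sum]
  exact LinearMap.congr_fun this c

lemma single_mem_suppOn {A : Set X} {σ : SingSimplex n X} (h : Set.range ⇑σ ⊆ A) (a : R) :
    Finsupp.single σ a ∈ suppOn R n A := Finsupp.single_mem_supported R a h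

/-- induction principle for `suppOn` -/
lemma suppOn_le {A : Set X} {P : Submodule R (SChain R n X)}
    (h : ∀ σ : SingSimplex n X, Set.range ⇑σ ⊆ A → Finsupp.single σ 1 ∈ P) :
    suppOn R n A ≤ P := by
  rw [suppOn, Finsupp.supported_eq_span_single, Submodule.span_le]
  rintro _ ⟨σ, hσ, rfl⟩
  exact h σ hσ

lemma suppOn_mono {A B : Set X} (h : A ⊆ B) : suppOn R n A ≤ suppOn R n B :=
  suppOn_le fun _ hσ => single_mem_suppOn (hσ.trans h) 1

lemma suppOn_univ (c : SChain R n X) : c ∈ suppOn R n (Set.univ : Set X) := by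
  intro σ _; exact Set.subset_univ _

lemma suppOn_inf {A B : Set X} {c : SChain R n X} (h : c ∈ suppOn R n A) (h' : c ∈ suppOn R n B) :
    c ∈ suppOn R n (A ∩ B) := fun σ hσ => Set.subset_inter (h hσ) (h' hσ)

lemma sbdry_mem {A : Set X} {c : SChain R (n + 1) X} (h : c ∈ suppOn R (n + 1) A) :
    sbdry R c ∈ suppOn R n A := by
  have : suppOn R (n + 1) A ≤ (suppOn R n A).comap (sbdry R) := suppOn_le fun σ hσ => by
    rw [Submodule.mem_comap, sbdry_single]
    exact Submodule.sum_mem _ fun i _ => zsmul_mem (single_mem_suppOn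
      (by rintro _ ⟨x, rfl⟩; exact hσ ⟨_, rfl⟩) (1 : R)) _
  exact this h

lemma cmap_mem {A : Set X} {B : Set Y} {f : C(X, Y)} (hf : Set.MapsTo f A B) {c : SChain R n X}
    (h : c ∈ suppOn R n A) : cmap R f c ∈ suppOn R n B := by
  have : suppOn R n A ≤ (suppOn R n B).comap (cmap R f) := suppOn_le fun σ hσ => by
    rw [Submodule.mem_comap, cmap_single]
    refine single_mem_suppOn ?_ 1
    rintro _ ⟨x, rfl⟩
    exact hf (hσ ⟨x, rfl⟩)
  exact this h

lemma cmap_mem' {B : Set Y} {f : C(X, Y)} (hf : ∀ x, f x ∈ B) (c : SChain R n X) :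
    cmap R f c ∈ suppOn R n B := cmap_mem (A := Set.univ) (fun x _ => hf x) (suppOn_univ c)

/-- A subset containing all the images is compact. -/
lemma exists_compact_supp (c : SChain R n X) : ∃ K : Set X, IsCompact K ∧ c ∈ suppOn R n K := by
  haveI : CompactSpace (TSimplex n) := by
    refine isCompact_iff_compactSpace.1 (?_ : IsCompact
      {x : Fin (n + 1) → ℝ | (∀ i, 0 ≤ x i) ∧ ∑ i, x i = 1})
    exact isCompact_stdSimplex ℝ (Fin (n + 1))
  refine ⟨⋃ σ ∈ c.support, Set.range ⇑σ, c.support.isCompact_biUnion fun σ _ =>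
    isCompact_range σ.continuous, fun σ hσ => ?_⟩
  exact Set.subset_biUnion_of_mem (u := fun σ : SingSimplex n X => Set.range ⇑σ) hσ

/-! ### ordered chains -/
/-- ordered simplicial chains on a vertex type -/
abbrev LC (R : Type) [CommRing R] (n : ℕ) (V : Type) := (Fin (n + 1) → V) →₀ R

variable {V W : Type}

def lbd (R : Type) [CommRing R] : LC R (n + 1) V →ₗ[R] LC R n V :=
  Finsupp.lsum R fun v => LinearMap.toSpanSingleton R _
    (∑ i : Fin (n + 2), ((-1 : ℤ) ^ (i : ℕ)) • Finsupp.single (v ∘ i.succAbove) (1 : R))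

def lcone (R : Type) [CommRing R] (b : V) : LC R n V →ₗ[R] LC R (n + 1) V :=
  Finsupp.lmapDomain R R (fun v : Fin (n + 1) → V => (Fin.cons b v : Fin (n + 2) → V))

def lmp (R : Type) [CommRing R] (f : V → W) : LC R n V →ₗ[R] LC R n W :=
  Finsupp.lmapDomain R R (fun v : Fin (n + 1) → V => f ∘ v)

@[simp] lemma lcone_single (b : V) (v : Fin (n + 1) → V) (a : R) :
    lcone R b (Finsupp.single v a) = Finsupp.single (Fin.cons b v : Fin (n + 2) → V) a := by
  simp [lcone]

@[simp] lemma lmp_single (f : V → W) (v : Fin (n + 1) → V) (a : R) :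
    lmp R f (Finsupp.single v a) = Finsupp.single (f ∘ v) a := by
  simp [lmp]

@[simp] lemma lbd_single (v : Fin (n + 2) → V) (a : R) :
    lbd R (Finsupp.single v a) =
      ∑ i : Fin (n + 2), ((-1 : ℤ) ^ (i : ℕ)) • Finsupp.single (v ∘ i.succAbove) a := by
  simp only [lbd, Finsupp.lsum_single, LinearMap.toSpanSingleton_apply, Finset.smul_sum,
    smul_comm a, Finsupp.smul_single, smul_eq_mul, mul_one]

lemma lc_ext {M : Type*} [AddCommMonoid M] [Module R M] {f g : LC R n V →ₗ[R] M}
    (h : ∀ v, f (Finsupp.single v 1) = g (Finsupp.single v 1)) : f = g :=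
  Finsupp.lhom_ext' fun σ => LinearMap.ext_ring (h σ)

lemma lbd_lmp (f : V → W) (c : LC R (n + 1) V) : lbd R (lmp R f c) = lmp R f (lbd R c) := by
  have : (lbd R).comp (lmp R f) = (lmp R f).comp (lbd R : LC R (n + 1) V →ₗ[R] _) :=
    lc_ext fun σ => by simp [Function.comp_assoc]
  exact LinearMap.congr_fun this c

lemma lcone_lmp (f : V → W) (b : V) (c : LC R n V) :
    lcone R (f b) (lmp R f c) = lmp R f (lcone R b c) := by
  have : (lcone R (f b)).comp (lmp R f) = (lmp R f).comp (lcone R b : LC R n V →ₗ[R] _) :=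
    lc_ext fun v => by
      simp only [LinearMap.comp_apply, lmp_single, lcone_single]
      congr 1; funext i; refine Fin.cases ?_ (fun i => ?_) i <;> simp
  exact LinearMap.congr_fun this c

lemma lbd_lcone (b : V) (c : LC R (n + 1) V) :
    lbd R (lcone R b c) = c - lcone R b (lbd R c) := by
  have : (lbd R).comp (lcone R b) =
      (LinearMap.id - (lcone R b).comp (lbd R) : LC R (n + 1) V →ₗ[R] _) :=
    lc_ext fun v => by
      simp only [LinearMap.comp_apply, lcone_single, lbd_single, LinearMap.sub_apply,
        LinearMap.id_apply, map_sum, map_zsmul]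
      rw [Fin.sum_univ_succ, sub_eq_add_neg, ← Finset.sum_neg_distrib]
      congr 1
      · simp only [Fin.val_zero, pow_zero, one_smul]; rfl
      · refine Finset.sum_congr rfl fun i _ => ?_
        have : (Fin.cons b v : Fin (n + 3) → V) ∘ i.succ.succAbove =
            Fin.cons b (v ∘ i.succAbove) := by
          funext j; refine Fin.cases ?_ (fun j => ?_) j <;> simp
        rw [this, Fin.val_succ, pow_succ, mul_neg_one, neg_smul]
  exact LinearMap.congr_fun this c

lemma lbd_lcone_zero (b v : V) (a : R) :
    lbd R (lcone R b (Finsupp.single (fun _ : Fin 1 => v) a)) =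
      Finsupp.single (fun _ : Fin 1 => v) a - Finsupp.single (fun _ : Fin 1 => b) a := by
  rw [lcone_single, lbd_single]
  refine (Fin.sum_univ_two _).trans ?_
  simp only [Fin.val_zero, Fin.val_one, pow_zero, pow_one, one_smul, neg_smul, sub_eq_add_neg]
  congr 3 <;> · funext j; fin_cases j; rfl

lemma lbd_lcone_bd (b : V) (c : LC R 1 V) : lbd R (lcone R b (lbd R c)) = lbd R c := by
  have : (lbd R).comp ((lcone R b).comp (lbd R)) = (lbd R : LC R 1 V →ₗ[R] _) :=
    lc_ext fun v => by
      have h : ∀ i : Fin 2, v ∘ i.succAbove = fun _ : Fin 1 => v (i.succAbove 0) := by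
        intro i; funext j; fin_cases j; rfl
      simp only [LinearMap.comp_apply, lbd_single v, h, map_sum, map_zsmul, lbd_lcone_zero]
      refine (Fin.sum_univ_two _).trans (Eq.trans ?_ (Fin.sum_univ_two _).symm)
      simp [sub_eq_add_neg]
      abel
  exact LinearMap.congr_fun this c

lemma lbd_lbd (c : LC R (n + 2) V) : lbd R (lbd R c) = 0 := by
  have : (lbd R).comp (lbd R) = (0 : LC R (n + 2) V →ₗ[R] LC R n V) := by
    clear c
    induction n with
    | zero =>
      refine lc_ext fun v => ?_
      have hv : (Finsupp.single v 1 : LC R 2 V) = lcone R (v 0) (Finsupp.single (Fin.tail v) 1) := by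
        simp [Fin.cons_self_tail]
      rw [LinearMap.comp_apply, hv, lbd_lcone, map_sub, lbd_lcone_bd, sub_self]; rfl
    | succ n ih =>
      refine lc_ext fun v => ?_
      have hv : (Finsupp.single v 1 : LC R (n + 3) V) =
          lcone R (v 0) (Finsupp.single (Fin.tail v) 1) := by
        simp [Fin.cons_self_tail]
      have h2 := LinearMap.congr_fun ih (Finsupp.single (Fin.tail v) 1)
      rw [LinearMap.comp_apply] at h2
      rw [LinearMap.comp_apply, hv, lbd_lcone, map_sub, lbd_lcone, h2]; simp
  exact LinearMap.congr_fun this c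

/-- prism on ordered chains -/
def lprism (R : Type) [CommRing R] (V : Type) : (n : ℕ) → LC R n V →ₗ[R] LC R (n + 1) (V × Bool)
  | 0 => Finsupp.lsum R fun v => LinearMap.toSpanSingleton R _
      (Finsupp.single (Fin.cons (v 0, false) fun _ => (v 0, true) : Fin 2 → V × Bool) 1)
  | n + 1 => Finsupp.lsum R fun v => LinearMap.toSpanSingleton R _
      (lcone R (v 0, false) (lmp R (fun x => (x, true)) (Finsupp.single v 1)) -
        lcone R (v 0, false) (lprism R V n (Finsupp.single (Fin.tail v) 1)))

lemma lprism_zero (v : Fin 1 → V) : lprism R V 0 (Finsupp.single v 1) =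
    lcone R (v 0, false) (lmp R (fun x => (x, true)) (Finsupp.single v 1)) := by
  simp only [lprism, Finsupp.lsum_single, LinearMap.toSpanSingleton_apply, one_smul, lmp_single,
    lcone_single]
  congr 2; funext j; fin_cases j; rfl

lemma lprism_cone (b : V) (c : LC R n V) : lprism R V (n + 1) (lcone R b c) =
    lcone R (b, false) (lcone R (b, true) (lmp R (fun x => (x, true)) c)) -
      lcone R (b, false) (lprism R V n c) := by
  have : (lprism R V (n + 1)).comp (lcone R b) =
    (lcone R (b, false)).comp ((lcone R (b, true)).comp (lmp R (fun x => (x, true)))) -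
      (lcone R (b, false)).comp (lprism R V n) := lc_ext fun v => by
    simp only [LinearMap.comp_apply, lcone_single, LinearMap.sub_apply, lprism,
      Finsupp.lsum_single, LinearMap.toSpanSingleton_apply, one_smul, lmp_single, Fin.cons_zero,
      Fin.tail_cons]
    congr 3; funext i; refine Fin.cases ?_ (fun j => ?_) i <;> simp
  exact LinearMap.congr_fun this c

lemma lprism_nat (f : V → W) (c : LC R n V) :
    lprism R W n (lmp R f c) = lmp R (Prod.map f id) (lprism R V n c) := by
  have : (lprism R W n).comp (lmp R f) = (lmp R (Prod.map f id)).comp (lprism R V n) := by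
    clear c
    induction n with
    | zero => 
      refine lc_ext fun v => ?_
      simp only [LinearMap.comp_apply, lmp_single, lprism_zero, lcone_single]
      congr 1; funext i; refine Fin.cases ?_ (fun j => ?_) i <;> simp
    | succ n ih =>
      refine lc_ext fun v => ?_
      have hv : (Finsupp.single v 1 : LC R (n + 1) V) =
          lcone R (v 0) (Finsupp.single (Fin.tail v) 1) := by
        simp [Fin.cons_self_tail]
      have ih' := LinearMap.congr_fun ih (Finsupp.single (Fin.tail v) 1)
      simp only [LinearMap.comp_apply] at ih'
      rw [LinearMap.comp_apply, LinearMap.comp_apply, hv, ← lcone_lmp, lprism_cone, lprism_cone,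
        ih', map_sub, ← lcone_lmp, ← lcone_lmp, ← lcone_lmp]
      congr 3
      simp [Function.comp_def]
  exact LinearMap.congr_fun this c

lemma lbd_lprism (c : LC R (n + 1) V) : lbd R (lprism R V (n + 1) c) =
    lmp R (fun x => (x, true)) c - lmp R (fun x => (x, false)) c - lprism R V n (lbd R c) := by
  have : (lbd R).comp (lprism R V (n + 1)) = lmp R (fun x => (x, true)) -
      lmp R (fun x => (x, false)) - (lprism R V n).comp (lbd R) := by
    clear c
    induction n with
    | zero =>
      refine lc_ext fun v => ?_
      obtain ⟨a, b, rfl⟩ : ∃ a b : V, v = Fin.cons a (fun _ => b) :=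
        ⟨v 0, v 1, by funext i; fin_cases i <;> rfl⟩
      have hv : (Finsupp.single (Fin.cons a (fun _ => b) : Fin 2 → V) 1 : LC R 1 V) =
          lcone R a (Finsupp.single (fun _ : Fin 1 => b) 1) := by simp
      simp only [LinearMap.comp_apply, LinearMap.sub_apply]
      rw [hv, lprism_cone, map_sub, lbd_lcone, lprism_zero, lbd_lcone]
      simp only [lmp_single, Function.comp_def, lbd_lcone_zero, map_sub, lprism_zero, ← lcone_lmp]
      abel
    | succ n ih =>
      refine lc_ext fun v => ?_
      have hv : (Finsupp.single v 1 : LC R (n + 2) V) =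
          lcone R (v 0) (Finsupp.single (Fin.tail v) 1) := by
        simp [Fin.cons_self_tail]
      have ih' := LinearMap.congr_fun ih (Finsupp.single (Fin.tail v) 1)
      simp only [LinearMap.comp_apply, LinearMap.sub_apply] at ih'
      simp only [LinearMap.comp_apply, LinearMap.sub_apply]
      rw [hv, lprism_cone, map_sub, lbd_lcone, lbd_lcone, lbd_lcone, ih', lbd_lcone, lbd_lmp]
      simp only [map_sub, lprism_cone, ← lcone_lmp]
      abel
  exact LinearMap.congr_fun this c

lemma lbd_lprism_zero (c : LC R 0 V) : lbd R (lprism R V 0 c) =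
    lmp R (fun x => (x, true)) c - lmp R (fun x => (x, false)) c := by
  have : (lbd R).comp (lprism R V 0) = lmp R (fun x => (x, true)) - lmp R (fun x => (x, false)) :=
    lc_ext fun v => by
      obtain ⟨a, rfl⟩ : ∃ a : V, v = (fun _ => a) := ⟨v 0, by funext i; fin_cases i; rfl⟩
      simp only [LinearMap.comp_apply, LinearMap.sub_apply, lprism_zero, lmp_single,
        Function.comp_def, lbd_lcone_zero]
  exact LinearMap.congr_fun this c

end Toolkit
end
noncomputable section
open Finset

section Real
variable {R : Type} [CommRing R] {X Y : Type} [TopologicalSpace X] [TopologicalSpace Y] {n m : ℕ}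

instance tsimplexCompact : CompactSpace (TSimplex n) :=
  isCompact_iff_compactSpace.1 (isCompact_stdSimplex ℝ (Fin (n + 1)))

class Cvx (K : Type) [TopologicalSpace K] where
  E : Type
  [i1 : NormedAddCommGroup E]
  [i2 : NormedSpace ℝ E]
  e : K → E
  emb : Topology.IsEmbedding e
  conv : Convex ℝ (Set.range e)
attribute [instance] Cvx.i1 Cvx.i2

variable {K L : Type} [TopologicalSpace K] [TopologicalSpace L] [Cvx K] [Cvx L]

lemma bar_ex (v : Fin (n + 1) → K) (x : TSimplex n) :
    ∃ y : K, Cvx.e y = ∑ j, x.1 j • Cvx.e (v j) :=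
  Cvx.conv.sum_mem (fun i _ => x.2.1 i) x.2.2 (fun i _ => ⟨v i, rfl⟩)

/-- affine simplex with given vertices -/
def bar (v : Fin (n + 1) → K) : C(TSimplex n, K) where
  toFun x := (bar_ex v x).choose
  continuous_toFun := by
    rw [Cvx.emb.continuous_iff]
    have : (Cvx.e ∘ fun x => (bar_ex v x).choose) = fun x : TSimplex n => ∑ j, x.1 j • Cvx.e (v j) :=
      funext fun x => (bar_ex v x).choose_spec
    rw [this]
    exact continuous_finset_sum _ fun j _ =>
      ((continuous_apply j).comp continuous_subtype_val).smul continuous_const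

lemma e_bar (v : Fin (n + 1) → K) (x : TSimplex n) :
    Cvx.e (bar v x) = ∑ j, x.1 j • Cvx.e (v j) := (bar_ex v x).choose_spec

lemma face_sum {E : Type*} [AddCommGroup E] [Module ℝ E] (i : Fin (n + 2)) (x : TSimplex n)
    (w : Fin (n + 2) → E) :
    ∑ j, (faceMap i x).1 j • w j = ∑ k, x.1 k • w (i.succAbove k) := by
  rw [← Finset.sum_fiberwise_of_maps_to (g := i.succAbove) (t := univ) (fun k _ => mem_univ _)]
  refine Finset.sum_congr rfl fun j _ => ?_
  change (∑ k ∈ univ.filter (fun k => i.succAbove k = j), x.1 k) • w j = _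
  rw [Finset.sum_smul]
  refine Finset.sum_congr rfl fun k hk => ?_
  rw [(Finset.mem_filter.1 hk).2]

lemma bar_face (v : Fin (n + 2) → K) (i : Fin (n + 2)) :
    (bar v).comp (faceMap i) = bar (v ∘ i.succAbove) := by
  ext x
  apply Cvx.emb.injective
  rw [ContinuousMap.comp_apply, e_bar, e_bar, face_sum]; rfl

def IsAff (f : K → L) : Prop := ∀ (n : ℕ) (v : Fin (n + 1) → K) (x : TSimplex n),
  f (bar v x) = bar (f ∘ v) x

lemma isAff_of {f : K → L} (g : Cvx.E K →ₗ[ℝ] Cvx.E L) (c : Cvx.E L) (h : ∀ x, Cvx.e (f x) = g (Cvx.e x) + c) :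
    IsAff f := fun n v x => by
  apply Cvx.emb.injective
  rw [h, e_bar, e_bar]
  simp only [Function.comp, h, smul_add, Finset.sum_add_distrib, ← Finset.sum_smul, x.2.2, map_sum,
    map_smul, one_smul]

/-- realization of ordered chains -/
def lreal (R : Type) [CommRing R] : LC R n K →ₗ[R] SChain R n K :=
  Finsupp.lmapDomain R R bar

@[simp] lemma lreal_single (v : Fin (n + 1) → K) (a : R) :
    lreal R (Finsupp.single v a) = Finsupp.single (bar v) a := by simp [lreal]

lemma sbdry_lreal (c : LC R (n + 1) K) : sbdry R (lreal R c) = lreal R (lbd R c) := by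
  have : (sbdry R).comp (lreal R) = (lreal R).comp (lbd R : LC R (n + 1) K →ₗ[R] _) :=
    lc_ext fun v => by simp [bar_face]
  exact LinearMap.congr_fun this c

lemma cmap_lreal {f : C(K, L)} (hf : IsAff f) (c : LC R n K) :
    cmap R f (lreal R c) = lreal R (lmp R f c) := by
  have : (cmap R f).comp (lreal R) = (lreal R).comp (lmp R f : LC R n K →ₗ[R] _) :=
    lc_ext fun v => by
      simp only [LinearMap.comp_apply, lreal_single, cmap_single, lmp_single]
      congr 1; ext x; exact hf n v x
  exact LinearMap.congr_fun this c

instance : Cvx (TSimplex m) where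
  E := Fin (m + 1) → ℝ
  e := Subtype.val
  emb := Topology.IsEmbedding.subtypeVal
  conv := by
    have : Set.range (Subtype.val : TSimplex m → _) = stdSimplex ℝ (Fin (m + 1)) :=
      Subtype.range_val_subtype
    exact this ▸ convex_stdSimplex ℝ (Fin (m + 1))

instance : Cvx unitInterval where
  E := ℝ
  e := Subtype.val
  emb := Topology.IsEmbedding.subtypeVal
  conv := by rw [Subtype.range_val]; exact convex_Icc 0 1

instance (priority := 50) cvxNormed {E : Type} [NormedAddCommGroup E] [NormedSpace ℝ E] : Cvx E where
  E := E
  e := id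
  emb := Topology.IsEmbedding.id
  conv := by rw [Set.range_id]; exact convex_univ

instance : Cvx (K × L) where
  E := Cvx.E K × Cvx.E L
  e := Prod.map Cvx.e Cvx.e
  emb := Cvx.emb.prodMap Cvx.emb
  conv := by rw [Set.range_prodMap]; exact Cvx.conv.prod Cvx.conv

lemma bar_prod (v : Fin (n + 1) → K × L) (x : TSimplex n) :
    bar v x = (bar (Prod.fst ∘ v) x, bar (Prod.snd ∘ v) x) := by
  apply Cvx.emb.injective
  change Cvx.e (bar v x) = (Cvx.e (bar (Prod.fst ∘ v) x), Cvx.e (bar (Prod.snd ∘ v) x))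
  rw [e_bar, e_bar, e_bar]
  refine Prod.ext ?_ ?_
  · rw [Prod.fst_sum]; rfl
  · rw [Prod.snd_sum]; rfl

lemma bar_const (k : K) (x : TSimplex n) : bar (fun _ => k) x = k := by
  apply Cvx.emb.injective
  rw [e_bar, ← Finset.sum_smul, x.2.2, one_smul]

lemma IsAff.prodMap {K' L' : Type} [TopologicalSpace K'] [TopologicalSpace L'] [Cvx K'] [Cvx L']
    {f : K → L} {g : K' → L'} (hf : IsAff f) (hg : IsAff g) : IsAff (Prod.map f g) :=
  fun n v x => by rw [bar_prod, bar_prod, Prod.map, hf, hg]; rfl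

lemma isAff_fst : IsAff (Prod.fst : K × L → K) := fun n v x => by rw [bar_prod]
lemma isAff_snd : IsAff (Prod.snd : K × L → L) := fun n v x => by rw [bar_prod]
lemma isAff_mk (l : L) : IsAff (fun k : K => (k, l)) := fun n v x => by
  rw [bar_prod]; exact Prod.ext rfl (bar_const l x).symm
lemma isAff_const (l : L) : IsAff (fun k : K => l) := fun n v x => (bar_const l x).symm
lemma isAff_id : IsAff (id : K → K) := fun n v x => rfl

lemma isAff_bar (v : Fin (n + 1) → K) : IsAff (bar v) := fun m w x => by
  apply Cvx.emb.injective
  rw [e_bar, e_bar]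
  simp only [Function.comp, e_bar, Finset.smul_sum, smul_smul]
  rw [Finset.sum_comm]
  refine Finset.sum_congr rfl fun j _ => ?_
  rw [← Finset.sum_smul]
  congr 1
  have := congrFun (e_bar w x) j
  change (bar w x).1 j = _ at this
  rw [this, Finset.sum_apply]; rfl

lemma bar_vertex : bar (vertexPt : Fin (n + 1) → TSimplex n) = ContinuousMap.id _ := by
  ext x
  apply Subtype.ext
  refine (e_bar vertexPt x).trans ?_
  funext i
  rw [Finset.sum_apply]
  change ∑ j, x.1 j * (if i = j then 1 else 0) = x.1 i
  simp

lemma bar_apply_vertex (v : Fin (n + 1) → K) (j : Fin (n + 1)) : bar v (vertexPt j) = v j := by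
  apply Cvx.emb.injective
  rw [e_bar]
  change ∑ i, (if i = j then (1 : ℝ) else 0) • _ = _
  simp

lemma bar_comp (v : Fin (n + 1) → K) (w : Fin (m + 1) → TSimplex n) :
    (bar v).comp (bar w) = bar (bar v ∘ w) := ContinuousMap.ext fun x => isAff_bar v m w x

lemma faceMap_eq_bar (i : Fin (n + 2)) : faceMap i = bar (vertexPt ∘ i.succAbove) := by
  rw [← bar_face, bar_vertex]; rfl

lemma isAff_face (i : Fin (n + 2)) : IsAff (faceMap i : TSimplex n → _) := by
  rw [faceMap_eq_bar]; exact isAff_bar _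

lemma face_vertex (i : Fin (n + 2)) : faceMap i ∘ vertexPt = vertexPt ∘ i.succAbove := by
  rw [faceMap_eq_bar]; funext j; exact bar_apply_vertex _ j

/-- fundamental ordered simplex -/
def iot (R : Type) [CommRing R] (n : ℕ) : LC R n (TSimplex n) := Finsupp.single vertexPt 1

/-- operators on singular chains induced by an ordered chain -/
def opr (Φ : LC R m (TSimplex n)) : SChain R n X →ₗ[R] SChain R m X :=
  Finsupp.lsum R fun σ => LinearMap.toSpanSingleton R _ (cmap R σ (lreal R Φ))

@[simp] lemma opr_single (Φ : LC R m (TSimplex n)) (σ : SingSimplex n X) :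
    opr Φ (Finsupp.single σ 1) = cmap R σ (lreal R Φ) := by simp [opr]

lemma opr_iot (c : SChain R n X) : opr (iot R n) c = c := by
  have : opr (iot R n) = (LinearMap.id : SChain R n X →ₗ[R] _) := chain_ext fun σ => by
    simp [iot, bar_vertex]
  exact LinearMap.congr_fun this c

lemma sbdry_opr (Φ : LC R (m + 1) (TSimplex n)) (c : SChain R n X) :
    sbdry R (opr Φ c) = opr (lbd R Φ) c := by
  have : (sbdry R).comp (opr Φ) = (opr (lbd R Φ) : SChain R n X →ₗ[R] _) := chain_ext fun σ => by
    simp [sbdry_cmap, sbdry_lreal]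
  exact LinearMap.congr_fun this c

lemma opr_sbdry (Φ : LC R m (TSimplex n)) (c : SChain R (n + 1) X) :
    opr Φ (sbdry R c) = opr (∑ i : Fin (n + 2), ((-1 : ℤ) ^ (i : ℕ)) • lmp R (faceMap i) Φ) c := by
  have : (opr Φ).comp (sbdry R) = (opr (∑ i : Fin (n + 2),
    ((-1 : ℤ) ^ (i : ℕ)) • lmp R (faceMap i) Φ) : SChain R (n + 1) X →ₗ[R] _) := chain_ext fun σ => by
    simp only [LinearMap.comp_apply, sbdry_single, map_sum, map_zsmul, opr_single,
      ← cmap_lreal (isAff_face _), cmap_cmap]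
  exact LinearMap.congr_fun this c

lemma opr_mem {A : Set X} (Φ : LC R m (TSimplex n)) {c : SChain R n X} (h : c ∈ suppOn R n A) :
    opr Φ c ∈ suppOn R m A := by
  have : suppOn R n A ≤ (suppOn R m A).comap (opr Φ) := suppOn_le fun σ hσ => by
    rw [Submodule.mem_comap, opr_single]
    exact cmap_mem' (fun x => hσ ⟨x, rfl⟩) _
  exact this h

lemma cmap_opr (f : C(X, Y)) (Φ : LC R m (TSimplex n)) (c : SChain R n X) :
    cmap R f (opr Φ c) = opr Φ (cmap R f c) := by
  have : (cmap R f).comp (opr Φ) = (opr Φ).comp (cmap R f : SChain R n X →ₗ[R] _) :=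
    chain_ext fun σ => by simp [cmap_cmap]
  exact LinearMap.congr_fun this c

lemma sum_face_iot : ∑ i : Fin (n + 2), ((-1 : ℤ) ^ (i : ℕ)) • lmp R (faceMap i) (iot R n) =
    lbd R (iot R (n + 1)) := by
  simp only [iot, lmp_single, lbd_single, face_vertex]

lemma sbdry_sbdry (c : SChain R (n + 2) X) : sbdry R (sbdry R c) = 0 := by
  conv_lhs => rw [← opr_iot c]
  rw [sbdry_opr, sbdry_opr, lbd_lbd]
  have : (opr 0 : SChain R (n + 2) X →ₗ[R] SChain R n X) = 0 := chain_ext fun σ => by simp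
  rw [this]; rfl

/-! prism -/
def b2I (b : Bool) : unitInterval := if b then 1 else 0

/-- prism chains in `X × I` -/
def prism (R : Type) [CommRing R] {n : ℕ} {X : Type} [TopologicalSpace X] :
    SChain R n X →ₗ[R] SChain R (n + 1) (X × unitInterval) :=
  Finsupp.lsum R fun σ => LinearMap.toSpanSingleton R _
    (cmap R (σ.prodMap (ContinuousMap.id _))
      (lreal R (lmp R (Prod.map id b2I) (lprism R _ n (iot R n)))))

@[simp] lemma prism_single (σ : SingSimplex n X) : prism R (Finsupp.single σ 1) =
    cmap R (σ.prodMap (ContinuousMap.id _))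
      (lreal R (lmp R (Prod.map id b2I) (lprism R _ n (iot R n)))) := by simp [prism]

lemma lmp_lmp {U V W : Type} (f : U → V) (g : V → W) (c : LC R n U) :
    lmp R g (lmp R f c) = lmp R (g ∘ f) c := by
  have : (lmp R g).comp (lmp R f) = (lmp R (g ∘ f) : LC R n U →ₗ[R] _) :=
    lc_ext fun v => by simp [Function.comp_assoc]
  exact LinearMap.congr_fun this c

def inI (t : unitInterval) : C(X, X × unitInterval) := ⟨fun x => (x, t), by fun_prop⟩

lemma aux_inI (σ : SingSimplex n X) (b : Bool) :
    cmap R (σ.prodMap (ContinuousMap.id _)) (lreal R (lmp R (Prod.map id b2I)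
      (lmp R (fun x => (x, b)) (iot R n)))) = Finsupp.single ((inI (b2I b)).comp σ) 1 := by
  rw [lmp_lmp]
  have : (Prod.map id b2I ∘ fun x : TSimplex n => (x, b)) = inI (b2I b) := rfl
  rw [this, ← cmap_lreal (isAff_mk _), iot, lreal_single, bar_vertex]
  simp only [cmap_single]; rfl

lemma prism_bd_aux (c : SChain R (n + 1) X) : prism R (sbdry R c) =
    (Finsupp.lsum R fun σ => LinearMap.toSpanSingleton R _ (cmap R (σ.prodMap (ContinuousMap.id _))
      (lreal R (lmp R (Prod.map id b2I) (lprism R _ n (lbd R (iot R (n + 1)))))))) c := by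
  refine LinearMap.congr_fun (f := (prism R).comp (sbdry R)) (chain_ext fun σ => ?_) c
  simp only [LinearMap.comp_apply, sbdry_single, map_sum, map_zsmul, prism_single, Finsupp.lsum_single,
    LinearMap.toSpanSingleton_apply, one_smul]
  rw [← sum_face_iot]
  simp only [map_sum, map_zsmul, lprism_nat]
  refine Finset.sum_congr rfl fun i _ => congrArg _ ?_
  rw [lmp_lmp]
  have : Prod.map id b2I ∘ Prod.map (faceMap i : TSimplex n → _) id =
    ((faceMap i).prodMap (ContinuousMap.id unitInterval)) ∘ Prod.map id b2I := rfl
  rw [this, ← lmp_lmp, ← cmap_lreal (IsAff.prodMap (isAff_face i) isAff_id), cmap_cmap]; rfl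

lemma sbdry_prism (c : SChain R (n + 1) X) :
    sbdry R (prism R c) = cmap R (inI 1) c - cmap R (inI 0) c - prism R (sbdry R c) := by
  rw [prism_bd_aux]
  refine LinearMap.congr_fun (f := (sbdry R).comp (prism R)) (g := cmap R (inI 1) - cmap R (inI 0) - _)
    (chain_ext fun σ => ?_) c
  simp only [LinearMap.comp_apply, LinearMap.sub_apply, prism_single, Finsupp.lsum_single,
    LinearMap.toSpanSingleton_apply, one_smul, cmap_single]
  rw [sbdry_cmap, sbdry_lreal, lbd_lmp, lbd_lprism]
  simp only [map_sub, aux_inI]; rfl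

lemma sbdry_prism_zero (c : SChain R 0 X) :
    sbdry R (prism R c) = cmap R (inI 1) c - cmap R (inI 0) c := by
  refine LinearMap.congr_fun (f := (sbdry R).comp (prism R)) (g := cmap R (inI 1) - cmap R (inI 0))
    (chain_ext fun σ => ?_) c
  simp only [LinearMap.comp_apply, LinearMap.sub_apply, prism_single, cmap_single]
  rw [sbdry_cmap, sbdry_lreal, lbd_lmp, lbd_lprism_zero]
  simp only [map_sub, aux_inI]; rfl

lemma prism_mem {A : Set X} {c : SChain R n X} (h : c ∈ suppOn R n A) :
    prism R c ∈ suppOn R (n + 1) (A ×ˢ (Set.univ : Set unitInterval)) := by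
  have : suppOn R n A ≤ (suppOn R (n + 1) (A ×ˢ (Set.univ : Set unitInterval))).comap (prism R) :=
    suppOn_le fun σ hσ => by
      rw [Submodule.mem_comap, prism_single]
      refine cmap_mem' (fun x => ?_) _
      exact ⟨hσ ⟨x.1, rfl⟩, trivial⟩
  exact this h
end Real
end
noncomputable section
open Finset

section Sd
variable {R : Type} [CommRing R] {X Y : Type} [TopologicalSpace X] [TopologicalSpace Y] {n m : ℕ}
variable {K L : Type} [TopologicalSpace K] [TopologicalSpace L] [Cvx K] [Cvx L]

lemma map_supp {α M : Type*} [AddCommGroup M] [Module R M] {S : Set α} {P : Submodule R M}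
    (f : (α →₀ R) →ₗ[R] M) (h : ∀ v ∈ S, f (Finsupp.single v 1) ∈ P) {c : α →₀ R}
    (hc : c ∈ Finsupp.supported R R S) : f c ∈ P := by
  have : Finsupp.supported R R S ≤ P.comap f := by
    rw [Finsupp.supported_eq_span_single, Submodule.span_le]
    rintro _ ⟨v, hv, rfl⟩; exact h v hv
  exact this hc

def bctr (n : ℕ) : TSimplex n := ⟨fun _ => 1 / (n + 1), fun _ => by positivity, by
  simp; field_simp⟩
def bary (v : Fin (n + 1) → K) : K := bar v (bctr n)

def lsd (R : Type) [CommRing R] (K : Type) [TopologicalSpace K] [Cvx K] :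
    (n : ℕ) → LC R n K →ₗ[R] LC R n K
  | 0 => LinearMap.id
  | n + 1 => Finsupp.lsum R fun v => LinearMap.toSpanSingleton R _
      (lcone R (bary v) (lsd R K n (lbd R (Finsupp.single v 1))))

def lT (R : Type) [CommRing R] (K : Type) [TopologicalSpace K] [Cvx K] :
    (n : ℕ) → LC R n K →ₗ[R] LC R (n + 1) K
  | 0 => 0
  | n + 1 => Finsupp.lsum R fun v => LinearMap.toSpanSingleton R _
      (lcone R (bary v) (Finsupp.single v 1 - lT R K n (lbd R (Finsupp.single v 1))))

lemma lsd_single (v : Fin (n + 2) → K) : lsd R K (n + 1) (Finsupp.single v 1) =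
    lcone R (bary v) (lsd R K n (lbd R (Finsupp.single v 1))) := by
  simp only [lsd, Finsupp.lsum_single, LinearMap.toSpanSingleton_apply, one_smul]
lemma lT_single (v : Fin (n + 2) → K) : lT R K (n + 1) (Finsupp.single v 1) =
    lcone R (bary v) (Finsupp.single v 1 - lT R K n (lbd R (Finsupp.single v 1))) := by
  simp only [lT, Finsupp.lsum_single, LinearMap.toSpanSingleton_apply, one_smul]

lemma lbd_lsd (c : LC R (n + 1) K) : lbd R (lsd R K (n + 1) c) = lsd R K n (lbd R c) := by
  refine LinearMap.congr_fun (f := (lbd R).comp (lsd R K (n + 1))) (g := (lsd R K n).comp (lbd R)) ?_ c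
  clear c
  induction n with
  | zero =>
    refine lc_ext fun v => ?_
    simp only [LinearMap.comp_apply]
    rw [lsd_single]
    exact lbd_lcone_bd _ _
  | succ n ih =>
    refine lc_ext fun v => ?_
    have ih' := LinearMap.congr_fun ih (lbd R (Finsupp.single v 1))
    simp only [LinearMap.comp_apply] at ih' ⊢
    rw [lsd_single, lbd_lcone, ih', lbd_lbd]; simp

lemma lbd_lT (c : LC R (n + 1) K) : lbd R (lT R K (n + 1) c) =
    c - lsd R K (n + 1) c - lT R K n (lbd R c) := by
  refine LinearMap.congr_fun (f := (lbd R).comp (lT R K (n + 1)))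
    (g := LinearMap.id - lsd R K (n + 1) - (lT R K n).comp (lbd R)) ?_ c
  clear c
  induction n with
  | zero =>
    refine lc_ext fun v => ?_
    simp only [LinearMap.comp_apply, LinearMap.sub_apply, LinearMap.id_apply]
    rw [lsd_single, lT_single]
    simp only [lT, LinearMap.zero_apply, sub_zero, lsd, LinearMap.id_apply]
    exact lbd_lcone _ _
  | succ n ih =>
    refine lc_ext fun v => ?_
    have ih' := LinearMap.congr_fun ih (lbd R (Finsupp.single v 1))
    simp only [LinearMap.comp_apply, LinearMap.sub_apply, LinearMap.id_apply] at ih' ⊢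
    rw [lsd_single, lT_single, lbd_lcone, map_sub, ih', lbd_lbd, map_zero, sub_zero, sub_sub_cancel]
    abel

lemma bary_aff {f : K → L} (hf : IsAff f) (v : Fin (n + 1) → K) : f (bary v) = bary (f ∘ v) := hf _ _ _

lemma lsd_nat {f : K → L} (hf : IsAff f) (c : LC R n K) :
    lsd R L n (lmp R f c) = lmp R f (lsd R K n c) := by
  refine LinearMap.congr_fun (f := (lsd R L n).comp (lmp R f)) (g := (lmp R f).comp (lsd R K n)) ?_ c
  clear c
  induction n with
  | zero => rfl
  | succ n ih =>
    refine lc_ext fun v => ?_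
    have ih' := LinearMap.congr_fun ih (lbd R (Finsupp.single v 1))
    simp only [LinearMap.comp_apply] at ih' ⊢
    rw [lmp_single, lsd_single, ← bary_aff hf, ← lmp_single, lbd_lmp, ih', lsd_single, lcone_lmp]

lemma lT_nat {f : K → L} (hf : IsAff f) (c : LC R n K) :
    lT R L n (lmp R f c) = lmp R f (lT R K n c) := by
  refine LinearMap.congr_fun (f := (lT R L n).comp (lmp R f)) (g := (lmp R f).comp (lT R K n)) ?_ c
  clear c
  induction n with
  | zero => simp [lT]
  | succ n ih =>
    refine lc_ext fun v => ?_
    have ih' := LinearMap.congr_fun ih (lbd R (Finsupp.single v 1))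
    simp only [LinearMap.comp_apply] at ih' ⊢
    rw [lmp_single, lT_single, ← bary_aff hf, ← lmp_single, lbd_lmp, ih', lT_single, ← map_sub, lcone_lmp]

/-- iterated subdivision of singular chains -/
def sd (R : Type) [CommRing R] {n : ℕ} {X : Type} [TopologicalSpace X] : SChain R n X →ₗ[R] SChain R n X :=
  opr (lsd R _ n (iot R n))
def sdT (R : Type) [CommRing R] {n : ℕ} {X : Type} [TopologicalSpace X] :
    SChain R n X →ₗ[R] SChain R (n + 1) X := opr (lT R _ n (iot R n))

lemma opr_sub (Φ Ψ : LC R m (TSimplex n)) (c : SChain R n X) : opr (Φ - Ψ) c = opr Φ c - opr Ψ c := by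
  refine LinearMap.congr_fun (f := opr (Φ - Ψ)) (g := opr Φ - opr Ψ) (chain_ext fun σ => ?_) c
  simp

lemma sbdry_sd (c : SChain R (n + 1) X) : sbdry R (sd R c) = sd R (sbdry R c) := by
  rw [sd, sbdry_opr, lbd_lsd, sd, opr_sbdry, ← sum_face_iot]
  simp only [map_sum, map_zsmul, lsd_nat (isAff_face _)]

lemma sbdry_sdT (c : SChain R (n + 1) X) :
    sbdry R (sdT R c) = c - sd R c - sdT R (sbdry R c) := by
  rw [sdT, sbdry_opr, lbd_lT, opr_sub, opr_sub, opr_iot, sdT, opr_sbdry, ← sum_face_iot, sd]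
  simp only [map_sum, map_zsmul, lT_nat (isAff_face _)]

lemma sd_zero (c : SChain R 0 X) : sd R c = c := by
  rw [sd]; exact opr_iot c

lemma sd_iter (k : ℕ) (c : SChain R n X) : (sd R)^[k] c = opr ((lsd R _ n)^[k] (iot R n)) c := by
  induction k generalizing c with
  | zero => simp [opr_iot]
  | succ k ih =>
    rw [Function.iterate_succ_apply', ih, Function.iterate_succ_apply']
    refine LinearMap.congr_fun (f := (sd R).comp (opr ((lsd R _ n)^[k] (iot R n))))
      (g := opr (lsd R _ n ((lsd R _ n)^[k] (iot R n)))) (chain_ext fun σ => ?_) c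
    simp only [LinearMap.comp_apply, opr_single]
    rw [sd, ← cmap_opr]
    congr 1
    refine LinearMap.congr_fun (f := (opr (lsd R _ n (iot R n)) :
        SChain R n (TSimplex n) →ₗ[R] _).comp (lreal R))
      (g := (lreal R).comp (lsd R _ n)) (lc_ext fun v => ?_) _
    simp only [LinearMap.comp_apply, lreal_single, opr_single]
    rw [cmap_lreal (isAff_bar v), ← lsd_nat (isAff_bar v), iot, lmp_single]
    congr 3; funext j; exact bar_apply_vertex v j

/-! mesh -/
def smallv (n : ℕ) (S : Set K) (d : ℝ) : Set (Fin (n + 1) → K) :=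
  {v | (∀ i, v i ∈ S) ∧ ∀ i j, ‖Cvx.e (v i) - Cvx.e (v j)‖ ≤ d}

lemma bar_face_range (v : Fin (n + 2) → K) (i : Fin (n + 2)) :
    Set.range (bar (v ∘ i.succAbove)) ⊆ Set.range (bar v) := by
  rw [← bar_face]; rintro _ ⟨x, rfl⟩; exact ⟨_, rfl⟩

lemma norm_bar_sub (v : Fin (n + 1) → K) (x : TSimplex n) (y : K) (d : ℝ)
    (h : ∀ j, ‖Cvx.e (v j) - Cvx.e y‖ ≤ d) : ‖Cvx.e (bar v x) - Cvx.e y‖ ≤ d := by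
  have h1 : Cvx.e (bar v x) - Cvx.e y = ∑ j, x.1 j • (Cvx.e (v j) - Cvx.e y) := by
    simp only [e_bar, smul_sub, Finset.sum_sub_distrib, ← Finset.sum_smul, x.2.2, one_smul]
  rw [h1]
  refine (norm_sum_le _ _).trans ?_
  calc ∑ j, ‖x.1 j • (Cvx.e (v j) - Cvx.e y)‖ ≤ ∑ j, x.1 j * d := by
        refine Finset.sum_le_sum fun j _ => ?_
        rw [norm_smul, Real.norm_of_nonneg (x.2.1 j)]
        exact mul_le_mul_of_nonneg_left (h j) (x.2.1 j)
    _ = d := by rw [← Finset.sum_mul, x.2.2, one_mul]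

lemma norm_bary_sub (v : Fin (n + 1) → K) (d : ℝ)
    (h : ∀ i j, ‖Cvx.e (v i) - Cvx.e (v j)‖ ≤ d) (j) :
    ‖Cvx.e (v j) - Cvx.e (bary v)‖ ≤ n / (n + 1) * d := by
  have h1 : Cvx.e (v j) - Cvx.e (bary v) = ∑ i, (1 / (n + 1) : ℝ) • (Cvx.e (v j) - Cvx.e (v i)) := by
    rw [bary, e_bar]
    simp only [smul_sub, Finset.sum_sub_distrib, ← Finset.sum_smul, bctr]
    congr 1
    rw [Finset.sum_const, card_univ, Fintype.card_fin, nsmul_eq_mul]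
    push_cast
    rw [mul_one_div_cancel (by positivity), one_smul]
  rw [h1, ← Finset.sum_erase univ (a := j) (by simp)]
  refine (norm_sum_le _ _).trans ?_
  calc _ ≤ ∑ i ∈ univ.erase j, (1 / (n + 1) : ℝ) * d := by
        refine Finset.sum_le_sum fun i _ => ?_
        rw [norm_smul, Real.norm_of_nonneg (by positivity)]
        exact mul_le_mul_of_nonneg_left (h _ _) (by positivity)
    _ = _ := by
        rw [Finset.sum_const, card_erase_of_mem (mem_univ _), card_univ, Fintype.card_fin, nsmul_eq_mul]
        push_cast [Nat.add_sub_cancel]; ring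

lemma lsd_small (v : Fin (n + 1) → K) (d : ℝ) (h : ∀ i j, ‖Cvx.e (v i) - Cvx.e (v j)‖ ≤ d) :
    lsd R K n (Finsupp.single v 1) ∈
      Finsupp.supported R R (smallv n (Set.range (bar v)) (n / (n + 1) * d)) := by
  induction n with
  | zero =>
    refine Finsupp.single_mem_supported R 1 ⟨fun i => ⟨vertexPt i, bar_apply_vertex v i⟩, fun i j => ?_⟩
    rw [Subsingleton.elim (α := Fin 1) i j]; simp
  | succ n ih =>
    have hd : 0 ≤ d := (norm_nonneg _).trans (h 0 0)
    rw [lsd_single, lbd_single, map_sum, map_sum]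
    refine Submodule.sum_mem _ fun i _ => ?_
    rw [map_zsmul, map_zsmul]
    refine zsmul_mem ?_ _
    have := ih (v ∘ i.succAbove) (fun _ _ => h _ _)
    refine map_supp (lcone R (bary v)) ?_ this
    rintro w ⟨hw, hw'⟩
    rw [lcone_single]
    have hle : (n : ℝ) / (n + 1) * d ≤ ((n + 1 : ℕ) : ℝ) / ((n + 1 : ℕ) + 1) * d := by
      refine mul_le_mul_of_nonneg_right ?_ hd
      rw [div_le_div_iff₀ (by positivity) (by positivity)]; push_cast; nlinarith
    have hb : ∀ k, ‖Cvx.e (w k) - Cvx.e (bary v)‖ ≤ ((n + 1 : ℕ) : ℝ) / ((n + 1 : ℕ) + 1) * d := by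
      intro k
      obtain ⟨x, hx⟩ := bar_face_range v i (hw k)
      rw [← hx]
      exact norm_bar_sub v x _ _ (norm_bary_sub v d h)
    refine Finsupp.single_mem_supported R 1 ⟨fun k => ?_, fun k l => ?_⟩
    · refine Fin.cases ⟨_, rfl⟩ (fun k => bar_face_range v i (hw k)) k
    · refine Fin.cases ?_ (fun k => ?_) k <;> refine Fin.cases ?_ (fun l => ?_) l
      · simp only [Fin.cons_zero, sub_self, norm_zero]; positivity
      · simp only [Fin.cons_zero, Fin.cons_succ]; rw [norm_sub_rev]; exact hb l
      · simp only [Fin.cons_zero, Fin.cons_succ]; exact hb k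
      · simp only [Fin.cons_succ]; exact (hw' k l).trans hle

lemma lsd_iter_small (d : ℝ) (c : LC R n K) (hc : c ∈ Finsupp.supported R R (smallv n Set.univ d)) (k : ℕ) :
    (lsd R K n)^[k] c ∈ Finsupp.supported R R (smallv n Set.univ ((n / (n + 1) : ℝ) ^ k * d)) := by
  induction k with
  | zero => simpa using hc
  | succ k ih =>
    rw [Function.iterate_succ_apply']
    refine map_supp (lsd R K n) ?_ ih
    rintro v ⟨-, hv⟩
    refine Finsupp.supported_mono ?_ (lsd_small v _ hv)
    rintro w ⟨-, hw⟩
    exact ⟨fun _ => trivial, fun i j => (hw i j).trans (by rw [pow_succ]; ring_nf; rfl)⟩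

lemma single_small (U V : Set X) (hU : IsOpen U) (hV : IsOpen V) (σ : SingSimplex n X)
    (h : Set.range σ ⊆ U ∪ V) : ∃ m, (sd R)^[m] (Finsupp.single σ (1 : R)) ∈ suppOn R n U ⊔ suppOn R n V := by
  letI : MetricSpace (TSimplex n) := inferInstanceAs (MetricSpace {x : Fin (n + 1) → ℝ // _})
  obtain ⟨δ, hδ, hL⟩ := lebesgue_number_lemma_of_metric (s := Set.univ) (c := fun b : Bool =>
    σ ⁻¹' (if b then U else V)) isCompact_univ (fun b => by
      cases b <;> exact IsOpen.preimage σ.continuous (by simpa)) (fun x _ => by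
      rcases h ⟨x, rfl⟩ with hx | hx
      · exact Set.mem_iUnion.2 ⟨true, hx⟩
      · exact Set.mem_iUnion.2 ⟨false, hx⟩)
  have h0 : iot R n ∈ Finsupp.supported R R (smallv n Set.univ 1) := by
    refine Finsupp.single_mem_supported R 1 ⟨fun _ => trivial, fun i j => ?_⟩
    refine (pi_norm_le_iff_of_nonneg zero_le_one).2 fun k => ?_
    change ‖(if k = i then (1 : ℝ) else 0) - (if k = j then 1 else 0)‖ ≤ 1
    split_ifs <;> simp
  obtain ⟨m, hm⟩ : ∃ m : ℕ, (n / (n + 1) : ℝ) ^ m * 1 < δ := by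
    have := exists_pow_lt_of_lt_one hδ (y := (n / (n + 1) : ℝ)) (by
      rw [div_lt_one (by positivity)]; linarith)
    simpa using this
  refine ⟨m, ?_⟩
  rw [sd_iter, opr_single]
  refine map_supp ((cmap R σ).comp (lreal R)) ?_ (lsd_iter_small 1 _ h0 m)
  rintro v ⟨-, hv⟩
  simp only [LinearMap.comp_apply, lreal_single, cmap_single]
  obtain ⟨b, hb⟩ := hL (v 0) trivial
  have hr : Set.range (σ.comp (bar v)) ⊆ if b then U else V := by
    rintro _ ⟨x, rfl⟩
    refine hb (Metric.mem_ball.2 (lt_of_le_of_lt ?_ hm))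
    change dist (bar v x).1 (v 0).1 ≤ _
    rw [dist_eq_norm]
    exact norm_bar_sub v x (v 0) _ (fun j => hv j 0)
  cases b
  · exact Submodule.mem_sup_right (single_mem_suppOn hr 1)
  · exact Submodule.mem_sup_left (single_mem_suppOn hr 1)

lemma sd_mem {A : Set X} {c : SChain R n X} (h : c ∈ suppOn R n A) : sd R c ∈ suppOn R n A := opr_mem _ h
lemma sdT_mem {A : Set X} {c : SChain R n X} (h : c ∈ suppOn R n A) : sdT R c ∈ suppOn R (n + 1) A :=
  opr_mem _ h

lemma supmap {U V : Set X} {l : ℕ} (f : SChain R n X →ₗ[R] SChain R l X)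
    (hf : ∀ A : Set X, ∀ c ∈ suppOn R n A, f c ∈ suppOn R l A) {c : SChain R n X}
    (h : c ∈ suppOn R n U ⊔ suppOn R n V) : f c ∈ suppOn R l U ⊔ suppOn R l V := by
  obtain ⟨a, ha, b, hb, rfl⟩ := Submodule.mem_sup.1 h
  rw [map_add]
  exact Submodule.add_mem_sup (hf _ _ ha) (hf _ _ hb)

lemma chain_small {U V : Set X} (hU : IsOpen U) (hV : IsOpen V) {c : SChain R n X}
    (h : c ∈ suppOn R n (U ∪ V)) : ∃ m, (sd R)^[m] c ∈ suppOn R n U ⊔ suppOn R n V := by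
  have hst : ∀ (c : SChain R n X) m k, (sd R)^[m] c ∈ suppOn R n U ⊔ suppOn R n V →
      (sd R)^[k + m] c ∈ suppOn R n U ⊔ suppOn R n V := by
    intro c m k hc
    rw [Function.iterate_add_apply]
    induction k with
    | zero => exact hc
    | succ k ih => rw [Function.iterate_succ_apply']; exact supmap _ (fun _ _ => sd_mem) ih
  rw [suppOn, Finsupp.supported_eq_span_single] at h
  induction h using Submodule.span_induction with
  | mem x hx => obtain ⟨σ, hσ, rfl⟩ := hx; exact single_small U V hU hV σ hσ
  | zero => exact ⟨0, zero_mem _⟩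
  | add x y _ _ hx hy =>
    obtain ⟨a, ha⟩ := hx
    obtain ⟨b, hb⟩ := hy
    refine ⟨a + b, ?_⟩
    rw [iterate_map_add]
    exact add_mem (add_comm a b ▸ hst _ _ _ ha) (hst _ _ _ hb)
  | smul r x _ hx =>
    obtain ⟨a, ha⟩ := hx
    refine ⟨a, ?_⟩
    have : ∀ k, (sd R)^[k] (r • x) = r • (sd R)^[k] x := fun k => by
      induction k with
      | zero => rfl
      | succ k ih => rw [Function.iterate_succ_apply', ih, map_smul, Function.iterate_succ_apply']
    rw [this]; exact Submodule.smul_mem _ _ ha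

/-- small chains -/
lemma small_chains {U V : Set X} (hU : IsOpen U) (hV : IsOpen V) {c : SChain R n X}
    (h : c ∈ suppOn R n (U ∪ V)) (hb : sbdryN R n c ∈ suppOn R (n - 1) U ⊔ suppOn R (n - 1) V) :
    ∃ w ∈ suppOn R (n + 1) (U ∪ V), ∃ a ∈ suppOn R n U, ∃ b ∈ suppOn R n V, c = a + b + sbdry R w := by
  obtain ⟨m, hm⟩ := chain_small hU hV h
  suffices H : ∀ k, ∃ w ∈ suppOn R (n + 1) (U ∪ V), c - (sd R)^[k] c - sbdry R w ∈
      suppOn R n U ⊔ suppOn R n V by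
    obtain ⟨w, hw, h2⟩ := H m
    obtain ⟨a, ha, b, hb, h3⟩ := Submodule.mem_sup.1 (add_mem h2 hm)
    exact ⟨w, hw, a, ha, b, hb, by rw [h3]; abel⟩
  intro k
  cases n with
  | zero =>
    refine ⟨0, zero_mem _, ?_⟩
    have : (sd R)^[k] c = c := by
      induction k with
      | zero => rfl
      | succ k ih => rw [Function.iterate_succ_apply', ih, sd_zero]
    simp [this]
  | succ n =>
    induction k with
    | zero => exact ⟨0, zero_mem _, by simp⟩
    | succ k ih =>
      obtain ⟨w, hw, h2⟩ := ih
      set d := (sd R)^[k] c with hd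
      have hdm : d ∈ suppOn R (n + 1) (U ∪ V) ∧ sbdry R d ∈ suppOn R n U ⊔ suppOn R n V := by
        rw [hd]; clear h2 hd
        induction k with
        | zero => exact ⟨h, hb⟩
        | succ k ih =>
          rw [Function.iterate_succ_apply']
          exact ⟨sd_mem ih.1, by rw [sbdry_sd]; exact supmap _ (fun _ _ => sd_mem) ih.2⟩
      refine ⟨w + sdT R d, add_mem hw (sdT_mem hdm.1), ?_⟩
      rw [Function.iterate_succ_apply', ← hd, map_add, sbdry_sdT]
      have := add_mem h2 (supmap _ (fun _ _ => sdT_mem) hdm.2)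
      convert this using 1; abel
end Sd
end
noncomputable section
open Finset

section Loc
variable {R : Type} [CommRing R] {X Y : Type} [TopologicalSpace X] [TopologicalSpace Y] {n i : ℕ}

def nul (R : Type) [CommRing R] (n : ℕ) {X : Type} [TopologicalSpace X] (S : Set X) :
    Submodule R (SChain R n X) := suppOn R n S ⊔ LinearMap.range (sbdry R)
def cyc (R : Type) [CommRing R] (n : ℕ) {X : Type} [TopologicalSpace X] (S : Set X) :
    Submodule R (SChain R n X) := (suppOn R (n - 1) S).comap (sbdryN R n)

lemma mem_nul {S : Set X} {z : SChain R n X} :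
    z ∈ nul R n S ↔ ∃ a ∈ suppOn R n S, ∃ w, a + sbdry R w = z := by
  simp [nul, Submodule.mem_sup]
lemma mem_cyc {S : Set X} {z : SChain R n X} : z ∈ cyc R n S ↔ sbdryN R n z ∈ suppOn R (n - 1) S := Iff.rfl
lemma mem_cyc_succ {S : Set X} {z : SChain R (n + 1) X} : z ∈ cyc R (n + 1) S ↔ sbdry R z ∈ suppOn R n S :=
  Iff.rfl
lemma relH_iff {A : Set X} {z z' : SChain R n X} : RelHomologous R n A z z' ↔ z - z' ∈ nul R n A := by
  rw [mem_nul]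
  exact ⟨fun ⟨w, h⟩ => ⟨_, h, w, by abel⟩, fun ⟨a, ha, w, h⟩ => ⟨w, by rw [← h]; simpa using ha⟩⟩

lemma sbdryN_sbdry (z : SChain R (n + 1) X) : sbdryN R n (sbdry R z) = 0 := by
  cases n with
  | zero => rfl
  | succ n => exact sbdry_sbdry z
lemma sbdryN_mem {A : Set X} {c : SChain R n X} (h : c ∈ suppOn R n A) :
    sbdryN R n c ∈ suppOn R (n - 1) A := by
  cases n with
  | zero => exact zero_mem _
  | succ n => exact sbdry_mem h
lemma sbdryN_cmap (f : C(X, Y)) (c : SChain R n X) : sbdryN R n (cmap R f c) = cmap R f (sbdryN R n c) := by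
  cases n with
  | zero => exact (map_zero _).symm
  | succ n => exact sbdry_cmap f c

lemma supp_nul {S : Set X} {z : SChain R n X} (h : z ∈ suppOn R n S) : z ∈ nul R n S :=
  Submodule.mem_sup_left h
lemma supp_cyc {S : Set X} {z : SChain R n X} (h : z ∈ suppOn R n S) : z ∈ cyc R n S := sbdryN_mem h
lemma bd_nul {S : Set X} (w : SChain R (n + 1) X) : sbdry R w ∈ nul R n S :=
  Submodule.mem_sup_right ⟨w, rfl⟩
lemma bd_cyc {S : Set X} (w : SChain R (n + 1) X) : sbdry R w ∈ cyc R n S := by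
  rw [mem_cyc, sbdryN_sbdry]; exact zero_mem _
lemma nul_cyc {S : Set X} {z : SChain R n X} (h : z ∈ nul R n S) : z ∈ cyc R n S := by
  obtain ⟨a, ha, w, rfl⟩ := mem_nul.1 h
  exact add_mem (supp_cyc ha) (bd_cyc w)
lemma nul_mono {S T : Set X} (h : S ⊆ T) {z : SChain R n X} (hz : z ∈ nul R n S) : z ∈ nul R n T :=
  by
  obtain ⟨a, ha, w, rfl⟩ := mem_nul.1 hz
  exact add_mem (supp_nul (suppOn_mono h ha)) (bd_nul w)
lemma cyc_mono {S T : Set X} (h : S ⊆ T) {z : SChain R n X} (hz : z ∈ cyc R n S) : z ∈ cyc R n T :=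
  suppOn_mono h hz
lemma nul_map {A : Set X} {B : Set Y} {f : C(X, Y)} (hf : Set.MapsTo f A B) {z : SChain R n X}
    (h : z ∈ nul R n A) : cmap R f z ∈ nul R n B := by
  obtain ⟨a, ha, w, rfl⟩ := mem_nul.1 h
  rw [map_add, ← sbdry_cmap]
  exact add_mem (supp_nul (cmap_mem hf ha)) (bd_nul _)
lemma cyc_map {A : Set X} {B : Set Y} {f : C(X, Y)} (hf : Set.MapsTo f A B) {z : SChain R n X}
    (h : z ∈ cyc R n A) : cmap R f z ∈ cyc R n B := by
  rw [mem_cyc, sbdryN_cmap]; exact cmap_mem hf h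

/-- `prism` of the boundary -/
def prismb (c : SChain R n X) : SChain R n (X × unitInterval) :=
  match n, c with
  | 0, _ => 0
  | _ + 1, c => prism R (sbdry R c)

lemma sbdry_prism' (c : SChain R n X) :
    sbdry R (prism R c) = cmap R (inI 1) c - cmap R (inI 0) c - prismb c := by
  cases n with
  | zero => rw [sbdry_prism_zero]; simp [prismb]
  | succ n => exact sbdry_prism c
lemma prismb_mem {A : Set X} {c : SChain R n X} (h : c ∈ cyc R n A) :
    prismb c ∈ suppOn R n (A ×ˢ (Set.univ : Set unitInterval)) := by
  cases n with
  | zero => exact zero_mem _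
  | succ n => exact prism_mem h

/-- homotopy invariance with control of supports -/
lemma hinv' {A C : Set X} {B D : Set Y} (H : C(X × unitInterval, Y)) (f g : C(X, Y))
    (hf : ∀ x, H (x, 0) = f x) (hg : ∀ x, H (x, 1) = g x) (hA : ∀ x ∈ A, ∀ t, H (x, t) ∈ B)
    (hC : ∀ x ∈ C, ∀ t, H (x, t) ∈ D) {c : SChain R n X} (hc : c ∈ cyc R n A) (hc' : c ∈ suppOn R n C) :
    ∃ b ∈ suppOn R n B, ∃ w ∈ suppOn R (n + 1) D, cmap R g c = cmap R f c + b + sbdry R w := by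
  refine ⟨cmap R H (prismb c), cmap_mem (fun x hx => hA x.1 hx.1 x.2) (prismb_mem hc),
    cmap R H (prism R c), cmap_mem (fun x hx => hC x.1 hx.1 x.2) (prism_mem hc'), ?_⟩
  rw [sbdry_cmap, sbdry_prism', map_sub, map_sub, cmap_cmap, cmap_cmap,
    (by ext x; exact hg x : H.comp (inI 1) = g), (by ext x; exact hf x : H.comp (inI 0) = f)]
  abel

lemma hinv {A : Set X} {B : Set Y} (H : C(X × unitInterval, Y)) (f g : C(X, Y))
    (hf : ∀ x, H (x, 0) = f x) (hg : ∀ x, H (x, 1) = g x) (hA : ∀ x ∈ A, ∀ t, H (x, t) ∈ B)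
    {c : SChain R n X} (hc : c ∈ cyc R n A) : cmap R g c - cmap R f c ∈ nul R n B := by
  obtain ⟨b, hb, w, -, h⟩ := hinv' (D := Set.univ) H f g hf hg hA (fun _ _ _ => trivial) hc (suppOn_univ c)
  rw [h, add_assoc, add_sub_cancel_left]
  exact add_mem (supp_nul hb) (bd_nul w)

/-- local homology is that of `ℝⁿ` -/
structure LH (R : Type) [CommRing R] (n : ℕ) (X : Type) [TopologicalSpace X] (p : X) : Prop where
  van : ∀ i, n < i → ∀ z ∈ cyc R i ({p}ᶜ : Set X), z ∈ nul R i ({p}ᶜ : Set X)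
  gen : ∃ g ∈ cyc R n ({p}ᶜ : Set X), (∀ z ∈ cyc R n ({p}ᶜ : Set X), ∃ k : R, z - k • g ∈ nul R n {p}ᶜ) ∧
    ∀ k : R, k • g ∈ nul R n {p}ᶜ → k = 0

lemma LH.homeo {p : X} {q : Y} (h : LH R n X p) (e : X ≃ₜ Y) (he : e p = q) : LH R n Y q := by
  subst he
  have h1 : Set.MapsTo e ({p}ᶜ : Set X) {e p}ᶜ := fun x hx => by simpa using hx
  have h2 : Set.MapsTo e.symm ({e p}ᶜ : Set Y) {p}ᶜ := fun x hx => by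
    simpa [Homeomorph.symm_apply_eq] using hx
  let f : C(X, Y) := e
  let g : C(Y, X) := e.symm
  have hfg : ∀ {i} (z : SChain R i Y), cmap R f (cmap R g z) = z := fun z => by
    rw [cmap_cmap]; convert cmap_id z; ext y; simp [f, g]
  have hgf : ∀ {i} (z : SChain R i X), cmap R g (cmap R f z) = z := fun z => by
    rw [cmap_cmap]; convert cmap_id z; ext y; simp [f, g]
  refine ⟨fun i hi z hz => ?_, ?_⟩
  · rw [← hfg z]
    exact nul_map h1 (h.van i hi _ (cyc_map h2 hz))
  · obtain ⟨c, hc, hc1, hc2⟩ := h.gen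
    refine ⟨cmap R f c, cyc_map h1 hc, fun z hz => ?_, fun k hk => hc2 k ?_⟩
    · obtain ⟨k, hk⟩ := hc1 _ (cyc_map (f := g) h2 hz)
      refine ⟨k, ?_⟩
      have := nul_map (f := f) h1 hk
      rwa [map_sub, hfg, map_smul] at this
    · have := nul_map (f := g) h2 hk
      rwa [map_smul, hgf] at this

lemma LH_zero [Unique X] (p : X) : LH R 0 X p := by
  rw [Unique.eq_default p]
  have hS : ({default}ᶜ : Set X) = ∅ := by ext x; simp [Unique.eq_default x]
  have hs : ∀ {i} (σ τ : SingSimplex i X), σ = τ := fun σ τ => by ext x; exact Subsingleton.elim _ _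
  have hsum : ∀ {i} (σ : SingSimplex (i + 1) X) (τ : SingSimplex i X) (a : R),
      sbdry R (Finsupp.single σ a) = if Even i then 0 else Finsupp.single τ a := by
    intro i σ τ a
    rw [sbdry_single, Finset.sum_congr rfl fun k _ => by rw [hs (σ.comp (faceMap k)) τ],
      ← Finset.sum_smul, Fin.sum_neg_one_pow]
    simp only [Nat.even_add, even_two, iff_true]
    split_ifs <;> simp
  have hE : ∀ {i} (z : SChain R i X), ∃ a : R, z = Finsupp.single (ContinuousMap.const _ default) a := fun z =>
    ⟨z (ContinuousMap.const _ default), by ext τ; rw [hs τ (ContinuousMap.const _ default)]; simp⟩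
  refine ⟨fun i hi z hz => ?_, Finsupp.single (ContinuousMap.const _ default) 1, ?_, fun z _ => ?_, fun k hk => ?_⟩
  · obtain ⟨i, rfl⟩ := Nat.exists_eq_succ_of_ne_zero (by omega : i ≠ 0)
    obtain ⟨a, rfl⟩ := hE z
    by_cases he : Even i
    · have := hsum (ContinuousMap.const _ default) (ContinuousMap.const _ (default : X)) a (i := i + 1)
      rw [if_neg (by simpa [Nat.even_add_one] using he)] at this
      rw [← this]; exact bd_nul _
    · rw [hS, mem_cyc_succ, hsum _ (ContinuousMap.const _ default) a, if_neg he, suppOn,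
        Finsupp.mem_supported] at hz
      have ha : a = 0 := by
        by_contra ha
        have := hz (a := ContinuousMap.const _ default) (by simp [ha])
        exact (this ⟨vertexPt 0, rfl⟩).elim
      rw [ha, Finsupp.single_zero]; exact zero_mem _
  · exact (zero_mem _ : (0 : SChain R (0 - 1) X) ∈ suppOn R (0 - 1) _)
  · obtain ⟨a, rfl⟩ := hE z
    refine ⟨a, ?_⟩
    rw [Finsupp.smul_single, smul_eq_mul, mul_one, sub_self]; exact zero_mem _
  · obtain ⟨a, ha, w, h⟩ := mem_nul.1 hk
    obtain ⟨b, rfl⟩ := hE w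
    rw [hsum _ (ContinuousMap.const _ default), if_pos (by simp), add_zero] at h
    rw [h, hS, Finsupp.smul_single, smul_eq_mul, mul_one, suppOn, Finsupp.mem_supported] at ha
    by_contra hk
    have := ha (a := ContinuousMap.const _ default) (by simp [hk])
    exact (this ⟨vertexPt 0, rfl⟩).elim

variable {E : Type} [NormedAddCommGroup E] [NormedSpace ℝ E]

def UU (E : Type) [NormedAddCommGroup E] (s : ℝ) : Set (E × ℝ) := {q | q.1 ≠ 0 ∨ 0 < s * q.2}
def piE : C(E × ℝ, E) := ⟨Prod.fst, continuous_fst⟩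
def ioE (s : ℝ) : C(E, E × ℝ) := ⟨fun x => (x, s), by fun_prop⟩

lemma UU_open (s : ℝ) : IsOpen (UU E s) :=
  (isOpen_ne_fun continuous_fst continuous_const).union
    (isOpen_lt continuous_const (continuous_const.mul continuous_snd))
lemma UU_union : UU E 1 ∪ UU E (-1) = ({0}ᶜ : Set (E × ℝ)) := by
  ext ⟨x, t⟩
  simp only [UU, Set.mem_union, Set.mem_setOf_eq, Set.mem_compl_iff, Set.mem_singleton_iff,
    Prod.mk_eq_zero, not_and, one_mul, neg_mul, neg_pos]
  constructor
  · rintro ((h | h) | (h | h)) h1 h2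
    exacts [h h1, h.ne' h2, h h1, h.ne h2]
  · intro h
    by_cases hx : x = 0
    · rcases lt_or_gt_of_ne (h hx) with h | h <;> tauto
    · tauto
lemma UU_inter {q : E × ℝ} (h : q ∈ UU E 1) (h' : q ∈ UU E (-1)) : q.1 ≠ 0 := by
  rcases h with h | h
  · exact h
  · rcases h' with h' | h'
    · exact h'
    · linarith
lemma UU_sub (s : ℝ) (hs : s = 1 ∨ s = -1) : UU E s ⊆ {0}ᶜ := by
  rw [← UU_union]; rcases hs with rfl | rfl
  · exact Set.subset_union_left
  · exact Set.subset_union_right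

lemma susp_ab {z : SChain R (i + 1) (E × ℝ)} {a b : SChain R i (E × ℝ)} (ha : a ∈ suppOn R i (UU E 1))
    (hb : b ∈ suppOn R i (UU E (-1))) (h : sbdry R z = a + b) : a ∈ cyc R i {q : E × ℝ | q.1 ≠ 0} := by
  have h1 : sbdryN R i a = - sbdryN R i b := by
    rw [← add_eq_zero_iff_eq_neg, ← map_add, ← h, sbdryN_sbdry]
  refine suppOn_mono (fun q hq => UU_inter hq.1 hq.2) (suppOn_inf (sbdryN_mem ha) ?_)
  rw [h1]; exact neg_mem (sbdryN_mem hb)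

lemma io_mem (c : SChain R i E) : cmap R (ioE 1) c ∈ suppOn R i (UU E 1) :=
  cmap_mem' (f := ioE 1) (B := UU E 1) (fun x => Or.inr (by simp [ioE])) c
lemma susp_inj {z : SChain R (i + 1) (E × ℝ)} {a b : SChain R i (E × ℝ)} (ha : a ∈ suppOn R i (UU E 1))
    (hb : b ∈ suppOn R i (UU E (-1))) (h : sbdry R z = a + b)
    (hn : cmap R piE a ∈ nul R i ({0}ᶜ : Set E)) : z ∈ nul R (i + 1) ({0}ᶜ : Set (E × ℝ)) := by
  obtain ⟨f, hf, w, hw⟩ := mem_nul.1 hn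
  obtain ⟨b', hb', w', hw', h'⟩ := hinv' (R := R) (B := {q : E × ℝ | q.1 ≠ 0}) (D := UU E 1)
    (⟨fun q => (q.1.1, (1 - (q.2 : ℝ)) * q.1.2 + q.2), by fun_prop⟩ : C((E × ℝ) × unitInterval, E × ℝ))
    (ContinuousMap.id _) ((ioE 1).comp piE) (fun x => by ext <;> simp) (fun x => by ext <;> simp [ioE, piE])
    (fun x hx t => hx) (fun x hx t => by
      rcases hx with hx | hx
      · exact Or.inl hx
      · refine Or.inr ?_
        have h0 := t.2.1; have h1 := t.2.2
        simp only [one_mul, ContinuousMap.coe_mk] at hx ⊢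
        rcases h0.eq_or_lt with h0 | h0
        · rw [← h0]; simpa using hx
        · nlinarith [mul_nonneg (sub_nonneg.2 h1) hx.le]) (susp_ab ha hb h) ha
  rw [cmap_id, ← cmap_cmap, ← hw, map_add, ← sbdry_cmap] at h'
  set W := cmap R (ioE 1) w - w' with hW
  have hWm : W ∈ suppOn R (i + 1) (UU E 1) := sub_mem (io_mem _) hw'
  have h2 : sbdry R (z - W) ∈ suppOn R i (UU E (-1)) := by
    have : sbdry R (z - W) = cmap R (ioE 1) f - b' + b := by
      rw [map_sub, h, hW, map_sub, eq_sub_of_add_eq h']; abel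
    rw [this]
    refine add_mem (sub_mem (cmap_mem (f := ioE 1) (B := UU E (-1)) (fun x hx => Or.inl hx) hf) (suppOn_mono (fun x hx => Or.inl hx) hb')) hb
  have h3 := hinv (R := R) (B := UU E (-1))
    (⟨fun q => ((1 - (q.2 : ℝ)) • q.1.1, (1 - (q.2 : ℝ)) * q.1.2 - q.2), by fun_prop⟩ :
      C((E × ℝ) × unitInterval, E × ℝ))
    (ContinuousMap.id _) (ContinuousMap.const _ (0, -1)) (fun x => by ext <;> simp) (fun x => by ext <;> simp)
    (fun x hx t => by
      have h0 := t.2.1; have h1 := t.2.2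
      rcases h1.eq_or_lt with h1 | h1
      · refine Or.inr ?_; simp [h1]
      · rcases hx with hx | hx
        · exact Or.inl (smul_ne_zero (by linarith) hx)
        · refine Or.inr ?_
          simp only [ContinuousMap.coe_mk] at hx ⊢
          nlinarith [mul_pos (sub_pos.2 h1) hx]) (mem_cyc_succ.2 h2)
  rw [cmap_id] at h3
  have h4 : z - W ∈ nul R (i + 1) (UU E (-1)) := by
    have := sub_mem (supp_nul (cmap_mem' (f := ContinuousMap.const _ ((0 : E), (-1 : ℝ))) (B := UU E (-1))
      (fun x => Or.inr (by simp)) (z - W))) h3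
    rwa [sub_sub_cancel] at this
  have := add_mem (nul_mono (UU_sub _ (Or.inr rfl)) h4) (supp_nul (suppOn_mono (UU_sub _ (Or.inl rfl)) hWm))
  rwa [sub_add_cancel] at this

lemma susp_conv {z : SChain R (i + 1) (E × ℝ)} {a b : SChain R i (E × ℝ)} (ha : a ∈ suppOn R i (UU E 1))
    (hb : b ∈ suppOn R i (UU E (-1))) (h : sbdry R z = a + b)
    (hn : z ∈ nul R (i + 1) ({0}ᶜ : Set (E × ℝ))) : cmap R piE a ∈ nul R i ({0}ᶜ : Set E) := by
  obtain ⟨f, hf, w, rfl⟩ := mem_nul.1 hn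
  rw [map_add, sbdry_sbdry, add_zero] at h
  rw [← UU_union] at hf
  obtain ⟨w', -, f1, hf1, f2, hf2, rfl⟩ := small_chains (UU_open 1) (UU_open (-1)) hf (by
    change sbdry R f ∈ _
    rw [h]; exact Submodule.add_mem_sup ha hb)
  rw [map_add, sbdry_sbdry, add_zero, map_add] at h
  have h1 : a - sbdry R f1 ∈ suppOn R i {q : E × ℝ | q.1 ≠ 0} := by
    refine suppOn_mono (fun q hq => UU_inter hq.1 hq.2) (suppOn_inf (sub_mem ha (sbdry_mem hf1)) ?_)
    have : a - sbdry R f1 = sbdry R f2 - b := by rw [sub_eq_sub_iff_add_eq_add, ← h]; abel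
    rw [this]; exact sub_mem (sbdry_mem hf2) hb
  have h2 := add_mem (supp_nul (cmap_mem (f := piE) (B := ({0}ᶜ : Set E)) (fun q hq => hq) h1))
    (bd_nul (cmap R piE f1))
  rwa [map_sub, ← sbdry_cmap, sub_add_cancel] at h2

def sus : SChain R i E →ₗ[R] SChain R (i + 1) (E × ℝ) :=
  (cmap R (⟨fun q => (q.1, 2 * (q.2 : ℝ) - 1), by fun_prop⟩ : C(E × unitInterval, E × ℝ))).comp (prism R)

lemma sus_bd {c : SChain R i E} (hc : c ∈ cyc R i ({0}ᶜ : Set E)) :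
    ∃ b ∈ suppOn R i (UU E (-1)), sbdry R (sus c) = cmap R (ioE 1) c + b := by
  refine ⟨-cmap R (ioE (-1)) c - cmap R _ (prismb c), sub_mem (neg_mem (cmap_mem' (f := ioE (-1)) (B := UU E (-1))
    (fun x => Or.inr (by simp [ioE])) _)) (cmap_mem (B := UU E (-1)) (f := ⟨fun q => (q.1, 2 * (q.2 : ℝ) - 1), by
      fun_prop⟩) (fun x hx => Or.inl hx.1) (prismb_mem hc)), ?_⟩
  rw [sus, LinearMap.comp_apply, sbdry_cmap, sbdry_prism', map_sub, map_sub, cmap_cmap, cmap_cmap]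
  have h1 : ∀ t : unitInterval, (⟨fun q => (q.1, 2 * (q.2 : ℝ) - 1), by fun_prop⟩ :
    C(E × unitInterval, E × ℝ)).comp (inI t) = ioE (2 * t - 1) := fun t => rfl
  rw [h1, h1, show (2 * ((1 : unitInterval) : ℝ) - 1) = 1 by norm_num,
    show (2 * ((0 : unitInterval) : ℝ) - 1) = -1 by norm_num]
  abel

lemma pi_io (s : ℝ) (c : SChain R i E) : cmap R piE (cmap R (ioE s) c) = c := by
  rw [cmap_cmap]; exact cmap_id c

lemma sus_nul {c : SChain R i E} (hc : c ∈ cyc R i ({0}ᶜ : Set E)) :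
    sus c ∈ nul R (i + 1) ({0}ᶜ : Set (E × ℝ)) ↔ c ∈ nul R i ({0}ᶜ : Set E) := by
  obtain ⟨b, hb, h⟩ := sus_bd hc
  constructor
  · intro hn
    have := susp_conv (io_mem c) hb h hn
    rwa [pi_io] at this
  · intro hn
    exact susp_inj (io_mem c) hb h (by rwa [pi_io])

lemma sus_cyc {c : SChain R i E} (hc : c ∈ cyc R i ({0}ᶜ : Set E)) :
    sus c ∈ cyc R (i + 1) ({0}ᶜ : Set (E × ℝ)) := by
  obtain ⟨b, hb, h⟩ := sus_bd hc
  rw [mem_cyc_succ, h]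
  exact add_mem (suppOn_mono (UU_sub 1 (Or.inl rfl)) (io_mem c)) (suppOn_mono (UU_sub _ (Or.inr rfl)) hb)

lemma sus_surj {z : SChain R (i + 1) (E × ℝ)} (hz : z ∈ cyc R (i + 1) ({0}ᶜ : Set (E × ℝ))) :
    ∃ c ∈ cyc R i ({0}ᶜ : Set E), z - sus c ∈ nul R (i + 1) ({0}ᶜ : Set (E × ℝ)) := by
  rw [mem_cyc_succ, ← UU_union] at hz
  obtain ⟨w, hw, a, ha, b, hb, h⟩ := small_chains (UU_open 1) (UU_open (-1)) hz (by
    rw [sbdryN_sbdry]; exact zero_mem _)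
  rw [UU_union] at hw
  have h1 : sbdry R (z - w) = a + b := by rw [map_sub, h]; abel
  have hc : cmap R piE a ∈ cyc R i ({0}ᶜ : Set E) := cyc_map (fun q hq => hq) (susp_ab ha hb h1)
  refine ⟨_, hc, ?_⟩
  obtain ⟨b', hb', h'⟩ := sus_bd hc
  have := susp_inj (z := z - w - sus (cmap R piE a)) (a := a - cmap R (ioE 1) (cmap R piE a)) (b := b - b')
    (sub_mem ha (io_mem _)) (sub_mem hb hb') (by rw [map_sub, h1, h']; abel)
    (by rw [map_sub, pi_io, sub_self]; exact zero_mem _)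
  have := add_mem this (supp_nul hw)
  convert this using 1; abel

lemma LH.susp (h : LH R n E 0) : LH R (n + 1) (E × ℝ) 0 := by
  refine ⟨fun i hi z hz => ?_, ?_⟩
  · obtain ⟨i, rfl⟩ := Nat.exists_eq_succ_of_ne_zero (by omega : i ≠ 0)
    obtain ⟨c, hc, h1⟩ := sus_surj hz
    have := add_mem h1 ((sus_nul hc).2 (h.van i (by omega) c hc))
    rwa [sub_add_cancel] at this
  · obtain ⟨g, hg, h1, h2⟩ := h.gen
    refine ⟨sus g, sus_cyc hg, fun z hz => ?_, fun k hk => h2 k ?_⟩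
    · obtain ⟨c, hc, h3⟩ := sus_surj hz
      obtain ⟨k, hk⟩ := h1 c hc
      refine ⟨k, ?_⟩
      have := add_mem h3 ((sus_nul (sub_mem hc (Submodule.smul_mem _ k hg))).2 hk)
      rwa [map_sub, map_smul, sub_add_sub_cancel] at this
    · rw [← map_smul] at hk
      exact (sus_nul (Submodule.smul_mem _ k hg)).1 hk

abbrev EE (n : ℕ) := EuclideanSpace ℝ (Fin n)

lemma LH_euc (n : ℕ) : LH R n (EE n) 0 := by
  induction n with
  | zero => exact LH_zero 0
  | succ n ih =>
    let e : (EE n × ℝ) ≃L[ℝ] EE (n + 1) := ContinuousLinearEquiv.ofFinrankEq (by simp)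
    exact ih.susp.homeo e.toHomeomorph (map_zero e)

lemma LH_euc' (n : ℕ) (p : EE n) : LH R n (EE n) p :=
  (LH_euc n).homeo (Homeomorph.addLeft p) (by simp)
end Loc
end
noncomputable section
open Finset

section Exc
variable {R : Type} [CommRing R] {X Y : Type} [TopologicalSpace X] [TopologicalSpace Y] {n i : ℕ}
open Topology

lemma exists_lift {j : C(Y, X)} (hj : IsEmbedding j) {u : SChain R n X}
    (hu : u ∈ suppOn R n (Set.range j)) : ∃ v, cmap R j v = u := by
  have : suppOn R n (Set.range j) ≤ LinearMap.range (cmap R j) := suppOn_le fun σ hσ => by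
    choose f hf using fun x => hσ ⟨x, rfl⟩
    refine ⟨Finsupp.single ⟨f, hj.continuous_iff.2 (by convert σ.continuous; exact funext hf)⟩ 1, ?_⟩
    rw [cmap_single]; congr 1; ext x; exact hf x
  exact this hu

lemma cmap_inj {j : C(Y, X)} (hj : Function.Injective j) : Function.Injective (cmap R j : SChain R n Y → _) :=
  Finsupp.mapDomain_injective fun σ τ h => by
    ext x; exact hj (DFunLike.congr_fun h x)

lemma cmap_mem_iff {j : C(Y, X)} (hj : Function.Injective j) {S : Set X} {v : SChain R n Y} :
    cmap R j v ∈ suppOn R n S ↔ v ∈ suppOn R n (j ⁻¹' S) := by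
  refine ⟨fun h => ?_, cmap_mem fun x hx => hx⟩
  rw [suppOn, Finsupp.mem_supported] at h ⊢
  intro σ hσ
  have : j.comp σ ∈ (cmap R j v).support := by
    rw [Finsupp.mem_support_iff]
    change Finsupp.mapDomain (fun σ => j.comp σ) v (j.comp σ) ≠ 0
    rw [Finsupp.mapDomain_apply (fun σ τ h => by ext x; exact hj (DFunLike.congr_fun h x))]
    exact Finsupp.mem_support_iff.1 hσ
  rintro _ ⟨x, rfl⟩
  exact h this ⟨x, rfl⟩

lemma exc_surj {j : C(Y, X)} (hj : IsOpenEmbedding j) {S : Set X} (hS : IsOpen S) (hU : Set.range j ∪ S = Set.univ)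
    {z : SChain R n X} (hz : z ∈ cyc R n S) : ∃ v ∈ cyc R n (j ⁻¹' S), z - cmap R j v ∈ nul R n S := by
  obtain ⟨w, -, a, ha, b, hb, h⟩ := small_chains hj.isOpen_range hS (c := z) (by rw [hU]; exact suppOn_univ _)
    (Submodule.mem_sup_right hz)
  obtain ⟨v, rfl⟩ := exists_lift hj.isEmbedding ha
  refine ⟨v, ?_, ?_⟩
  · rw [mem_cyc, ← cmap_mem_iff hj.injective, ← sbdryN_cmap]
    have : cmap R j v = z - b - sbdry R w := by rw [h]; abel
    rw [this]; exact sub_mem (sub_mem hz (supp_cyc hb)) (bd_cyc w)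
  · rw [show z - cmap R j v = b + sbdry R w by rw [h]; abel]
    exact add_mem (supp_nul hb) (bd_nul w)

lemma exc_inj {j : C(Y, X)} (hj : IsOpenEmbedding j) {S : Set X} (hS : IsOpen S) (hU : Set.range j ∪ S = Set.univ)
    {v : SChain R n Y} (hv : cmap R j v ∈ nul R n S) : v ∈ nul R n (j ⁻¹' S) := by
  obtain ⟨s, hs, w, hw⟩ := mem_nul.1 hv
  obtain ⟨u, -, a, ha, b, hb, h⟩ := small_chains hj.isOpen_range hS (c := w) (by rw [hU]; exact suppOn_univ _)
    (by
      change sbdry R w ∈ _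
      rw [eq_sub_of_add_eq' hw]
      exact sub_mem (Submodule.mem_sup_left (cmap_mem' (f := j) (B := Set.range j) (fun x => ⟨x, rfl⟩) _))
        (Submodule.mem_sup_right hs))
  obtain ⟨a, rfl⟩ := exists_lift hj.isEmbedding ha
  have h1 : cmap R j (v - sbdry R a) ∈ suppOn R n S := by
    rw [map_sub, ← hw, h, map_add, map_add, sbdry_sbdry, sbdry_cmap]
    convert add_mem hs (sbdry_mem hb) using 1; abel
  rw [cmap_mem_iff hj.injective] at h1
  have := add_mem (supp_nul h1) (bd_nul a)
  rwa [sub_add_cancel] at this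

lemma LH.exc [T1Space X] {p : Y} (h : LH R n Y p) {j : C(Y, X)} (hj : IsOpenEmbedding j) : LH R n X (j p) := by
  have hS : IsOpen ({j p}ᶜ : Set X) := isOpen_compl_singleton
  have hU : Set.range j ∪ ({j p}ᶜ : Set X) = Set.univ := by
    ext x; simp only [Set.mem_union, Set.mem_compl_iff, Set.mem_singleton_iff, Set.mem_univ, iff_true]
    by_cases hx : x = j p
    · exact Or.inl ⟨p, hx.symm⟩
    · exact Or.inr hx
  have hp : j ⁻¹' ({j p}ᶜ : Set X) = {p}ᶜ := by ext x; simp [hj.injective.eq_iff]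
  have hm : Set.MapsTo j ({p}ᶜ : Set Y) {j p}ᶜ := by rw [← hp]; exact fun x hx => hx
  refine ⟨fun i hi z hz => ?_, ?_⟩
  · obtain ⟨v, hv, h1⟩ := exc_surj hj hS hU hz
    rw [hp] at hv
    have := add_mem h1 (nul_map hm (h.van i hi v hv))
    rwa [sub_add_cancel] at this
  · obtain ⟨g, hg, h1, h2⟩ := h.gen
    refine ⟨cmap R j g, cyc_map hm hg, fun z hz => ?_, fun k hk => h2 k ?_⟩
    · obtain ⟨v, hv, h3⟩ := exc_surj hj hS hU hz
      rw [hp] at hv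
      obtain ⟨k, hk⟩ := h1 v hv
      refine ⟨k, ?_⟩
      have := add_mem h3 (nul_map hm hk)
      rwa [map_sub, sub_add_sub_cancel, map_smul] at this
    · rw [← map_smul] at hk
      rw [← hp]; exact exc_inj hj hS hU hk

/-- Mayer–Vietoris -/
lemma mv {S T : Set X} (hS : IsOpen S) (hT : IsOpen T) {z : SChain R n X} (h1 : z ∈ nul R n S)
    (h2 : z ∈ nul R n T) (h : ∀ d ∈ cyc R (n + 1) (S ∪ T), d ∈ nul R (n + 1) (S ∪ T)) : z ∈ nul R n (S ∩ T) := by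
  obtain ⟨s, hs, w1, e1⟩ := mem_nul.1 h1
  obtain ⟨t, ht, w2, e2⟩ := mem_nul.1 h2
  have hd : sbdry R (w1 - w2) = t - s := by
    rw [map_sub, eq_sub_of_add_eq' e1, eq_sub_of_add_eq' e2]; abel
  obtain ⟨f, hf, e, he⟩ := mem_nul.1 (h (w1 - w2) (by
    rw [mem_cyc_succ, hd]
    exact sub_mem (suppOn_mono Set.subset_union_right ht) (suppOn_mono Set.subset_union_left hs)))
  have hf' : sbdry R f = t - s := by rw [← hd, ← he, map_add, sbdry_sbdry, add_zero]
  obtain ⟨u, -, f1, hf1, f2, hf2, rfl⟩ := small_chains hS hT hf (by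
    change sbdry R f ∈ _
    rw [hf']; exact sub_mem (Submodule.mem_sup_right ht) (Submodule.mem_sup_left hs))
  rw [map_add, sbdry_sbdry, add_zero, map_add] at hf'
  refine mem_nul.2 ⟨s + sbdry R f1, suppOn_inf (add_mem hs (sbdry_mem hf1)) ?_, w1 - f1, ?_⟩
  · rw [show s + sbdry R f1 = t - sbdry R f2 by rw [eq_sub_of_add_eq hf']; abel]
    exact sub_mem ht (sbdry_mem hf2)
  · rw [← e1, map_sub]; abel

lemma mv_glue {S T : Set X} (hS : IsOpen S) (hT : IsOpen T) {a b : SChain R n X} (ha : a ∈ cyc R n S)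
    (hb : b ∈ cyc R n T) (h : a - b ∈ nul R n (S ∪ T)) :
    ∃ z ∈ cyc R n (S ∩ T), z - a ∈ nul R n S ∧ z - b ∈ nul R n T := by
  obtain ⟨f, hf, e, he⟩ := mem_nul.1 h
  obtain ⟨u, -, f1, hf1, f2, hf2, rfl⟩ := small_chains hS hT hf (by
    rw [eq_sub_of_add_eq he, map_sub, sbdryN_sbdry, sub_zero, map_sub]
    exact sub_mem (Submodule.mem_sup_left ha) (Submodule.mem_sup_right hb))
  have h2 : b + f2 = a - f1 - sbdry R (e + u) := by
    rw [map_add, eq_add_of_sub_eq he.symm]; abel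
  refine ⟨b + f2, suppOn_inf ?_ (add_mem hb (supp_cyc hf2)), ?_, ?_⟩
  · change b + f2 ∈ cyc R n S
    rw [h2]; exact sub_mem (sub_mem ha (supp_cyc hf1)) (bd_cyc _)
  · rw [h2, show a - f1 - sbdry R (e + u) - a = -(f1 + sbdry R (e + u)) by abel]
    exact neg_mem (add_mem (supp_nul hf1) (bd_nul _))
  · rw [add_sub_cancel_left]; exact supp_nul hf2

lemma csupp {S : Set X} {c : SChain R n X} (h : c ∈ suppOn R n S) :
    ∃ K ⊆ S, IsCompact K ∧ c ∈ suppOn R n K :=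
  ⟨⋃ σ ∈ c.support, Set.range ⇑σ, Set.iUnion₂_subset fun σ hσ => h hσ, c.support.isCompact_biUnion fun σ _ =>
    isCompact_range σ.continuous, fun σ hσ => Set.subset_biUnion_of_mem (u := fun σ : SingSimplex n X => Set.range ⇑σ) hσ⟩

lemma scale {C K : Set (EE n)} (hC : IsCompact C) (hK : IsCompact K) {x : EE n} (hx : x ∉ K) :
    ∃ H : C(EE n × unitInterval, EE n), (∀ y, H (y, 0) = y) ∧ (∀ y ∈ K, H (y, 1) ∈ Cᶜ) ∧
      ∀ C : Set (EE n), Convex ℝ C → x ∈ C → ∀ y ∈ Cᶜ, ∀ t, H (y, t) ∈ Cᶜ := by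
  obtain ⟨ε, hε, hb⟩ := Metric.isOpen_iff.1 hK.isClosed.isOpen_compl x hx
  obtain ⟨r, hr, hCr⟩ := hC.isBounded.subset_ball_lt 0 x
  have hre : 0 < r / ε := by positivity
  refine ⟨⟨fun q => x + (1 + q.2 * (r / ε)) • (q.1 - x), by fun_prop⟩, fun y => by simp, fun y hy hc => ?_,
    fun C hC hx y hy t h => hy ?_⟩
  · have h3 := hCr hc
    have h4 : ε ≤ ‖y - x‖ := by
      by_contra h5
      exact hb (by rw [Metric.mem_ball, dist_eq_norm]; exact not_le.1 h5) hy
    simp only [ContinuousMap.coe_mk, Metric.mem_ball, dist_eq_norm,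
      add_sub_cancel_left, norm_smul, Set.Icc.coe_one, one_mul, Real.norm_eq_abs] at h3
    rw [abs_of_pos (by positivity)] at h3
    have : r / ε * ε = r := by field_simp
    nlinarith
  · have ht := t.2.1
    have hp : 0 < 1 + (t : ℝ) * (r / ε) := by positivity
    have := hC.add_smul_sub_mem hx h (t := (1 + (t : ℝ) * (r / ε))⁻¹)
      ⟨by positivity, inv_le_one_of_one_le₀ (by nlinarith)⟩
    simpa [smul_smul, inv_mul_cancel₀ hp.ne'] using this

/-- convex sets -/
lemma conv_nul {C : Set (EE n)} (hC : Convex ℝ C) (hC' : IsCompact C) {x : EE n} (hx : x ∈ C)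
    {z : SChain R i (EE n)} (hz : z ∈ cyc R i Cᶜ) (h : z ∈ nul R i ({x}ᶜ : Set (EE n))) : z ∈ nul R i Cᶜ := by
  obtain ⟨s, hs, w, hw⟩ := mem_nul.1 h
  obtain ⟨K, hKx, hK, hsK⟩ := csupp hs
  obtain ⟨H, H0, H1, H2⟩ := scale hC' hK (fun h => hKx h rfl)
  have h1 := hinv (R := R) (A := Cᶜ) (B := Cᶜ) H (ContinuousMap.id _) (H.comp (inI 1)) H0 (fun y => rfl)
    (H2 C hC hx) hz
  rw [cmap_id] at h1
  have h2 : cmap R (H.comp (inI 1)) z ∈ nul R i Cᶜ := by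
    rw [← hw, map_add, ← sbdry_cmap]
    exact add_mem (supp_nul (cmap_mem (f := H.comp (inI 1)) (A := K) H1 hsK)) (bd_nul _)
  have := sub_mem h2 h1
  rwa [sub_sub_cancel] at this

lemma conv_surj {C : Set (EE n)} (hC' : IsCompact C) {x : EE n}
    {z : SChain R i (EE n)} (hz : z ∈ cyc R i ({x}ᶜ : Set (EE n))) :
    ∃ z' ∈ cyc R i Cᶜ, z' - z ∈ nul R i ({x}ᶜ : Set (EE n)) := by
  obtain ⟨K, hKx, hK, hsK⟩ := csupp hz
  obtain ⟨H, H0, H1, H2⟩ := scale hC' hK (fun h => hKx h rfl)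
  have h1 := hinv (R := R) (A := {x}ᶜ) (B := {x}ᶜ) H (ContinuousMap.id _) (H.comp (inI 1)) H0 (fun y => rfl)
    (H2 _ (convex_singleton x) rfl) hz
  rw [cmap_id] at h1
  refine ⟨_, ?_, h1⟩
  rw [mem_cyc, sbdryN_cmap]
  exact cmap_mem (f := H.comp (inI 1)) (A := K) H1 hsK

lemma nul_pt {D : Set X} {x : X} (hx : x ∈ D) {z : SChain R i X} (h : z ∈ nul R i Dᶜ) : z ∈ nul R i ({x}ᶜ : Set X) :=
  nul_mono (Set.compl_subset_compl.2 (Set.singleton_subset_iff.2 hx)) h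
lemma cyc_pt {D : Set X} {x : X} (hx : x ∈ D) {z : SChain R i X} (h : z ∈ cyc R i Dᶜ) : z ∈ cyc R i ({x}ᶜ : Set X) :=
  cyc_mono (Set.compl_subset_compl.2 (Set.singleton_subset_iff.2 hx)) h

variable [T2Space X]

lemma exc_cover {j : C(Y, X)} {A : Set X} (h : A ⊆ Set.range j) : Set.range j ∪ Aᶜ = Set.univ := by
  rw [Set.eq_univ_iff_forall]
  exact fun x => (em (x ∈ A)).imp (fun hx => h hx) id

lemma chart_conv {j : C(EE n, X)} (hj : IsOpenEmbedding j) {C : Set (EE n)} (hC : Convex ℝ C) (hC' : IsCompact C)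
    {x : EE n} (hx : x ∈ C) {z : SChain R i X} (hz : z ∈ cyc R i (j '' C)ᶜ) (h : z ∈ nul R i ({j x}ᶜ : Set X)) :
    z ∈ nul R i (j '' C)ᶜ := by
  have hS : IsOpen (j '' C)ᶜ := (hC'.image j.continuous).isClosed.isOpen_compl
  have hp : j ⁻¹' (j '' C)ᶜ = Cᶜ := by rw [Set.preimage_compl, Set.preimage_image_eq _ hj.injective]
  obtain ⟨v, hv, h1⟩ := exc_surj hj hS (exc_cover (Set.image_subset_range _ _)) hz
  have h2 : cmap R j v ∈ nul R i ({j x}ᶜ : Set X) := by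
    have := sub_mem h (nul_pt (Set.mem_image_of_mem j hx) h1)
    rwa [sub_sub_cancel] at this
  have h3 := exc_inj hj isOpen_compl_singleton (exc_cover (Set.singleton_subset_iff.2 ⟨x, rfl⟩)) h2
  rw [hp] at hv
  have h4 := conv_nul hC hC' hx hv (by convert h3; ext y; simp [hj.injective.eq_iff])
  have := add_mem h1 (nul_map (f := j) (fun y hy => by rw [← hp] at hy; exact hy) h4)
  rwa [sub_add_cancel] at this

lemma chart_surj {j : C(EE n, X)} (hj : IsOpenEmbedding j) {C : Set (EE n)} (hC' : IsCompact C)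
    {x : EE n} {z : SChain R i X} (hz : z ∈ cyc R i ({j x}ᶜ : Set X)) :
    ∃ z' ∈ cyc R i (j '' C)ᶜ, z' - z ∈ nul R i ({j x}ᶜ : Set X) := by
  obtain ⟨v, hv, h1⟩ := exc_surj hj isOpen_compl_singleton (exc_cover (Set.singleton_subset_iff.2 ⟨x, rfl⟩)) hz
  have hp : j ⁻¹' {j x}ᶜ = {x}ᶜ := by ext y; simp [hj.injective.eq_iff]
  rw [hp] at hv
  obtain ⟨w, hw, h2⟩ := conv_surj hC' hv
  refine ⟨cmap R j w, cyc_map (fun y hy => ?_) hw, ?_⟩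
  · rintro ⟨y', hy', h⟩; rw [hj.injective h] at hy'; exact hy hy'
  · have := sub_mem (nul_map (f := j) (fun y hy => by rw [← hp] at hy; exact hy) h2) h1
    rwa [map_sub, sub_sub_sub_cancel_right] at this

lemma chart_fin {j : C(EE n, X)} (hj : IsOpenEmbedding j) {ι : Type} (s : Finset ι) : ∀ (C : ι → Set (EE n))
    (hC : ∀ k, Convex ℝ (C k)) (hC' : ∀ k, IsCompact (C k)) (i : ℕ) (hi : n < i)
    (z : SChain R i X) (hz : z ∈ cyc R i (j '' ⋃ k ∈ s, C k)ᶜ), z ∈ nul R i (j '' ⋃ k ∈ s, C k)ᶜ := by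
  classical
  induction s using Finset.induction_on with
  | empty => intro C _ _ i _ z _; simpa using supp_nul (suppOn_univ z)
  | insert a s ha ih =>
    intro C hC hC' i hi z hz
    have h1 : (⋃ k ∈ insert a s, C k) = C a ∪ ⋃ k ∈ s, C k := by simp
    rw [h1, Set.image_union, Set.compl_union] at hz ⊢
    have hcl : ∀ C : Set (EE n), IsCompact C → IsOpen (j '' C)ᶜ := fun C hC' =>
      (hC'.image j.continuous).isClosed.isOpen_compl
    refine mv (hcl _ (hC' a)) (hcl _ (s.isCompact_biUnion fun k _ => hC' k)) ?_
      (ih C hC hC' i hi z (cyc_mono Set.inter_subset_right hz)) ?_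
    · rcases (C a).eq_empty_or_nonempty with h | ⟨x, hx⟩
      · simpa [h] using supp_nul (suppOn_univ z)
      · refine chart_conv hj (hC a) (hC' a) hx (cyc_mono Set.inter_subset_left hz) ?_
        exact ((LH_euc' n x).exc hj).van i hi z (cyc_pt (Set.mem_image_of_mem j hx)
          (cyc_mono Set.inter_subset_left hz))
    · rw [← Set.compl_inter, ← Set.image_inter hj.injective, Set.inter_iUnion₂]
      exact ih _ (fun k => (hC a).inter (hC k)) (fun k => (hC' a).inter (hC' k)) _ (by omega)

lemma chart_cpt {j : C(EE n, X)} (hj : IsOpenEmbedding j) {A : Set X} (hA : IsCompact A) (hAj : A ⊆ Set.range j)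
    (hi : n < i) {z : SChain R i X} (hz : z ∈ cyc R i Aᶜ) : z ∈ nul R i Aᶜ := by
  obtain ⟨K, hKA, hK, hzK⟩ := csupp hz
  have hA0 : IsCompact (j ⁻¹' A) := hj.isEmbedding.isInducing.isCompact_preimage_iff hAj |>.2 hA
  have hO : IsOpen (j ⁻¹' Kᶜ) := hK.isClosed.isOpen_compl.preimage j.continuous
  have : ∀ a ∈ j ⁻¹' A, ∃ r > 0, Metric.closedBall a r ⊆ j ⁻¹' Kᶜ := fun a ha =>
    Metric.nhds_basis_closedBall.mem_iff.1 (hO.mem_nhds fun h => hKA h ha)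
  choose! r hr hb using this
  obtain ⟨t, ht, hc⟩ := hA0.elim_nhds_subcover (fun a => Metric.closedBall a (r a))
    fun a ha => Metric.closedBall_mem_nhds _ (hr a ha)
  classical
  have hsub : A ⊆ j '' ⋃ a ∈ t, Metric.closedBall a (r a) := fun x hx => by
    obtain ⟨y, rfl⟩ := hAj hx
    exact ⟨y, hc hx, rfl⟩
  refine nul_mono (Set.compl_subset_compl.2 hsub) (chart_fin hj t (fun a => Metric.closedBall a (r a))
    (fun a => convex_closedBall _ _) (fun a => isCompact_closedBall _ _) i hi z (suppOn_mono ?_ hzK))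
  rintro _ hx ⟨y, hy, rfl⟩
  obtain ⟨a, ha, hy⟩ := Set.mem_iUnion₂.1 hy
  exact hb a (ht a ha) hy hx

/-- locally Euclidean -/
def LEu (n : ℕ) (X : Type) [TopologicalSpace X] : Prop := ∀ x : X, ∃ j : C(EE n, X), IsOpenEmbedding j ∧ j 0 = x

lemma LEu.lh (hX : LEu n X) (x : X) : LH R n X x := by
  obtain ⟨j, hj, rfl⟩ := hX x
  exact (LH_euc n).exc hj

lemma ball_at (hX : LEu n X) {x : X} {z : SChain R i X} (hz : z ∈ cyc R i ({x}ᶜ : Set X)) {W : Set X} (hW : W ∈ 𝓝 x) :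
    ∃ D ∈ 𝓝 x, D ⊆ W ∧ IsCompact D ∧ z ∈ cyc R i Dᶜ ∧ (∃ j : C(EE n, X), IsOpenEmbedding j ∧ D ⊆ Set.range j) ∧
      (∀ w ∈ cyc R i Dᶜ, ∀ y ∈ D, w ∈ nul R i ({y}ᶜ : Set X) → w ∈ nul R i Dᶜ) ∧
      ∀ y ∈ D, ∀ u ∈ cyc R i ({y}ᶜ : Set X), ∃ u' ∈ cyc R i Dᶜ, u' - u ∈ nul R i ({y}ᶜ : Set X) := by
  obtain ⟨j, hj, rfl⟩ := hX x
  obtain ⟨K, hKx, hK, hzK⟩ := csupp hz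
  have hO : j ⁻¹' (Kᶜ ∩ W) ∈ 𝓝 0 := j.continuous.continuousAt.preimage_mem_nhds
    (Filter.inter_mem (hK.isClosed.isOpen_compl.mem_nhds fun h => hKx h rfl) hW)
  obtain ⟨r, hr, hb⟩ := Metric.nhds_basis_closedBall.mem_iff.1 hO
  have hz' : z ∈ cyc R i (j '' Metric.closedBall 0 r)ᶜ := by
    refine suppOn_mono ?_ hzK
    rintro _ hx ⟨y, hy, rfl⟩
    exact (hb hy).1 hx
  refine ⟨j '' Metric.closedBall 0 r, hj.isOpenMap.image_mem_nhds (Metric.closedBall_mem_nhds _ hr), ?_,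
    (isCompact_closedBall _ _).image j.continuous, hz', ⟨j, hj, Set.image_subset_range _ _⟩, ?_, ?_⟩
  · rintro _ ⟨y, hy, rfl⟩; exact (hb hy).2
  · rintro w hw _ ⟨y, hy, rfl⟩ hn
    exact chart_conv hj (convex_closedBall _ _) (isCompact_closedBall _ _) hy hw hn
  · rintro _ ⟨y, hy, rfl⟩ u hu
    exact chart_surj hj (isCompact_closedBall _ _) hu

/-- uniqueness -/
lemma glob (hX : LEu n X) {A : Set X} (hA : IsCompact A) {z : SChain R n X} (hz : z ∈ cyc R n Aᶜ)
    (h : ∀ x ∈ A, z ∈ nul R n ({x}ᶜ : Set X)) : z ∈ nul R n Aᶜ := by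
  have : ∀ x ∈ A, ∃ D ∈ 𝓝 x, IsCompact D ∧ z ∈ nul R n Dᶜ ∧ ∃ j : C(EE n, X), IsOpenEmbedding j ∧ D ⊆ Set.range j := by
    intro x hx
    obtain ⟨D, hD, -, hc, hz', hj, hn, -⟩ := ball_at hX (cyc_pt hx hz) Filter.univ_mem
    exact ⟨D, hD, hc, hn z hz' x (mem_of_mem_nhds hD) (h x hx), hj⟩
  choose! D hD hc hn hj using this
  obtain ⟨t, ht, htA⟩ := hA.elim_nhds_subcover D hD
  refine nul_mono (Set.compl_subset_compl.2 htA) ?_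
  clear htA
  classical
  induction t using Finset.induction_on with
  | empty => simpa using supp_nul (suppOn_univ z)
  | insert a s ha ih =>
    have hs : ∀ x ∈ s, x ∈ A := fun x hx => ht x (Finset.mem_insert_of_mem hx)
    have haA := ht a (Finset.mem_insert_self _ _)
    have h2 : IsCompact (⋃ k ∈ s, D k) := s.isCompact_biUnion fun k hk => hc k (hs k hk)
    rw [Finset.set_biUnion_insert, Set.compl_union]
    refine mv (hc a haA).isClosed.isOpen_compl h2.isClosed.isOpen_compl (hn a haA) (ih hs) ?_
    obtain ⟨j, hj, hDj⟩ := hj a haA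
    rw [← Set.compl_inter]
    exact fun d hd => chart_cpt hj ((hc a haA).inter h2) (Set.inter_subset_left.trans hDj) (by omega) hd

lemma const_nul (hX : LEu n X) {C : Set X} (hC : IsPreconnected C) {z : SChain R i X} (hz : z ∈ cyc R i Cᶜ) {x y : X}
    (hx : x ∈ C) (hy : y ∈ C) (h : z ∈ nul R i ({x}ᶜ : Set X)) : z ∈ nul R i ({y}ᶜ : Set X) := by
  refine (hC.induction₂ (fun x y => z ∈ nul R i ({x}ᶜ : Set X) ↔ z ∈ nul R i ({y}ᶜ : Set X)) (fun x hx => ?_)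
    (fun _ _ _ _ _ _ h1 h2 => h1.trans h2) (fun _ _ _ _ h => h.symm) hx hy).1 h
  obtain ⟨D, hD, -, -, hz', -, hn, -⟩ := ball_at hX (cyc_pt hx hz) Filter.univ_mem
  refine Filter.Eventually.filter_mono nhdsWithin_le_nhds ?_
  filter_upwards [hD] with y hy
  exact ⟨fun h => nul_pt hy (hn z hz' x (mem_of_mem_nhds hD) h), fun h => nul_pt (mem_of_mem_nhds hD) (hn z hz' y hy h)⟩

/-- `z` generates the local homology at `x` -/
def Gen (n : ℕ) {X : Type} [TopologicalSpace X] (x : X) (z : SChain ℤ n X) : Prop :=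
  z ∈ cyc ℤ n ({x}ᶜ : Set X) ∧ (∀ u ∈ cyc ℤ n ({x}ᶜ : Set X), ∃ k : ℤ, u - k • z ∈ nul ℤ n {x}ᶜ) ∧
    ∀ k : ℤ, k • z ∈ nul ℤ n {x}ᶜ → k = 0

lemma gen_nhds (hX : LEu n X) {x : X} {z : SChain ℤ n X} (h : Gen n x z) {W : Set X} (hW : W ∈ 𝓝 x) :
    ∃ D ∈ 𝓝 x, D ⊆ W ∧ IsCompact D ∧ z ∈ cyc ℤ n Dᶜ ∧ ∀ y ∈ D, Gen n y z := by
  obtain ⟨D, hD, hDW, hc, hz, -, h1, h2⟩ := ball_at hX h.1 hW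
  have hx := mem_of_mem_nhds hD
  refine ⟨D, hD, hDW, hc, hz, fun y hy => ⟨cyc_pt hy hz, fun u hu => ?_, fun k hk => h.2.2 k ?_⟩⟩
  · obtain ⟨u', hu', h3⟩ := h2 y hy u hu
    obtain ⟨k, hk⟩ := h.2.1 u' (cyc_pt hx hu')
    refine ⟨k, ?_⟩
    have := sub_mem (nul_pt hy (h1 _ (sub_mem hu' (Submodule.smul_mem _ k hz)) x hx hk)) h3
    convert this using 1; abel
  · exact nul_pt hx (h1 _ (Submodule.smul_mem _ k hz) y hy hk)

lemma Gen.unit {x : X} {z w : SChain ℤ n X} (hz : Gen n x z) (hw : Gen n x w) :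
    ∃ e : ℤˣ, z - (e : ℤ) • w ∈ nul ℤ n ({x}ᶜ : Set X) := by
  obtain ⟨a, ha⟩ := hw.2.1 z hz.1
  obtain ⟨b, hb⟩ := hz.2.1 w hw.1
  have h1 : (1 - a * b) • z ∈ nul ℤ n ({x}ᶜ : Set X) := by
    have := add_mem ha (Submodule.smul_mem _ a hb)
    rw [smul_sub, sub_add_sub_cancel, smul_smul] at this
    rwa [sub_smul, one_smul]
  have h2 := hz.2.2 _ h1
  exact ⟨⟨a, b, by linarith, by linarith⟩, ha⟩
lemma Gen.unit_eq {x : X} {z w : SChain ℤ n X} (hw : Gen n x w) {e e' : ℤˣ}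
    (h : z - (e : ℤ) • w ∈ nul ℤ n ({x}ᶜ : Set X)) (h' : z - (e' : ℤ) • w ∈ nul ℤ n ({x}ᶜ : Set X)) : e = e' := by
  have := sub_mem h h'
  rw [sub_sub_sub_cancel_left, ← sub_smul] at this
  exact Units.ext (by linarith [hw.2.2 _ this])

lemma glob_ex (hX : LEu n X) (O : X → SChain ℤ n X → Prop)
    (h1 : ∀ x z z', O x z → O x z' → z - z' ∈ nul ℤ n ({x}ᶜ : Set X))
    (h2 : ∀ x z z', O x z → z' - z ∈ nul ℤ n ({x}ᶜ : Set X) → O x z')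
    {A : Set X} (hA : IsCompact A) (h3 : ∀ x ∈ A, ∃ D ∈ 𝓝 x, IsCompact D ∧ ∃ z ∈ cyc ℤ n Dᶜ, ∀ y ∈ D ∩ A, O y z) :
    ∃ z ∈ cyc ℤ n Aᶜ, ∀ y ∈ A, O y z := by
  choose D hD hc z hz hO using fun x : A => h3 x x.2
  obtain ⟨t, htA⟩ := hA.elim_nhds_subcover' (fun x hx => D ⟨x, hx⟩) fun x hx => hD ⟨x, hx⟩
  replace htA : A ⊆ ⋃ x ∈ t, D x ∩ A := fun y hy => by
    obtain ⟨x, hx, hy'⟩ := Set.mem_iUnion₂.1 (htA hy)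
    exact Set.mem_biUnion hx ⟨hy', hy⟩
  replace hc := fun x => (hc x).inter hA
  replace hz := fun x => cyc_mono (Set.compl_subset_compl.2 (Set.inter_subset_left (s := D x) (t := A))) (hz x)
  suffices ∃ z ∈ cyc ℤ n (⋃ x ∈ t, D x ∩ A)ᶜ, ∀ y ∈ ⋃ x ∈ t, D x ∩ A, O y z by
    obtain ⟨z, hz, h⟩ := this
    exact ⟨z, cyc_mono (Set.compl_subset_compl.2 htA) hz, fun y hy => h y (htA hy)⟩
  clear htA
  classical
  induction t using Finset.induction_on with
  | empty => exact ⟨0, zero_mem _, by simp⟩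
  | insert a s ha ih =>
    obtain ⟨b, hb, hbO⟩ := ih
    have hs : IsCompact (⋃ k ∈ s, D k ∩ A) := s.isCompact_biUnion fun k hk => hc k
    rw [Finset.set_biUnion_insert, Set.compl_union]
    obtain ⟨w, hw, hw1, hw2⟩ := mv_glue (hc a).isClosed.isOpen_compl hs.isClosed.isOpen_compl (hz a) hb (by
      rw [← Set.compl_inter]
      refine glob hX ((hc a).inter hs) ?_ fun x hx => h1 _ _ _ (hO a x hx.1) (hbO x hx.2)
      exact sub_mem (cyc_mono (Set.compl_subset_compl.2 Set.inter_subset_left) (hz a))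
        (cyc_mono (Set.compl_subset_compl.2 Set.inter_subset_right) hb))
    refine ⟨w, hw, ?_⟩
    rintro y (hy | hy)
    · exact h2 _ _ _ (hO a y hy) (nul_pt hy hw1)
    · exact h2 _ _ _ (hbO y hy) (nul_pt hy hw2)
end Exc
end
noncomputable section
open Finset
open Topology

section
variable {R : Type} [CommRing R] {X Y : Type} [TopologicalSpace X] [TopologicalSpace Y] {m n i : ℕ} {A S : Set X}

def CS (A : Set X) : Set (X × ℝ) := {q | 0 ≤ q.2 ∧ (q.2 = 0 ∨ q.1 ∈ A)}
abbrev Col (A : Set X) : Type := ↥(CS A)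
def icol (A : Set X) : C(X, Col A) := ⟨fun x => ⟨(x, 0), le_rfl, Or.inl rfl⟩, by fun_prop⟩
def rcol (A : Set X) : C(Col A, X) := ⟨fun q => q.1.1, by fun_prop⟩
def kcol (A : Set X) : C(A × unitInterval, Col A) :=
  ⟨fun q => ⟨(q.1.1, q.2.1), q.2.2.1, Or.inr q.1.2⟩, by fun_prop⟩
def KC (A : Set X) : Set (Col A) := {q | q.1.2 = 0}
def vcm (A : Set X) : C(A, X) := ⟨Subtype.val, continuous_subtype_val⟩

lemma KC_eq : KC A = Set.range (icol A) := by
  ext ⟨⟨x, t⟩, h⟩; constructor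
  · rintro (rfl : t = 0); exact ⟨x, rfl⟩
  · rintro ⟨y, hy⟩; rw [← hy]; rfl

lemma supp_empty {c : SChain R n X} (h : c ∈ suppOn R n (∅ : Set X)) : c = 0 := by
  ext σ; by_contra h0
  have := h (Finsupp.mem_support_iff.2 h0)
  exact this ⟨vertexPt 0, rfl⟩

lemma lift_sub (A : Set X) {u : SChain R n X} (hu : u ∈ suppOn R n A) : ∃ v : SChain R n A, cmap R (vcm A) v = u :=
  exists_lift (j := vcm A) IsEmbedding.subtypeVal (by rwa [show Set.range (vcm A) = A from Subtype.range_coe])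
lemma vcm_inj (A : Set X) : Function.Injective (vcm A) := Subtype.val_injective

lemma ext_col (hS : S ⊆ A) {c : SChain R (m + 1) X} (hc : c ∈ cyc R (m + 1) S) : ∃ c' : SChain R (m + 1) (Col A),
    c' ∈ cyc R (m + 1) {q : Col A | q.1.1 ∈ S ∧ q.1.2 = 1} ∧ c' - cmap R (icol A) c ∈ suppOn R (m + 1) {q : Col A | q.1.1 ∈ S} := by
  rw [mem_cyc_succ] at hc
  obtain ⟨b, hb⟩ := lift_sub A (suppOn_mono hS hc)
  have hbS : b ∈ suppOn R m ((vcm A) ⁻¹' S) := by rw [← cmap_mem_iff (vcm_inj A), hb]; exact hc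
  have hb0 : prismb b = 0 := by
    have : b ∈ cyc R m (∅ : Set A) := by
      rw [mem_cyc, cmap_inj (vcm_inj A) (a₁ := sbdryN R m b) (a₂ := 0) (by rw [← sbdryN_cmap, hb, sbdryN_sbdry, map_zero])]
      exact Submodule.zero_mem _
    exact supp_empty (by simpa using prismb_mem this)
  refine ⟨cmap R (icol A) c + cmap R (kcol A) (prism R b), ?_, ?_⟩
  · rw [mem_cyc_succ, map_add, sbdry_cmap, sbdry_cmap, ← hb, sbdry_prism', hb0, sub_zero, map_sub, cmap_cmap, cmap_cmap, cmap_cmap,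
      show (kcol A).comp (inI 0) = (icol A).comp (vcm A) from rfl, add_sub_cancel]
    exact cmap_mem (f := (kcol A).comp (inI 1)) (B := {q : Col A | q.1.1 ∈ S ∧ q.1.2 = 1}) (fun x hx => ⟨hx, rfl⟩) hbS
  · rw [add_sub_cancel_left]
    exact cmap_mem (f := kcol A) (B := {q : Col A | q.1.1 ∈ S}) (fun x hx => hx.1) (prism_mem hbS)

structure Good (n : ℕ) (X : Type) [TopologicalSpace X] (A : Set X) : Prop where
  t2 : T2Space X
  cpt : CompactSpace X
  leu : LEu n (Col A)
  cl : IsClosed A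
  dn : A ⊆ closure Aᶜ

lemma Good.ex (h : Good n X A) [Nonempty X] : ∃ x, x ∉ A := by
  by_contra! hx
  have := h.dn (hx (Classical.arbitrary X))
  rw [show Aᶜ = ∅ from Set.compl_empty_iff.2 (Set.eq_univ_of_forall hx), closure_empty] at this; exact this

lemma icol_off {x : X} (hx : x ∉ A) : Set.MapsTo (icol A) A ({icol A x}ᶜ : Set (Col A)) := fun a ha he =>
  hx (by rwa [← show a = x from congrArg (fun q : Col A => q.1.1) he])

lemma Good.nul_iff (h : Good (m + 1) X A) [PreconnectedSpace X] {x : X} (hx : x ∉ A) {c : SChain R (m + 1) X}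
    (hc : c ∈ cyc R (m + 1) A) : c ∈ nul R (m + 1) A ↔ cmap R (icol A) c ∈ nul R (m + 1) ({icol A x}ᶜ : Set (Col A)) := by
  haveI := h.t2; haveI := h.cpt
  constructor
  · exact nul_map (icol_off hx)
  · intro hn
    obtain ⟨c', h1, h2⟩ := ext_col le_rfl hc
    have hK : c' ∈ cyc R (m + 1) (KC A)ᶜ := cyc_mono (fun q hq (h0 : q.1.2 = 0) => by have := hq.2; linarith) h1
    have h3 : c' ∈ nul R (m + 1) ({icol A x}ᶜ : Set (Col A)) := by
      rw [← sub_add_cancel c' (cmap R (icol A) c)]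
      refine add_mem (supp_nul (suppOn_mono ?_ h2)) hn
      rintro q hq rfl; exact hx hq
    have h4 := glob h.leu (A := KC A) (KC_eq (A := A) ▸ isCompact_range (icol A).continuous) hK
      (fun y hy => const_nul h.leu (C := KC A) (KC_eq (A := A) ▸ isPreconnected_range (icol A).continuous) hK rfl hy h3)
    have h5 := nul_map (f := rcol A) (B := A) (fun q hq => q.2.2.resolve_left hq) h4
    have h6 := cmap_mem (f := rcol A) (B := A) (fun q hq => hq) h2
    rw [map_sub, cmap_cmap, show (rcol A).comp (icol A) = .id X from rfl, cmap_id] at h6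
    simpa using sub_mem h5 (supp_nul h6)

lemma Good.deg (h : Good (m + 1) X A) [ConnectedSpace X] : ∃ d : cyc ℤ (m + 1) A →ₗ[ℤ] ℤ, ∀ c, d c = 0 ↔ c.1 ∈ nul ℤ (m + 1) A := by
  haveI := h.t2
  obtain ⟨x, hx⟩ := h.ex
  obtain ⟨g, hg, h1, h2⟩ := (h.leu.lh (R := ℤ) (icol A x)).gen
  have hm : ∀ c : cyc ℤ (m + 1) A, cmap ℤ (icol A) c.1 ∈ cyc ℤ (m + 1) ({icol A x}ᶜ : Set (Col A)) := fun c =>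
    cyc_map (icol_off hx) c.2
  choose d hd using fun c => h1 _ (hm c)
  have hu : ∀ c k, cmap ℤ (icol A) c.1 - k • g ∈ nul ℤ (m + 1) ({icol A x}ᶜ : Set (Col A)) → d c = k := fun c k hk =>
    sub_eq_zero.1 (h2 _ (by have := sub_mem hk (hd c); rwa [sub_sub_sub_cancel_left, ← sub_smul] at this))
  refine ⟨⟨⟨d, fun a b => hu _ _ ?_⟩, fun k a => hu _ _ ?_⟩, fun c => ?_⟩
  · have := add_mem (hd a) (hd b)
    simp only [Submodule.coe_add, map_add, add_smul]; convert this using 1; abel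
  · have := Submodule.smul_mem _ k (hd a)
    rwa [smul_sub, ← map_smul, smul_smul] at this
  · rw [h.nul_iff hx c.2]
    constructor
    · intro (h0 : d c = 0); have := hd c; rwa [h0, zero_smul, sub_zero] at this
    · intro h0; exact hu _ _ (by rwa [zero_smul, sub_zero])

lemma Good.fund (h : Good (m + 1) X A) [ConnectedSpace X] : ∃ c, IsFundCycle (m + 1) A c := by
  obtain ⟨d, hd⟩ := h.deg
  obtain ⟨c, hc⟩ : ∃ c, d c = Submodule.IsPrincipal.generator (LinearMap.range d) := Submodule.IsPrincipal.generator_mem (LinearMap.range d)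
  refine ⟨c.1, c.2, fun z hz => ?_⟩
  obtain ⟨k, hk⟩ := (Submodule.IsPrincipal.mem_iff_eq_smul_generator (LinearMap.range d)).1 ⟨⟨z, hz⟩, rfl⟩
  exact ⟨k, relH_iff.2 ((hd (⟨z, hz⟩ - k • c)).1 (by rw [map_sub, map_smul, hk, hc, sub_self]))⟩

lemma Good.tf (h : Good (m + 1) X A) [ConnectedSpace X] {c : SChain ℤ (m + 1) X} (hc : c ∈ cyc ℤ (m + 1) A) {k : ℤ} (hk : k ≠ 0)
    (h0 : k • c ∈ nul ℤ (m + 1) A) : c ∈ nul ℤ (m + 1) A := by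
  obtain ⟨d, hd⟩ := h.deg
  have := (hd (k • ⟨c, hc⟩)).2 h0
  rw [map_smul, smul_eq_mul] at this
  exact (hd ⟨c, hc⟩).1 ((mul_eq_zero.1 this).resolve_left hk)

lemma Good.ho (h : Good (m + 1) X A) [ConnectedSpace X] {c : SChain ℤ (m + 1) X} (hc : c ∈ cyc ℤ (m + 1) A) (h0 : c ∉ nul ℤ (m + 1) A) :
    HomOrientable (m + 1) X A := by
  obtain ⟨g, hg⟩ := h.fund
  refine ⟨g, hg, fun hn => h0 ?_⟩
  obtain ⟨k, hk⟩ := hg.2 c hc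
  rw [relH_iff] at hn hk
  simpa using add_mem hk (Submodule.smul_mem _ k hn)

lemma Good.bdn (h : Good (m + 1) X A) [PreconnectedSpace X] [Nonempty X] {B : Set X} (hB : B ⊆ A) (hB' : B.Nonempty)
    {c w : SChain R (m + 1) X} (hw : w ∈ suppOn R (m + 1) B) (hc : c - w ∈ cyc R (m + 1) (A \ B)) : c ∈ nul R (m + 1) A := by
  haveI := h.t2
  obtain ⟨x0, hx0⟩ := h.ex
  obtain ⟨x, hx⟩ := hB'
  have hwA := suppOn_mono hB hw
  have hcA : c ∈ cyc R (m + 1) A := by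
    rw [← sub_add_cancel c w]; exact add_mem (cyc_mono Set.diff_subset hc) (supp_cyc hwA)
  obtain ⟨c', h1, h2⟩ := ext_col Set.diff_subset hc
  let ray : Set.Ici (0 : ℝ) → Col A := fun t => ⟨(x, t.1), t.2, Or.inr (hB hx)⟩
  have hray : Continuous ray := by fun_prop
  have hC : IsPreconnected (KC A ∪ Set.range ray) :=
    IsPreconnected.union (icol A x) rfl ⟨⟨0, Set.mem_Ici.2 le_rfl⟩, rfl⟩ (KC_eq (A := A) ▸ isPreconnected_range (icol A).continuous)
      (haveI : PreconnectedSpace (Set.Ici (0 : ℝ)) := Subtype.preconnectedSpace isPreconnected_Ici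
       isPreconnected_range hray)
  have hcC : c' ∈ cyc R (m + 1) (KC A ∪ Set.range ray)ᶜ := by
    refine cyc_mono ?_ h1
    rintro q ⟨⟨h3, h3'⟩, h4⟩ (h5 | ⟨t, rfl⟩)
    · rw [show q.1.2 = 0 from h5] at h4; norm_num at h4
    · exact h3' hx
  obtain ⟨K, -, hK, hcK⟩ := csupp (S := Set.univ) (c := c') (suppOn_univ _)
  obtain ⟨T, hT⟩ := (hK.image (f := fun q : Col A => q.1.2) (by fun_prop)).bddAbove
  have hn : c' ∈ nul R (m + 1) ({ray ⟨max T 0 + 1, by simp; positivity⟩}ᶜ : Set (Col A)) := by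
    refine supp_nul (suppOn_mono ?_ hcK)
    rintro q hq rfl
    have := hT ⟨_, hq, rfl⟩
    simp [ray] at this
    linarith [le_max_left T 0]
  have h3 := const_nul h.leu hC hcC (Or.inr ⟨_, rfl⟩) (Or.inl (rfl : icol A x0 ∈ KC A)) hn
  rw [h.nul_iff hx0 hcA]
  have h4 : cmap R (icol A) (c - w) ∈ nul R (m + 1) ({icol A x0}ᶜ : Set (Col A)) := by
    rw [← sub_sub_cancel c' (cmap R (icol A) (c - w))]
    refine sub_mem h3 (supp_nul (suppOn_mono ?_ h2))
    rintro q hq rfl; exact hx0 hq.1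
  rw [← sub_add_cancel c w, map_add]
  refine add_mem h4 (supp_nul (cmap_mem (icol_off hx0) hwA))
end
end
noncomputable section
open Finset
open Topology

section
variable {R : Type} [CommRing R] {X Y : Type} [TopologicalSpace X] [TopologicalSpace Y] {m n i : ℕ} {A S : Set X}

abbrev HS (n : ℕ) : Type := {y : EE n // 0 ≤ ∑ i, y i}
lemma recen {x : X} {j : C(EE n, X)} (hj : IsOpenEmbedding j) (hx : x ∈ Set.range j) :
    ∃ j : C(EE n, X), IsOpenEmbedding j ∧ j 0 = x := by
  obtain ⟨v, rfl⟩ := hx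
  exact ⟨j.comp (Homeomorph.addRight v : C(EE n, EE n)), hj.comp (Homeomorph.addRight v).isOpenEmbedding, by simp⟩
lemma emb_of {Z : Type} [TopologicalSpace Z] {U : Set X} (hU : IsOpen U) (e : U ≃ₜ Z) :
    ∃ j : C(Z, X), IsOpenEmbedding j ∧ Set.range j = U :=
  ⟨(vcm U).comp (e.symm : C(Z, U)), hU.isOpenEmbedding_subtypeVal.comp e.symm.isOpenEmbedding, by
    change Set.range (Subtype.val ∘ e.symm) = U
    rw [Set.range_comp, e.symm.surjective.range_eq, Set.image_univ, Subtype.range_coe]⟩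
lemma not_bd {x : X} : x ∉ intBoundary n X ↔ ∃ j : C(EE n, X), IsOpenEmbedding j ∧ x ∈ Set.range j := by
  rw [intBoundary, Set.mem_setOf_eq, not_not]
  constructor
  · rintro ⟨U, hx, hU, ⟨e⟩⟩
    obtain ⟨j, h1, h2⟩ := emb_of hU e
    exact ⟨j, h1, h2 ▸ hx⟩
  · rintro ⟨j, hj, hx⟩
    exact ⟨_, hx, hj.isOpen_range, ⟨hj.isEmbedding.toHomeomorph.symm⟩⟩
lemma bd_closed : IsClosed (intBoundary n X) := by
  rw [← isOpen_compl_iff, isOpen_iff_mem_nhds]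
  intro x hx
  obtain ⟨j, hj, h⟩ := not_bd.1 hx
  exact Filter.mem_of_superset (hj.isOpen_range.mem_nhds h) fun y hy => not_bd.2 ⟨j, hj, hy⟩
lemma ball_chart {p : EE n} {U : Set (EE n)} (hU : U ∈ 𝓝 p) : ∃ j : C(EE n, EE n), IsOpenEmbedding j ∧ j 0 = p ∧ Set.range j ⊆ U := by
  obtain ⟨r, hr, h⟩ := Metric.mem_nhds_iff.1 hU
  have hs : (OpenPartialHomeomorph.univBall p r).source = Set.univ := by simp
  refine ⟨⟨_, OpenPartialHomeomorph.continuous_univBall p r⟩, OpenPartialHomeomorph.isOpenEmbedding _ hs, by simp, ?_⟩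
  rintro _ ⟨v, rfl⟩
  refine h ?_
  rw [← OpenPartialHomeomorph.univBall_target p hr]
  exact OpenPartialHomeomorph.map_source _ (by simp)
lemma half_int {k : C(HS n, X)} (hk : IsOpenEmbedding k) {y : HS n} (hy : 0 < ∑ i, y.1 i) : k y ∉ intBoundary n X := by
  have ho : IsOpen {v : EE n | 0 < ∑ i, v i} := isOpen_lt continuous_const (by fun_prop)
  obtain ⟨j, h1, h2, h3⟩ := ball_chart (ho.mem_nhds hy)
  let f : C(EE n, HS n) := ⟨fun v => ⟨j v, le_of_lt (h3 ⟨v, rfl⟩)⟩, by fun_prop⟩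
  refine not_bd.2 ⟨k.comp f, hk.comp ⟨IsEmbedding.of_comp f.continuous continuous_subtype_val h1.isEmbedding, ?_⟩, ⟨0, ?_⟩⟩
  · rw [show Set.range f = Subtype.val ⁻¹' Set.range j from ?_]
    · exact h1.isOpen_range.preimage continuous_subtype_val
    · ext v; constructor
      · rintro ⟨w, rfl⟩; exact ⟨w, rfl⟩
      · rintro ⟨w, hw⟩; exact ⟨w, Subtype.ext hw⟩
  · change k (f 0) = k y; congr 1; exact Subtype.ext h2

def one' (n : ℕ) : EE n := WithLp.toLp 2 fun _ => 1
lemma sum_one (v : EE n) (t : ℝ) : ∑ i, (v + t • one' n) i = ∑ i, v i + t * n := by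
  simp [one', Finset.sum_add_distrib, mul_comm]
def tr (t : ℝ) (ht : 0 ≤ t) : C(HS n, HS n) := ⟨fun v => ⟨v.1 + t • one' n, by rw [sum_one]; have := v.2; positivity⟩, by fun_prop⟩
lemma half_bd [T1Space X] {k : C(HS (m + 1), X)} (hk : IsOpenEmbedding k) {y : HS (m + 1)} (hy : ∑ i, y.1 i = 0) :
    k y ∈ intBoundary (m + 1) X := by
  by_contra hb
  obtain ⟨j, hj, h0⟩ := not_bd.1 hb
  obtain ⟨j, hj, h0⟩ := recen hj h0
  obtain ⟨g, hg, -, h2⟩ := ((LH_euc (R := ℤ) (m + 1)).exc hj).gen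
  rw [h0] at hg h2
  obtain ⟨v, hv, h3⟩ := exc_surj hk (S := {k y}ᶜ) isClosed_singleton.isOpen_compl (by
    ext x; by_cases hx : x = k y <;> simp [hx]) hg
  have hne : ∀ (w : HS (m + 1)) (t : ℝ) (ht : 0 ≤ t), (tr t ht w) = y → w = y ∧ t = 0 := by
    intro w t ht h
    have h1 : w.1 + t • one' (m + 1) = y.1 := congrArg Subtype.val h
    have h4 : ∑ i, w.1 i + t * (m + 1 : ℕ) = 0 := by rw [← sum_one, h1, hy]
    have h5 := w.2
    have h6 : t = 0 := by
      rcases ht.eq_or_lt with h | h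
      · exact h.symm
      · have : 0 < t * (m + 1 : ℕ) := by positivity
        linarith
    subst h6; exact ⟨Subtype.ext (by simpa using h1), rfl⟩
  have hv' : v ∈ nul ℤ (m + 1) (k ⁻¹' {k y}ᶜ) := by
    have := hinv (R := ℤ) (A := k ⁻¹' {k y}ᶜ) (B := k ⁻¹' {k y}ᶜ) (c := v)
      ⟨fun q : HS (m + 1) × unitInterval => (⟨q.1.1 + q.2.1 • one' (m + 1), (tr q.2.1 q.2.2.1 q.1).2⟩ : HS (m + 1)), by fun_prop⟩ (.id _)
      (tr 1 zero_le_one) (fun x => Subtype.ext (by simp)) (fun x => Subtype.ext (by simp [tr]))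
      (fun x hx t he => hx (by rw [(hne x t.1 t.2.1 (hk.injective he)).1]; rfl)) hv
    rw [cmap_id] at this
    have h5 : cmap ℤ (tr 1 zero_le_one) v ∈ nul ℤ (m + 1) (k ⁻¹' {k y}ᶜ) :=
      supp_nul (cmap_mem (f := tr 1 zero_le_one) (B := k ⁻¹' {k y}ᶜ) (A := Set.univ) (fun x _ he => one_ne_zero (hne x 1 zero_le_one (hk.injective he)).2) (suppOn_univ _))
    simpa using sub_mem h5 this
  have h6 : (1 : ℤ) • g ∈ nul ℤ (m + 1) ({k y}ᶜ : Set X) := by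
    have := add_mem h3 (nul_map (f := k) (B := {k y}ᶜ) (fun _ h => h) hv')
    simpa using this
  exact one_ne_zero (h2 1 h6)

lemma half_iff [T1Space X] {k : C(HS (m + 1), X)} (hk : IsOpenEmbedding k) {y : HS (m + 1)} :
    k y ∈ intBoundary (m + 1) X ↔ ∑ i, y.1 i = 0 :=
  ⟨fun h => by
    by_contra h0; exact half_int hk (y.2.lt_of_ne (Ne.symm h0)) h, half_bd hk⟩

def phc (v : EE n) : ℝ := max 0 (-(∑ i, v i) / n)
lemma phc_le (v : EE (m + 1)) : 0 ≤ ∑ i, (v + phc v • one' (m + 1)) i := by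
  rw [sum_one, phc]
  have h : (0 : ℝ) < (m + 1 : ℕ) := by positivity
  have := mul_le_mul_of_nonneg_right (le_max_right 0 (-(∑ i, v i) / (m + 1 : ℕ))) h.le
  rw [div_mul_cancel₀ _ h.ne'] at this; linarith
lemma half_col [T1Space X] {k : C(HS (m + 1), X)} (hk : IsOpenEmbedding k) (q : Col (intBoundary (m + 1) X)) (hq : q.1.1 ∈ Set.range k) :
    ∃ j : C(EE (m + 1), Col (intBoundary (m + 1) X)), IsOpenEmbedding j ∧ j 0 = q := by
  have hn : (0 : ℝ) < (m + 1 : ℕ) := by positivity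
  have hc : Continuous (phc : EE (m + 1) → ℝ) := by unfold phc; fun_prop
  let ψ : EE (m + 1) → HS (m + 1) × ℝ := fun v => (⟨v + phc v • one' _, phc_le v⟩, phc v)
  have hψ : IsEmbedding ψ := IsEmbedding.of_leftInverse (f := fun p => p.1.1 - p.2 • one' _) (fun v => by simp [ψ]) (by fun_prop) (by fun_prop)
  have h0 : ∀ v, 0 ≤ phc v ∧ (phc v = 0 ∨ k (ψ v).1 ∈ intBoundary (m + 1) X) := fun v => by
    refine ⟨le_max_left _ _, ?_⟩
    rcases le_total (-(∑ i, v i) / (m + 1 : ℕ)) 0 with h | h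
    · exact Or.inl (max_eq_left h)
    · refine Or.inr (half_bd hk ?_)
      simp only [ψ]; rw [sum_one, phc, max_eq_right h, div_mul_cancel₀ _ hn.ne']; ring
  let φ : C(EE (m + 1), Col (intBoundary (m + 1) X)) := ⟨fun v => ⟨(k (ψ v).1, (ψ v).2), h0 v⟩, by fun_prop⟩
  have hr : Set.range φ = {q | q.1.1 ∈ Set.range k} := by
    ext ⟨⟨x, t⟩, h1, h2⟩; constructor
    · rintro ⟨v, hv⟩; rw [← hv]; exact ⟨_, rfl⟩
    · rintro ⟨y, rfl : k y = x⟩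
      have hp : phc (y.1 - t • one' _) = t := by
        have := y.2
        rw [phc, sub_eq_add_neg, ← neg_smul, sum_one]
        rcases h2 with (rfl : t = 0) | h2
        · simp; exact div_nonpos_of_nonpos_of_nonneg (by linarith) (by positivity)
        · rw [(half_iff hk).1 h2, max_eq_right, div_eq_iff hn.ne'] <;> [ring; (apply div_nonneg _ hn.le; have : (0 : ℝ) ≤ t * (m + 1 : ℕ) := mul_nonneg h1 hn.le; linarith)]
      refine ⟨y.1 - t • one' _, Subtype.ext (Prod.ext ?_ hp)⟩
      change k (ψ _).1 = k y
      congr 1; exact Subtype.ext (by simp [ψ, hp])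
  refine recen (j := φ) ⟨IsEmbedding.of_comp φ.continuous continuous_subtype_val ((hk.isEmbedding.prodMap IsEmbedding.id).comp hψ), ?_⟩ (hr ▸ hq)
  rw [hr]
  exact hk.isOpen_range.preimage (by fun_prop : Continuous fun q : Col (intBoundary (m + 1) X) => q.1.1)

lemma mfd_half (h : IsManifoldWithBoundary n X) {x : X} (hx : x ∈ intBoundary n X) : ∃ k : C(HS n, X), IsOpenEmbedding k ∧ x ∈ Set.range k := by
  obtain ⟨U, hxU, hU, ⟨⟨e⟩⟩ | ⟨⟨e⟩⟩⟩ := h.2.2 x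
  · exact (hx ⟨U, hxU, hU, ⟨e⟩⟩).elim
  · obtain ⟨j, h1, h2⟩ := emb_of hU e
    exact ⟨j, h1, h2 ▸ hxU⟩

lemma mfd_good [CompactSpace X] (h : IsManifoldWithBoundary (m + 1) X) : Good (m + 1) X (intBoundary (m + 1) X) := by
  haveI := h.1
  refine ⟨h.1, inferInstance, fun q => ?_, bd_closed, fun x hx => ?_⟩
  · by_cases hq : q.1.1 ∈ intBoundary (m + 1) X
    · obtain ⟨k, h1, h2⟩ := mfd_half h hq
      exact half_col h1 q h2
    · obtain ⟨j, h1, h2⟩ := not_bd.1 hq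
      refine recen (j := (icol _).comp j) ⟨IsEmbedding.of_comp (ContinuousMap.continuous _) (rcol _).continuous h1.isEmbedding, ?_⟩ ?_
      · rw [show Set.range ((icol _).comp j) = rcol (intBoundary (m + 1) X) ⁻¹' Set.range j from ?_]
        · exact h1.isOpen_range.preimage (rcol _).continuous
        ext ⟨⟨x, t⟩, h3, h4⟩; constructor
        · rintro ⟨v, hv⟩; rw [← hv]; exact ⟨v, rfl⟩
        · rintro ⟨v, hv : j v = x⟩
          obtain rfl : t = 0 := h4.resolve_right (not_bd.2 ⟨j, h1, v, hv⟩)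
          exact ⟨v, Subtype.ext (Prod.ext hv rfl)⟩
      · obtain ⟨v, hv⟩ := h2
        exact ⟨v, Subtype.ext (Prod.ext hv (q.2.2.resolve_right hq).symm)⟩
  · obtain ⟨k, h1, y, rfl⟩ := mfd_half h hx
    have ht : Filter.Tendsto (fun N : ℕ => k (tr (1 / ((N : ℝ) + 1)) (by positivity) y)) Filter.atTop (𝓝 (k y)) := by
      refine (k.continuous.tendsto y).comp (tendsto_subtype_rng.2 ?_)
      simpa [tr] using (tendsto_const_nhds (x := y.1)).add ((tendsto_one_div_add_atTop_nhds_zero_nat (𝕜 := ℝ)).smul_const (one' (m + 1)))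
    refine mem_closure_of_tendsto ht (Filter.Eventually.of_forall fun N => half_int h1 ?_)
    change 0 < ∑ i, (y.1 + _) i
    rw [sum_one]; have := y.2; positivity

def iot' (m : ℕ) : C(EE m, HS (m + 1)) := ⟨fun v => ⟨WithLp.toLp 2 (Fin.snoc v.ofLp (-∑ i, v i) : Fin (m + 1) → ℝ), by simp [Fin.sum_univ_castSucc]⟩, by
  refine Continuous.subtype_mk ((PiLp.continuous_toLp 2 _).comp (continuous_pi fun i => ?_)) _
  refine Fin.lastCases ?_ (fun i => ?_) i <;> simp <;> fun_prop⟩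
lemma bd_leu (h : IsManifoldWithBoundary (m + 1) X) : LEu m (intBoundary (m + 1) X) := by
  haveI := h.1
  intro x
  obtain ⟨k, h1, hx⟩ := mfd_half h x.2
  have hs : ∀ v, ∑ i, (iot' m v).1 i = 0 := fun v => by simp [iot', Fin.sum_univ_castSucc]
  let φ : C(EE m, intBoundary (m + 1) X) := ⟨fun v => ⟨k (iot' m v), half_bd h1 (hs v)⟩, by fun_prop⟩
  have hr : Set.range φ = Subtype.val ⁻¹' Set.range k := by
    ext ⟨x, hx⟩; constructor
    · rintro ⟨v, hv⟩; rw [← hv]; exact ⟨_, rfl⟩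
    · rintro ⟨y, rfl : k y = x⟩
      have := (half_iff h1).1 hx
      refine ⟨WithLp.toLp 2 fun i => y.1 i.castSucc, Subtype.ext (congrArg k (Subtype.ext ?_))⟩
      ext i; refine Fin.lastCases ?_ (fun i => ?_) i <;> simp [iot']
      rw [Fin.sum_univ_castSucc] at this; linarith
  refine recen (j := φ) ⟨IsEmbedding.of_comp φ.continuous continuous_subtype_val (h1.isEmbedding.comp ?_), ?_⟩ (hr ▸ hx)
  · exact IsEmbedding.of_leftInverse (f := fun y : HS (m + 1) => WithLp.toLp 2 fun i : Fin m => y.1 i.castSucc) (fun v => by ext i; simp [iot']) (by fun_prop) (iot' m).continuous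
  · rw [hr]; exact h1.isOpen_range.preimage continuous_subtype_val

lemma leu_good [T2Space X] [CompactSpace X] (h : LEu n X) : Good n X ∅ := by
  refine ⟨inferInstance, inferInstance, fun q => ?_, isClosed_empty, by simp⟩
  obtain ⟨j, h1, h2⟩ := h q.1.1
  have hs : Function.Surjective (icol (∅ : Set X)) := fun q => ⟨q.1.1, Subtype.ext (Prod.ext rfl (q.2.2.resolve_right (fun h => h)).symm)⟩
  obtain ⟨x, rfl⟩ := hs q
  refine ⟨(icol _).comp j, IsOpenEmbedding.comp (g := icol (∅ : Set X)) ⟨IsEmbedding.of_leftInverse (f := rcol _) (fun _ => rfl) (rcol _).continuous (icol _).continuous, ?_⟩ h1, congrArg (icol (∅ : Set X)) h2⟩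
  rw [hs.range_eq]; exact isOpen_univ

lemma Good.pull (h : Good n X A) [T2Space Y] [CompactSpace Y] {p : Y → X} (hp : IsLocalHomeomorph p) : Good n Y (p ⁻¹' A) := by
  refine ⟨inferInstance, inferInstance, fun q => ?_, h.cl.preimage hp.continuous,
    (Set.preimage_mono h.dn).trans hp.isOpenMap.preimage_closure_subset_closure_preimage⟩
  have hpc := hp.continuous
  obtain ⟨e, he, rfl⟩ := hp q.1.1
  obtain ⟨j, h1, h2⟩ := h.leu ⟨(e q.1.1, q.1.2), q.2⟩
  have hm : {v | (j v).1.1 ∈ e.target} ∈ 𝓝 (0 : EE n) :=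
    (e.open_target.preimage (by fun_prop : Continuous fun v => (j v).1.1)).mem_nhds (by rw [Set.mem_preimage, h2]; exact e.map_source he)
  obtain ⟨b, hb, hb0, hbr⟩ := ball_chart hm
  have hf : IsOpenEmbedding (j.comp b) := h1.comp hb
  have hin : ∀ v, (j (b v)).1.1 ∈ e.target := fun v => hbr ⟨v, rfl⟩
  let φ : C(EE n, Col (e ⁻¹' A)) := ⟨fun v => ⟨(e.symm (j (b v)).1.1, (j (b v)).1.2), by
    have := (j (b v)).2
    refine ⟨this.1, this.2.imp id fun h => ?_⟩
    change e (e.symm _) ∈ A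
    rwa [e.right_inv (hin v)]⟩, by
      have : Continuous fun v => e.symm (j (b v)).1.1 := e.continuousOn_symm.comp_continuous (by fun_prop) hin
      fun_prop⟩
  let P : C(Col (e ⁻¹' A), Col A) := ⟨fun q => ⟨(e q.1.1, q.1.2), q.2⟩, by fun_prop⟩
  have hP : P ∘ φ = j.comp b := by
    ext v <;> simp [P, φ, e.right_inv (hin v)]
  refine ⟨φ, ⟨IsEmbedding.of_comp φ.continuous P.continuous (hP ▸ hf.isEmbedding), ?_⟩, ?_⟩
  · rw [show Set.range φ = {q | q.1.1 ∈ e.source} ∩ P ⁻¹' Set.range (j.comp b) from ?_]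
    · exact (e.open_source.preimage (by fun_prop : Continuous fun q : Col (e ⁻¹' A) => q.1.1)).inter (hf.isOpen_range.preimage P.continuous)
    ext q; constructor
    · rintro ⟨v, rfl⟩; exact ⟨e.map_target (hin v), v, (congrFun hP v).symm⟩
    · rintro ⟨h3, v, hv⟩
      have h4 : j (b v) = P q := hv
      refine ⟨v, Subtype.ext (Prod.ext ?_ ?_)⟩
      · change e.symm (j (b v)).1.1 = _; rw [h4]; exact e.left_inv h3
      · change (j (b v)).1.2 = _; rw [h4]; rfl
  · refine Subtype.ext (Prod.ext ?_ ?_)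
    · change e.symm (j (b 0)).1.1 = _; rw [hb0, h2]; exact e.left_inv he
    · change (j (b 0)).1.2 = _; rw [hb0, h2]
end
end
noncomputable section
open Finset
open Topology

section
variable {R : Type} [CommRing R] {X Y : Type} [TopologicalSpace X] [TopologicalSpace Y] {m n i : ℕ} {A S : Set X}

instance : ConnectedSpace (TSimplex n) :=
  Subtype.connectedSpace ((convex_stdSimplex ℝ (Fin (n + 1))).isConnected ⟨_, (vertexPt (0 : Fin (n + 1))).2⟩)

open Classical in
/-- projection to the simplices in `S` -/
def pr (R : Type) [CommRing R] {X : Type} [TopologicalSpace X] {n : ℕ} (S : Set X) : SChain R n X →ₗ[R] SChain R n X :=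
  Finsupp.lsum R fun σ => if Set.range ⇑σ ⊆ S then Finsupp.lsingle σ else 0
lemma pr_in {σ : SingSimplex n X} (h : Set.range ⇑σ ⊆ S) (a : R) : pr R S (Finsupp.single σ a) = Finsupp.single σ a := by simp [pr, h]
lemma pr_out {σ : SingSimplex n X} (h : ¬ Set.range ⇑σ ⊆ S) (a : R) : pr R S (Finsupp.single σ a) = 0 := by simp [pr, h]
lemma pr_mem (c : SChain R n X) : pr R S c ∈ suppOn R n S := by
  induction c using Finsupp.induction_linear with
  | zero => simp
  | add f g hf hg => rw [map_add]; exact add_mem hf hg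
  | single σ a => by_cases h : Set.range ⇑σ ⊆ S
                  · rw [pr_in h]; exact single_mem_suppOn h _
                  · rw [pr_out h]; exact zero_mem _
lemma clop (hS : IsClopen S) (σ : SingSimplex n X) (h : ¬ Set.range ⇑σ ⊆ S) : Set.range ⇑σ ⊆ Sᶜ := fun x hx hxS =>
  h ((isPreconnected_range σ.continuous).subset_isClopen hS ⟨x, hx, hxS⟩)
lemma pr_co (hS : IsClopen S) (c : SChain R n X) : c - pr R S c ∈ suppOn R n Sᶜ := by
  induction c using Finsupp.induction_linear with
  | zero => simp
  | add f g hf hg => rw [map_add, add_sub_add_comm]; exact add_mem hf hg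
  | single σ a => by_cases h : Set.range ⇑σ ⊆ S
                  · rw [pr_in h]; simp
                  · rw [pr_out h, sub_zero]; exact single_mem_suppOn (clop hS σ h) _
lemma pr_supp {T : Set X} {c : SChain R n X} (h : c ∈ suppOn R n T) : pr R S c ∈ suppOn R n T := by
  refine suppOn_le (P := (suppOn R n T).comap (pr R S)) (fun σ hσ => ?_) h
  by_cases h : Set.range ⇑σ ⊆ S
  · rw [Submodule.mem_comap, pr_in h]; exact single_mem_suppOn hσ _
  · rw [Submodule.mem_comap, pr_out h]; exact zero_mem _
lemma pr_bd (hS : IsClopen S) (c : SChain R (n + 1) X) : sbdry R (pr R S c) = pr R S (sbdry R c) := by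
  induction c using Finsupp.induction_linear with
  | zero => simp
  | add f g hf hg => rw [map_add, map_add, map_add, map_add, hf, hg]
  | single σ a =>
    by_cases h : Set.range ⇑σ ⊆ S
    · have := sbdry_mem (single_mem_suppOn h a)
      rw [pr_in h]
      have h2 := pr_co hS (sbdry R (Finsupp.single σ a))
      have h3 := sub_mem this (pr_supp (S := S) this)
      have h4 := suppOn_inf (R := R) h2 h3
      rw [Set.compl_inter_self] at h4
      exact sub_eq_zero.1 (supp_empty h4)
    · have := sbdry_mem (single_mem_suppOn (clop hS σ h) a)
      rw [pr_out h, map_zero]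
      have h4 := suppOn_inf (R := R) (pr_supp (S := S) this) (pr_mem _)
      rw [Set.compl_inter_self] at h4
      exact (supp_empty h4).symm
lemma pr_cyc (hS : IsClopen S) {T : Set X} {c : SChain R (n + 1) X} (h : c ∈ cyc R (n + 1) T) : pr R S c ∈ cyc R (n + 1) T := by
  rw [mem_cyc_succ] at *; rw [pr_bd hS]; exact pr_supp h

lemma pr_add (hS : IsClopen S) (c : SChain R n X) : pr R S c + pr R Sᶜ c = c := by
  have h1 := sub_mem (pr_co hS c) (pr_mem (R := R) (S := Sᶜ) c)
  have h2 := sub_mem (pr_co hS.compl c) (pr_mem (R := R) (S := Sᶜᶜ) c)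
  rw [compl_compl] at h2
  have h3 := suppOn_inf (R := R) h1 (by rwa [sub_right_comm] at h2)
  rw [Set.compl_inter_self] at h3
  have h4 := supp_empty h3
  rw [sub_sub, sub_eq_zero] at h4; exact h4.symm

lemma nul_ev [T2Space X] {x : X} {z : SChain R n X} (h : z ∈ nul R n ({x}ᶜ : Set X)) : ∀ᶠ y in 𝓝 x, z ∈ nul R n ({y}ᶜ : Set X) := by
  obtain ⟨a, ha, w, rfl⟩ := mem_nul.1 h
  obtain ⟨K, hK, hKc, haK⟩ := csupp ha
  filter_upwards [hKc.isClosed.isOpen_compl.mem_nhds fun h => hK h rfl] with y hy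
  exact add_mem (supp_nul (suppOn_mono (fun k hk (e : k = y) => hy (e ▸ hk)) haK)) (bd_nul w)

lemma dc_t2 [T2Space X] {p : Y → X} (hp : IsDoubleCover p) : T2Space Y :=
  ⟨fun x y hxy => by
    by_cases h : p x = p y
    · exact hp.1.isSeparatedMap x y h hxy
    · obtain ⟨u, v, hu, hv, hx, hy, huv⟩ := t2_separation h
      exact ⟨_, _, hu.preimage hp.1.continuous, hv.preimage hp.1.continuous, hx, hy, huv.preimage p⟩⟩
lemma dc_fin {p : Y → X} (hp : IsDoubleCover p) (x : X) : Finite (p ⁻¹' {x}) := Nat.finite_of_card_ne_zero (by rw [hp.2 x]; norm_num)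
lemma dc_two {p : Y → X} (hp : IsDoubleCover p) {a b d : Y} (h : p a = p b) (h' : p a = p d) : a = b ∨ a = d ∨ b = d := by
  by_contra! hn
  haveI := dc_fin hp (p a)
  classical
  haveI := Fintype.ofFinite (p ⁻¹' {p a})
  have h3 := hp.2 (p a)
  rw [Nat.card_eq_fintype_card] at h3
  have := Finset.card_le_univ ({⟨a, rfl⟩, ⟨b, h.symm⟩, ⟨d, h'.symm⟩} : Finset (p ⁻¹' {p a}))
  rw [h3, Finset.card_eq_three.2 ⟨_, _, _, fun e => hn.1 (congrArg Subtype.val e), fun e => hn.2.1 (congrArg Subtype.val e),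
    fun e => hn.2.2 (congrArg Subtype.val e), rfl⟩] at this
  omega
lemma dc_cpt [T2Space X] [CompactSpace X] {p : Y → X} (hp : IsDoubleCover p) : CompactSpace Y := by
  refine ⟨isCompact_iff_ultrafilter_le_nhds.2 fun f _ => ?_⟩
  obtain ⟨x, -, hx⟩ := isCompact_iff_ultrafilter_le_nhds.1 (isCompact_univ (X := X)) (f.map p) (by simp)
  obtain ⟨hd, U, hxU, hU, hU', H, hH⟩ := hp.1 x
  haveI := dc_fin hp x
  have hf : p ⁻¹' U ∈ f := hx (hU.mem_nhds hxU)
  have h1 : (⋃ i ∈ (Set.univ : Set (p ⁻¹' {x})), {y | ∃ h : y ∈ p ⁻¹' U, (H ⟨y, h⟩).2 = i}) ∈ f :=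
    Filter.mem_of_superset hf fun y hy => Set.mem_biUnion (Set.mem_univ (H ⟨y, hy⟩).2) ⟨hy, rfl⟩
  obtain ⟨i, -, hi⟩ := (Ultrafilter.finite_biUnion_mem_iff Set.finite_univ).1 h1
  refine ⟨(H.symm (⟨x, hxU⟩, i)).1, trivial, fun N hN => ?_⟩
  have hs : Continuous fun u : U => (H.symm (u, i)).1 := by fun_prop
  obtain ⟨V, hV, hVN⟩ := mem_nhds_subtype _ _ _ |>.1 (hs.continuousAt.preimage_mem_nhds hN)
  filter_upwards [hi, hx hV] with y ⟨hy, hyi⟩ hyV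
  have := @hVN ⟨p y, hy⟩ hyV
  have e : H ⟨y, hy⟩ = (⟨p y, hy⟩, i) := Prod.ext (Subtype.ext (hH _)) hyi
  rwa [Set.mem_preimage, ← e, H.symm_apply_apply] at this
lemma Good.dc (h : Good n X A) {p : Y → X} (hp : IsDoubleCover p) : Good n Y (p ⁻¹' A) := by
  haveI := h.t2; haveI := h.cpt; haveI := dc_t2 hp; haveI := dc_cpt hp
  exact h.pull hp.1.isLocalHomeomorph

/-- a cover carrying a nontrivial class, of something without one, is connected -/
lemma dc_conn [T2Space X] [CompactSpace X] [ConnectedSpace X] (h0 : ∀ c ∈ cyc R (m + 1) A, c ∈ nul R (m + 1) A) {p : Y → X} (hp : IsDoubleCover p)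
    {c : SChain R (m + 1) Y} (hc : c ∈ cyc R (m + 1) (p ⁻¹' A)) (hcn : c ∉ nul R (m + 1) (p ⁻¹' A)) : ConnectedSpace Y := by
  haveI := dc_t2 hp; haveI := dc_cpt hp
  have hne : Nonempty Y := by
    obtain ⟨x⟩ := ‹ConnectedSpace X›.toNonempty
    by_contra! h
    have := hp.2 x
    simp at this
  refine { toPreconnectedSpace := preconnectedSpace_iff_clopen.2 fun W hW => ?_, toNonempty := hne }
  by_contra! hW'
  refine hcn ?_
  have key : ∀ W : Set Y, IsClopen W → W.Nonempty → ∀ x, ∃ y ∈ W, p y = x := fun W hW hn x => by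
    have : IsClopen (p '' W) := ⟨(hW.1.isCompact.image hp.1.continuous).isClosed, hp.1.isLocalHomeomorph.isOpenMap _ hW.2⟩
    have := this.eq_univ (hn.image p)
    exact (this ▸ Set.mem_univ x : x ∈ p '' W)
  have k2 : ∀ W : Set Y, IsClopen W → W.Nonempty → Wᶜ.Nonempty → pr R W c ∈ nul R (m + 1) (p ⁻¹' A) := fun W hW hn hn' => by
    have inj : Set.InjOn p W := fun a ha b hb hab => by
      by_contra hne
      obtain ⟨d, hd, hpd⟩ := key _ hW.compl hn' (p a)
      rcases dc_two hp hab hpd.symm with h | rfl | rfl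
      exacts [hne h, hd ha, hd hb]
    haveI := isCompact_iff_compactSpace.1 hW.1.isCompact
    let q : W ≃ X := Equiv.ofBijective (fun y => p y) ⟨fun a b h => Subtype.ext (inj a.2 b.2 h), fun x => by
      obtain ⟨y, hy, e⟩ := key W hW hn x; exact ⟨⟨y, hy⟩, e⟩⟩
    let Q : W ≃ₜ X := Continuous.homeoOfEquivCompactToT2 (f := q) (hp.1.continuous.comp continuous_subtype_val)
    let s : C(X, Y) := (vcm W).comp ⟨Q.symm, Q.symm.continuous⟩
    have hps : ∀ x, p (s x) = x := fun x => Q.apply_symm_apply x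
    have h1 := h0 _ (cyc_map (f := ⟨p, hp.1.continuous⟩) (B := A) (fun y hy => hy) (pr_cyc hW hc))
    have h2 := nul_map (f := s) (B := p ⁻¹' A) (fun x hx => by rwa [Set.mem_preimage, hps]) h1
    obtain ⟨v, hv⟩ := lift_sub W (pr_mem (R := R) (S := W) c)
    rw [← hv, cmap_cmap, cmap_cmap] at h2
    rwa [← hv, show vcm W = (s.comp ⟨p, hp.1.continuous⟩).comp (vcm W) from ?_]
    ext y
    exact congrArg Subtype.val (Q.symm_apply_apply y).symm
  have e2 : Wᶜ.Nonempty := Set.nonempty_compl.2 hW'.2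
  rw [← pr_add hW c]
  exact add_mem (k2 W hW hW'.1 e2) (k2 Wᶜ hW.compl e2 (by rw [compl_compl]; exact hW'.1))

def colm (p : C(Y, X)) (A : Set X) : C(Col (p ⁻¹' A), Col A) := ⟨fun q => ⟨(p q.1.1, q.1.2), q.2⟩, by fun_prop⟩
lemma colm_open {p : C(Y, X)} (hp : IsOpenMap p) : IsOpenMap (colm p A) :=
  (hp.prodMap IsOpenMap.id).restrictPreimage (CS A)
lemma emb_on {f : C(Y, X)} (hf : IsOpenMap f) {W : Set Y} (hW : IsOpen W) (hi : Set.InjOn f W) : IsOpenEmbedding (f.comp (vcm W)) :=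
  .of_continuous_injective_isOpenMap (f.comp (vcm W)).continuous (fun a b h => Subtype.ext (hi a.2 b.2 h))
    (IsOpenMap.comp (g := f) hf hW.isOpenMap_subtype_val)
lemma off {f : C(Y, X)} (hf : Function.Injective f) (y : Y) {q : X} (h : f y = q) : Set.MapsTo f ({y}ᶜ : Set Y) {q}ᶜ :=
  fun a ha e => ha (hf (e.trans h.symm))
lemma pt_cov {f : C(Y, X)} (y : Y) {q : X} (h : f y = q) : Set.range f ∪ ({q}ᶜ : Set X) = Set.univ :=
  Set.eq_univ_of_forall fun a => (em (a = q)).imp (fun e => ⟨y, h.trans e.symm⟩) id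
lemma pt_pre {f : C(Y, X)} (hf : Function.Injective f) (y : Y) {q : X} (h : f y = q) : f ⁻¹' ({q}ᶜ : Set X) = {y}ᶜ := by
  subst h; ext a; simp [hf.eq_iff]
lemma loc_uniq [T1Space X] [T1Space Y] {f : C(Y, X)} (hf : IsOpenMap f) {q : Y} {W W' : Set Y} (hW : IsOpen W) (hW' : IsOpen W') (hi : Set.InjOn f W)
    (hi' : Set.InjOn f W') (hq : q ∈ W) (hq' : q ∈ W') {d : SChain R n W} {d' : SChain R n W'} (hd : d ∈ cyc R n {⟨q, hq⟩}ᶜ)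
    (hd' : d' ∈ cyc R n {⟨q, hq'⟩}ᶜ) (h : cmap R (f.comp (vcm W)) d - cmap R (f.comp (vcm W')) d' ∈ nul R n {f q}ᶜ) :
    cmap R (vcm W) d - cmap R (vcm W') d' ∈ nul R n {q}ᶜ := by
  have key : ∀ {W V : Set Y} (hW : IsOpen W) (hV : IsOpen V) (hVW : V ⊆ W) (hi : Set.InjOn f W) (hq : q ∈ V) {d : SChain R n W}
      (hd : d ∈ cyc R n {⟨q, hVW hq⟩}ᶜ), ∃ e : SChain R n V, cmap R (vcm W) d - cmap R (vcm V) e ∈ nul R n {q}ᶜ ∧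
        cmap R (f.comp (vcm W)) d - cmap R (f.comp (vcm V)) e ∈ nul R n {f q}ᶜ := by
    intro W V hW hV hVW hi hq d hd
    let j : C(V, W) := ⟨Set.inclusion hVW, continuous_inclusion hVW⟩
    obtain ⟨e, -, h2⟩ := exc_surj (j := j) ⟨.inclusion hVW, by
      change IsOpen (Set.range (Set.inclusion hVW)); rw [Set.range_inclusion]; exact hV.preimage continuous_subtype_val⟩ isOpen_compl_singleton (pt_cov (f := j) ⟨q, hq⟩ (q := ⟨q, hVW hq⟩) rfl) hd
    refine ⟨e, ?_, ?_⟩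
    · have := nul_map (off (vcm_inj W) ⟨q, hVW hq⟩ (q := q) rfl) h2
      rwa [map_sub, cmap_cmap] at this
    · have := nul_map (off (emb_on hf hW hi).injective ⟨q, hVW hq⟩ (q := f q) rfl) h2
      rwa [map_sub, cmap_cmap] at this
  obtain ⟨e, h1, h2⟩ := key hW (hW.inter hW') Set.inter_subset_left hi ⟨hq, hq'⟩ hd
  obtain ⟨e', h1', h2'⟩ := key hW' (hW.inter hW') Set.inter_subset_right hi' ⟨hq, hq'⟩ hd'
  have hE := emb_on hf (hW.inter hW') (hi.mono Set.inter_subset_left)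
  have h3 : cmap R (f.comp (vcm (W ∩ W'))) (e - e') ∈ nul R n {f q}ᶜ := by
    rw [map_sub]; convert add_mem (sub_mem h h2) h2' using 1; abel
  have h4 := exc_inj hE isOpen_compl_singleton (pt_cov (f := f.comp (vcm (W ∩ W'))) ⟨q, hq, hq'⟩ (q := f q) rfl) h3
  rw [pt_pre hE.injective ⟨q, hq, hq'⟩ (q := f q) rfl] at h4
  have h5 := nul_map (off (vcm_inj (W ∩ W')) ⟨q, hq, hq'⟩ (q := q) rfl) h4
  rw [map_sub] at h5
  convert sub_mem (add_mem h1 h5) h1' using 1; abel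

lemma ori_lift (h : Good (m + 1) X A) [Nonempty Y] [T2Space Y] [CompactSpace Y] {p : C(Y, X)} (hp : IsLocalHomeomorph p)
    (z : X → SChain ℤ (m + 1) (Col A)) (hz : ∀ x, Gen (m + 1) (icol A x) (z x)) (ε : Y → ℤˣ)
    (hε : ∀ y0, ∀ᶠ y in 𝓝 y0, (ε y : ℤ) • z (p y) - (ε y0 : ℤ) • z (p y0) ∈ nul ℤ (m + 1) {icol A (p y)}ᶜ) :
    ∃ c ∈ cyc ℤ (m + 1) (p ⁻¹' A), c ∉ nul ℤ (m + 1) (p ⁻¹' A) := by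
  have hY := h.pull (Y := Y) hp
  haveI := h.t2
  let P := colm p A
  have hP : IsOpenMap P := colm_open hp.isOpenMap
  let O : Col (p ⁻¹' A) → SChain ℤ (m + 1) (Col (p ⁻¹' A)) → Prop := fun q u => ∃ W, IsOpen W ∧ Set.InjOn P W ∧ ∃ hq : q ∈ W,
    ∃ d : SChain ℤ (m + 1) W, d ∈ cyc ℤ (m + 1) {⟨q, hq⟩}ᶜ ∧ u - cmap ℤ (vcm W) d ∈ nul ℤ (m + 1) {q}ᶜ ∧
      cmap ℤ (P.comp (vcm W)) d - (ε q.1.1 : ℤ) • z (p q.1.1) ∈ nul ℤ (m + 1) {P q}ᶜ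
  have hK : IsCompact (KC (p ⁻¹' A)) := KC_eq (A := p ⁻¹' A) ▸ isCompact_range (icol _).continuous
  obtain ⟨z', hz', hO⟩ := glob_ex hY.leu O (fun q u u' => by
    rintro ⟨W, hW, hi, hq, d, h1, h2, h3⟩ ⟨W', hW', hi', hq', d', h1', h2', h3'⟩
    have := loc_uniq hP hW hW' hi hi' hq hq' h1 h1' (by simpa using sub_mem h3 h3')
    convert sub_mem (add_mem h2 this) h2' using 1; abel) (fun q u u' => by
    rintro ⟨W, hW, hi, hq, d, h1, h2, h3⟩ h4
    exact ⟨W, hW, hi, hq, d, h1, by simpa using add_mem h4 h2, h3⟩) hK (by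
    rw [KC_eq]
    rintro _ ⟨y, rfl⟩
    obtain ⟨V, hV, hyV, hVi⟩ := hp.isLocallyInjective y
    let W : Set (Col (p ⁻¹' A)) := rcol _ ⁻¹' V
    have hW : IsOpen W := hV.preimage (rcol _).continuous
    have hi : Set.InjOn P W := fun a ha b hb hab => Subtype.ext (Prod.ext (hVi ha hb (congrArg (fun q : Col A => q.1.1) hab))
      (congrArg (fun q : Col A => q.1.2) hab))
    have hE := emb_on hP hW hi
    let q0 : W := ⟨icol _ y, hyV⟩
    obtain ⟨d, hd, hd'⟩ := exc_surj hE (S := {P q0.1}ᶜ) isOpen_compl_singleton (pt_cov q0 rfl) (Submodule.smul_mem _ (ε y : ℤ) (hz (p y)).1)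
    rw [pt_pre hE.injective q0 (q := P q0.1) rfl] at hd
    have e1 := (P.continuous.tendsto q0.1).eventually (nul_ev hd')
    have e2 := ((rcol (p ⁻¹' A)).continuous.tendsto q0.1).eventually (hε y)
    obtain ⟨D, hD, hDW, hDc, hdD, -⟩ := ball_at hY.leu (cyc_map (off (vcm_inj W) q0 (q := icol _ y) rfl) hd)
      (Filter.inter_mem (hW.mem_nhds hyV) (Filter.inter_mem e1 e2))
    refine ⟨D, hD, hDc, _, hdD, ?_⟩
    rintro _ ⟨hqD, y', rfl⟩
    obtain ⟨h1, h2, h3⟩ := hDW hqD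
    rw [Set.mem_setOf_eq] at h2 h3
    refine ⟨W, hW, hi, h1, d, ?_, by simp, ?_⟩
    · have := cyc_pt hqD hdD
      rw [mem_cyc, sbdryN_cmap, cmap_mem_iff (vcm_inj W), pt_pre (vcm_inj W) ⟨_, h1⟩ (q := icol _ y') rfl] at this
      exact this
    · have : -(((ε y' : ℤ) • z (p y') - (ε y : ℤ) • z (p y)) + _) ∈ nul ℤ (m + 1) {P (icol _ y')}ᶜ := neg_mem (add_mem h3 h2)
      convert this using 1; simp [icol])
  obtain ⟨x, hx⟩ := hY.ex
  refine ⟨cmap ℤ (rcol _) z', cyc_map (f := rcol _) (B := p ⁻¹' A) (fun q hq => q.2.2.resolve_left hq) hz', fun hn => ?_⟩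
  have h1 := nul_map (icol_off hx) hn
  rw [cmap_cmap] at h1
  have h2 := hinv (A := (KC (p ⁻¹' A))ᶜ) (B := {icol _ x}ᶜ) (c := z') ⟨fun q : Col (p ⁻¹' A) × unitInterval => ⟨(q.1.1.1, (q.2 : ℝ) * q.1.1.2),
    mul_nonneg q.2.2.1 q.1.2.1, q.1.2.2.imp (fun h => by rw [h, mul_zero]) id⟩, by fun_prop⟩ ((icol _).comp (rcol _)) (.id _)
    (fun q => Subtype.ext (by simp [icol, rcol])) (fun q => Subtype.ext (by simp)) (fun q hq t e => hx ?_) hz'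
  · obtain ⟨W, hW, hi, hq, d, h4, h5, h6⟩ := hO _ (show icol _ x ∈ KC (p ⁻¹' A) from rfl)
    rw [cmap_id] at h2
    have h3 := sub_mem (add_mem h2 h1) h5
    rw [sub_add_cancel, sub_sub_cancel] at h3
    have h7 := exc_inj (j := vcm W) hW.isOpenEmbedding_subtypeVal isOpen_compl_singleton (pt_cov (f := vcm W) ⟨_, hq⟩ (q := icol _ x) rfl) h3
    rw [pt_pre (vcm_inj W) ⟨_, hq⟩ (q := icol _ x) rfl] at h7
    have h8 := sub_mem (nul_map (off (emb_on hP hW hi).injective ⟨_, hq⟩ (q := P (icol _ x)) rfl) h7) h6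
    rw [sub_sub_cancel] at h8
    exact (ε x).ne_zero ((hz (p x)).2.2 _ h8)
  · rw [← show q.1.1 = x from congrArg (fun q : Col (p ⁻¹' A) => q.1.1) e]
    exact q.2.2.resolve_left hq

lemma ori_cov (h : Good (m + 1) X A) [Nonempty X] : ∃ (Y : Type) (_ : TopologicalSpace Y) (p : Y → X), IsDoubleCover p ∧
    ∃ c ∈ cyc ℤ (m + 1) (p ⁻¹' A), c ∉ nul ℤ (m + 1) (p ⁻¹' A) := by
  haveI := h.t2
  have : ∀ x, ∃ z, ∃ U, IsOpen U ∧ x ∈ U ∧ ∀ y ∈ U, Gen (m + 1) (icol A y) z := fun x => by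
    obtain ⟨g, h1, h2, h3⟩ := (h.leu.lh (R := ℤ) (icol A x)).gen
    obtain ⟨D, hD, -, -, -, hG⟩ := gen_nhds h.leu ⟨h1, h2, h3⟩ Filter.univ_mem
    exact ⟨g, interior (icol A ⁻¹' D), isOpen_interior, mem_interior_iff_mem_nhds.2 ((icol A).continuous.continuousAt.preimage_mem_nhds hD),
      fun y hy => hG _ (interior_subset (s := icol A ⁻¹' D) hy)⟩
  choose z U hU hxU hz using this
  classical
  let sg : X → X → X → ℤˣ := fun i j x => if hx : x ∈ U i ∩ U j then ((hz i x hx.1).unit (hz j x hx.2)).choose else 1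
  have hs : ∀ i j x, x ∈ U i ∩ U j → z i - (sg i j x : ℤ) • z j ∈ nul ℤ (m + 1) {icol A x}ᶜ := fun i j x hx => by
    simp only [sg, dif_pos hx]; exact ((hz i x hx.1).unit (hz j x hx.2)).choose_spec
  let Z : FiberBundleCore X X ℤˣ :=
    { baseSet := U
      isOpen_baseSet := hU
      indexAt := id
      mem_baseSet_at := hxU
      coordChange := fun i j x v => sg i j x * v
      coordChange_self := fun i x hx v => by
        rw [(hz i x hx).unit_eq (hs i i x ⟨hx, hx⟩) (e' := 1) (by simp), one_mul]
      continuousOn_coordChange := fun i j => by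
        have : ContinuousOn (sg i j) (U i ∩ U j) := fun x hx => by
          refine ContinuousAt.continuousWithinAt (continuousAt_const.congr (f := fun _ => sg i j x) ?_)
          filter_upwards [((hU i).inter (hU j)).mem_nhds hx, ((icol A).continuous.tendsto x).eventually (nul_ev (hs i j x hx))] with y hy h2
          exact (hz j y hy.2).unit_eq h2 (hs i j y hy)
        exact (this.comp continuousOn_fst fun q hq => hq.1).mul continuousOn_snd
      coordChange_comp := fun i j k x hx v => by
        rw [← mul_assoc, (hz k x hx.2).unit_eq (hs i k x ⟨hx.1.1, hx.2⟩) (e' := sg j k x * sg i j x) ?_]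
        convert add_mem (hs i j x hx.1) (Submodule.smul_mem _ (sg i j x : ℤ) (hs j k x ⟨hx.1.2, hx.2⟩)) using 1
        rw [smul_sub, smul_smul, Units.val_mul, mul_comm]; abel }
  let p : Z.TotalSpace → X := Bundle.TotalSpace.proj
  have hp : IsDoubleCover p := ⟨FiberBundle.isCoveringMap (F := ℤˣ) (E := Z.Fiber), fun x => by
    rw [Nat.card_congr (β := ℤˣ) ⟨fun y => y.1.2, fun v => ⟨⟨x, v⟩, rfl⟩, ?_, fun v => rfl⟩]
    · simp
    · rintro ⟨⟨x, v⟩, rfl⟩; rfl⟩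
  refine ⟨Z.TotalSpace, inferInstance, p, hp, ?_⟩
  haveI := h.cpt; haveI := dc_t2 hp; haveI := dc_cpt hp
  haveI : Nonempty Z.TotalSpace := ‹Nonempty X›.map fun x => ⟨x, (1 : ℤˣ)⟩
  let ε : Z.TotalSpace → ℤˣ := fun y => y.2
  refine ori_lift h (p := ⟨p, hp.1.continuous⟩) hp.1.isLocalHomeomorph z (fun x => hz x x (hxU x)) ε fun y0 => ?_
  have h1 : ContinuousAt (Z.localTrivAt y0.proj) y0 := (Z.localTrivAt y0.proj).continuousOn.continuousAt
    ((Z.localTrivAt y0.proj).open_source.mem_nhds ((Z.mem_localTriv_source _ _).2 (hxU y0.proj)))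
  have h2 : ∀ᶠ y in 𝓝 y0, (Z.localTrivAt y0.proj y).2 = ε y0 := by
    have := (continuous_snd.continuousAt.comp h1).eventually ((isOpen_discrete {ε y0}).mem_nhds (by
      simp only [Function.comp, Z.localTrivAt_apply]; exact rfl))
    exact this
  filter_upwards [h2, hp.1.continuous.continuousAt.preimage_mem_nhds ((hU y0.proj).mem_nhds (hxU y0.proj))] with y hy hyU
  have h3 : sg y.proj y0.proj y.proj * ε y = ε y0 := hy
  have h4 := Submodule.smul_mem _ (ε y : ℤ) (hs y.proj y0.proj y.proj ⟨hxU _, hyU⟩)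
  rw [smul_sub, smul_smul, mul_comm, ← Units.val_mul, h3] at h4
  exact h4

lemma ori_ex (h : Good (m + 1) X A) [ConnectedSpace X] (hn : ¬ HomOrientable (m + 1) X A) :
    (∀ c ∈ cyc ℤ (m + 1) A, c ∈ nul ℤ (m + 1) A) ∧ ∃ (Y : TopCat.{0}) (p : Y → X), IsDoubleCover p ∧ HomOrientable (m + 1) Y (p ⁻¹' A) := by
  have h0 : ∀ c ∈ cyc ℤ (m + 1) A, c ∈ nul ℤ (m + 1) A := fun c hc => by_contra fun h1 => hn (h.ho hc h1)
  obtain ⟨Y, _, p, hp, c, hc, hc'⟩ := ori_cov h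
  haveI := h.t2; haveI := h.cpt
  haveI := dc_conn h0 hp hc hc'
  exact ⟨h0, TopCat.of Y, p, hp, (h.dc hp).ho hc hc'⟩
end
end
noncomputable section
open Finset
open Topology
section
variable {X : Type} [TopologicalSpace X] {m n : ℕ} {A : Set X}

lemma face_face {i j : Fin (n + 2)} (h : i ≤ j) (z : TSimplex n) :
    faceMap j.succ (faceMap i z) = faceMap i.castSucc (faceMap j z) := by
  have : (faceMap j.succ).comp (faceMap i : C(TSimplex n, _)) = (faceMap i.castSucc).comp (faceMap j) := by
    simp only [faceMap_eq_bar]; rw [bar_comp, bar_comp, ← faceMap_eq_bar, ← faceMap_eq_bar, ← Function.comp_assoc,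
      ← Function.comp_assoc, face_vertex, face_vertex]
    congr 1; funext k; simp only [Function.comp]; congr 1
    ext; simp only [Fin.succAbove, Fin.lt_def, Fin.le_def] at *; split_ifs <;> simp at * <;> omega
  exact DFunLike.congr_fun this z

def dg (i : Fin (n + 2)) : C(TSimplex (n + 1), TSimplex n) := bar (vertexPt ∘ Function.invFun i.succAbove)

lemma dg_face (i : Fin (n + 2)) (y : TSimplex n) : dg i (faceMap i y) = y := by
  have : (dg i).comp (faceMap i : C(TSimplex n, _)) = ContinuousMap.id _ := by
    rw [dg, bar_face, ← bar_vertex]; congr 1; funext k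
    simp only [Function.comp]; rw [Function.leftInverse_invFun Fin.succAbove_right_injective]
  exact DFunLike.congr_fun this y

lemma face_co (i : Fin (n + 2)) (y : TSimplex n) (k) : (faceMap i y).1 (i.succAbove k) = y.1 k := by
  change ∑ l ∈ univ.filter (fun l => i.succAbove l = i.succAbove k), y.1 l = _
  simp [Finset.sum_filter]
lemma face_co0 (i : Fin (n + 2)) (y : TSimplex n) : (faceMap i y).1 i = 0 := by
  change ∑ l ∈ univ.filter (fun l => i.succAbove l = i), y.1 l = _
  simp [Finset.sum_filter, Fin.succAbove_ne]

lemma face_dg (i : Fin (n + 2)) {y : TSimplex (n + 1)} (h : y.1 i = 0) : faceMap i (dg i y) = y := by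
  obtain ⟨x, hx⟩ : ∃ x, y = faceMap i x := by
    refine ⟨⟨fun k => y.1 (i.succAbove k), fun k => y.2.1 _, ?_⟩, Subtype.ext (funext fun k => ?_)⟩
    · have := y.2.2; rwa [Fin.sum_univ_succAbove _ i, h, zero_add] at this
    · rcases Fin.eq_self_or_eq_succAbove i k with rfl | ⟨k, rfl⟩
      · exact h.trans (face_co0 _ _).symm
      · refine Eq.trans ?_ (face_co i _ k).symm; rfl
  rw [hx, dg_face]

lemma horn {t : Fin (n + 3) → C(TSimplex (n + 1), X)} (k : Fin (n + 3))
    (ht : ∀ i j : Fin (n + 2), i ≤ j → j.succ ≠ k → i.castSucc ≠ k →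
      (t j.succ).comp (faceMap i) = (t i.castSucc).comp (faceMap j)) :
    ∃ θ : C(TSimplex (n + 2), X), ∀ i ≠ k, θ.comp (faceMap i) = t i := by
  have hs : (univ.erase k).Nonempty := ⟨k.succAbove 0, by simp [Fin.succAbove_ne]⟩
  let mn : TSimplex (n + 2) → ℝ := fun x => (univ.erase k).inf' hs fun i => x.1 i
  have hm0 : ∀ x, 0 ≤ mn x := fun x => Finset.le_inf' _ _ fun i _ => x.2.1 i
  have hm1 : ∀ x i, i ≠ k → mn x ≤ x.1 i := fun x i hi => Finset.inf'_le _ (by simp [hi])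
  have hmc : Continuous mn := Continuous.finset_inf'_apply hs fun i _ => (continuous_apply i).comp continuous_subtype_val
  let r : TSimplex (n + 2) → TSimplex (n + 2) := fun x => ⟨fun i => if i = k then x.1 i + (n + 2) * mn x else x.1 i - mn x, by
    refine ⟨fun i => ?_, ?_⟩
    · have := hm0 x; have := x.2.1 i
      dsimp only
      split_ifs with h
      · positivity
      · linarith [hm1 x i h]
    · have h1 := x.2.2
      rw [Fin.sum_univ_succAbove _ k] at h1 ⊢
      simp only [Fin.succAbove_ne, if_false, if_true, Finset.sum_sub_distrib, Finset.sum_const, card_univ, Fintype.card_fin, nsmul_eq_mul]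
      push_cast; linarith⟩
  have hr : Continuous r := Continuous.subtype_mk (continuous_pi fun i => by
    have : Continuous fun x : TSimplex (n+2) => x.1 i := (continuous_apply i).comp continuous_subtype_val
    by_cases h : i = k
    · simp only [h, if_true]; exact (h ▸ this).add (hmc.const_mul _)
    · simp only [h, if_false]; exact this.sub hmc) _
  have hw : ∀ x, ∃ i, i ≠ k ∧ mn x = x.1 i := fun x => by
    obtain ⟨i, hi, h⟩ := Finset.exists_mem_eq_inf' hs fun i => x.1 i
    exact ⟨i, by simpa using hi, h⟩
  choose w hwk hw using hw
  have r0 : ∀ x i, i ≠ k → mn x = x.1 i → (r x).1 i = 0 := fun x i hi h => by simp [r, hi, h]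
  have glue : ∀ (y : TSimplex (n + 2)) (i j), i ≠ k → j ≠ k → y.1 i = 0 → y.1 j = 0 → t i (dg i y) = t j (dg j y) := by
    intro y i j
    wlog h : i < j generalizing i j with H
    · intro hi hj h1 h2
      rcases (not_lt.1 h).eq_or_lt with rfl | h
      · rfl
      · exact (H j i h hj hi h2 h1).symm
    · intro hi hj h1 h2
      obtain ⟨i, rfl⟩ := Fin.exists_castSucc_eq.2 (Fin.ne_last_of_lt h)
      obtain ⟨j, rfl⟩ := Fin.exists_succ_eq.2 (Fin.ne_zero_of_lt h)
      have hij : i ≤ j := by have := Fin.lt_def.1 h; rw [Fin.val_succ, Fin.val_castSucc] at this; exact Fin.le_def.2 (by omega)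
      have e1 := face_dg _ h2
      have e2 : (dg j.succ y).1 i = 0 := by
        rw [← face_co j.succ, e1, Fin.succAbove_of_castSucc_lt _ _ h, h1]
      have e3 := face_dg _ e2
      set z := dg i (dg j.succ y)
      rw [← e3, ← e1, ← e3, face_face hij, dg_face]
      exact (DFunLike.congr_fun (ht i j hij hj hi) z).symm
  let θ : TSimplex (n + 2) → X := fun x => t (w x) (dg (w x) (r x))
  have hθ : ∀ x i, i ≠ k → mn x = x.1 i → θ x = t i (dg i (r x)) := fun x i hi h =>
    glue _ _ _ (hwk x) hi (r0 _ _ (hwk x) (hw x)) (r0 _ _ hi h)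
  have hc : Continuous θ := by
    refine LocallyFinite.continuous (f := fun i : {i // i ≠ k} => {x | mn x = x.1 i.1}) (locallyFinite_of_finite _) ?_
      (fun i => isClosed_eq hmc ((continuous_apply i.1).comp continuous_subtype_val)) fun i => ?_
    · exact Set.eq_univ_of_forall fun x => Set.mem_iUnion.2 ⟨⟨w x, hwk x⟩, hw x⟩
    · refine ContinuousOn.congr (f := fun x => t i.1 (dg i.1 (r x))) (by fun_prop) fun x hx => hθ x _ i.2 hx
  refine ⟨⟨θ, hc⟩, fun i hi => ContinuousMap.ext fun y => ?_⟩
  have h0 : mn (faceMap i y) = (faceMap i y).1 i := le_antisymm (hm1 _ _ hi) (by rw [face_co0]; exact hm0 _)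
  change θ (faceMap i y) = _
  rw [hθ _ i hi h0]
  have : r (faceMap i y) = faceMap i y := by
    rw [face_co0] at h0
    refine Subtype.ext (funext fun j => ?_)
    change ite _ _ _ = _
    rw [h0]; simp
  rw [this, dg_face]
end
end
noncomputable section
open Finset
open Topology
section
variable {X Y : Type} [TopologicalSpace X] [TopologicalSpace Y] {m n l : ℕ} {A : Set X}

def rf (σ : C(TSimplex n, X)) (ψ : Fin (m + 1) → Fin (n + 1)) : C(TSimplex m, X) := σ.comp (bar (vertexPt ∘ ψ))
lemma rf_rf (σ : C(TSimplex n, X)) (ψ : Fin (m + 1) → Fin (n + 1)) (φ : Fin (l + 1) → Fin (m + 1)) :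
    rf (rf σ ψ) φ = rf σ (ψ ∘ φ) := by
  rw [rf, rf, rf, ContinuousMap.comp_assoc, bar_comp]; congr 2; funext i; exact bar_apply_vertex _ _
lemma rf_face (σ : C(TSimplex n, X)) (ψ : Fin (m + 2) → Fin (n + 1)) (i) : (rf σ ψ).comp (faceMap i) = rf σ (ψ ∘ i.succAbove) := by
  rw [rf, rf, ContinuousMap.comp_assoc, bar_face]; rfl
lemma rf_succ (σ : C(TSimplex (n + 1), X)) (i) : σ.comp (faceMap i) = rf σ i.succAbove := by rw [faceMap_eq_bar]; rfl
lemma rf_id (σ : C(TSimplex n, X)) : rf σ id = σ := by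
  rw [rf, Function.comp_id, bar_vertex, ContinuousMap.comp_id]
lemma rf_ap (σ : C(TSimplex n, X)) (ψ : Fin (m + 1) → Fin (n + 1)) (i) : rf σ ψ (vertexPt i) = σ (vertexPt (ψ i)) :=
  congrArg σ (bar_apply_vertex _ i)
lemma rf_map (f : C(X, Y)) (σ : C(TSimplex n, X)) (ψ : Fin (m + 1) → Fin (n + 1)) : f.comp (rf σ ψ) = rf (f.comp σ) ψ := rfl
abbrev eg (σ : C(TSimplex n, X)) (i j : Fin (n + 1)) : C(TSimplex 1, X) := rf σ ![i, j]
abbrev kp (x : X) : C(TSimplex 1, X) := ContinuousMap.const _ x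
lemma eg_self (σ : C(TSimplex n, X)) (i) : eg σ i i = kp (σ (vertexPt i)) := by
  ext x; rw [eg, rf, show vertexPt ∘ ![i, i] = fun _ => vertexPt i by funext k; fin_cases k <;> rfl]
  exact congrArg σ (bar_const _ _)

def Tr (τ : C(TSimplex 2, X)) (a b c : C(TSimplex 1, X)) : Prop :=
  τ.comp (faceMap 2) = a ∧ τ.comp (faceMap 0) = b ∧ τ.comp (faceMap 1) = c
def Tri (a b c : C(TSimplex 1, X)) : Prop := ∃ τ, Tr τ a b c
lemma Tr.map (f : C(X, Y)) {τ} {a b c : C(TSimplex 1, X)} (h : Tr τ a b c) : Tr (f.comp τ) (f.comp a) (f.comp b) (f.comp c) := by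
  obtain ⟨rfl, rfl, rfl⟩ := h; exact ⟨rfl, rfl, rfl⟩
lemma Tri.map (f : C(X, Y)) {a b c : C(TSimplex 1, X)} (h : Tri a b c) : Tri (f.comp a) (f.comp b) (f.comp c) :=
  let ⟨_, h⟩ := h; ⟨_, h.map f⟩
lemma tr_rf (σ : C(TSimplex n, X)) (i j k) : Tr (rf σ ![i, j, k]) (eg σ i j) (eg σ j k) (eg σ i k) := by
  refine ⟨?_, ?_, ?_⟩ <;> rw [rf_face] <;> congr 1 <;> funext x <;> fin_cases x <;> rfl
lemma tri_rf (σ : C(TSimplex n, X)) (i j k) : Tri (eg σ i j) (eg σ j k) (eg σ i k) := ⟨_, tr_rf σ i j k⟩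
lemma eg_01 (e : C(TSimplex 1, X)) : eg e 0 1 = e := by
  rw [eg, show ![(0 : Fin 2), 1] = id by funext x; fin_cases x <;> rfl]; exact rf_id e
lemma tri_l (e : C(TSimplex 1, X)) : Tri (kp (e (vertexPt 0))) e e := by
  have := tri_rf e 0 0 1; rwa [eg_self, eg_01] at this
lemma tri_r (e : C(TSimplex 1, X)) : Tri e (kp (e (vertexPt 1))) e := by
  have := tri_rf e 0 1 1; rwa [eg_self, eg_01] at this

lemma horn2 (k : Fin 3) (d0 d1 d2 : C(TSimplex 1, X)) (h01 : 0 ≠ k → 1 ≠ k → d0 (vertexPt 1) = d1 (vertexPt 1))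
    (h02 : 0 ≠ k → 2 ≠ k → d0 (vertexPt 0) = d2 (vertexPt 1)) (h12 : 1 ≠ k → 2 ≠ k → d1 (vertexPt 0) = d2 (vertexPt 0)) :
    ∃ θ : C(TSimplex 2, X), (0 ≠ k → θ.comp (faceMap 0) = d0) ∧ (1 ≠ k → θ.comp (faceMap 1) = d1) ∧ (2 ≠ k → θ.comp (faceMap 2) = d2) := by
  obtain ⟨θ, h⟩ := horn (n := 0) (t := ![d0, d1, d2]) k (by
    have pt : ∀ (a b : C(TSimplex 1, X)) (i j : Fin 2), a (vertexPt (i.succAbove 0)) = b (vertexPt (j.succAbove 0)) → a.comp (faceMap i) = b.comp (faceMap j) := by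
      intro a b i j h
      rw [rf_succ, rf_succ]; ext x
      rw [rf, rf]
      have : ∀ i : Fin 2, (vertexPt ∘ i.succAbove : Fin 1 → TSimplex 1) = fun _ => vertexPt (i.succAbove 0) := fun i => by
        funext k; rw [Subsingleton.elim k 0]; rfl
      rw [this, this, ContinuousMap.comp_apply, ContinuousMap.comp_apply, bar_const, bar_const, h]
    intro i j hij h1 h2
    apply pt
    fin_cases i <;> fin_cases j
    · exact (h01 h2 h1).symm
    · exact (h02 h2 h1).symm
    · exact absurd hij (by decide)
    · exact (h12 h2 h1).symm)
  exact ⟨θ, fun hk => h 0 hk, fun hk => h 1 hk, fun hk => h 2 hk⟩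

lemma horn3 (k : Fin 4) {d0 d1 d2 d3 : C(TSimplex 2, X)} {e01 e02 e03 e12 e13 e23 : C(TSimplex 1, X)}
    (h0 : 0 ≠ k → Tr d0 e12 e23 e13) (h1 : 1 ≠ k → Tr d1 e02 e23 e03) (h2 : 2 ≠ k → Tr d2 e01 e13 e03) (h3 : 3 ≠ k → Tr d3 e01 e12 e02) :
    ∃ θ : C(TSimplex 3, X), (0 ≠ k → θ.comp (faceMap 0) = d0) ∧ (1 ≠ k → θ.comp (faceMap 1) = d1) ∧ (2 ≠ k → θ.comp (faceMap 2) = d2) ∧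
      (3 ≠ k → θ.comp (faceMap 3) = d3) ∧ Tr (θ.comp (faceMap 0)) e12 e23 e13 ∧ Tr (θ.comp (faceMap 1)) e02 e23 e03 ∧
      Tr (θ.comp (faceMap 2)) e01 e13 e03 ∧ Tr (θ.comp (faceMap 3)) e01 e12 e02 := by
  obtain ⟨θ, h⟩ := horn (n := 1) (t := ![d0, d1, d2, d3]) k (by
    intro i j hij hj hi
    fin_cases i <;> fin_cases j
    · exact (h1 hj).2.1.trans (h0 hi).2.1.symm
    · exact (h2 hj).2.1.trans (h0 hi).2.2.symm
    · exact (h3 hj).2.1.trans (h0 hi).1.symm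
    · exact absurd hij (by decide)
    · exact (h2 hj).2.2.trans (h1 hi).2.2.symm
    · exact (h3 hj).2.2.trans (h1 hi).1.symm
    · exact absurd hij (by decide)
    · exact absurd hij (by decide)
    · exact (h3 hj).1.trans (h2 hi).1.symm)
  have g0 : 0 ≠ k → θ.comp (faceMap 0) = d0 := fun hk => h 0 hk
  have g1 : 1 ≠ k → θ.comp (faceMap 1) = d1 := fun hk => h 1 hk
  have g2 : 2 ≠ k → θ.comp (faceMap 2) = d2 := fun hk => h 2 hk
  have g3 : 3 ≠ k → θ.comp (faceMap 3) = d3 := fun hk => h 3 hk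
  have ff : ∀ i j : Fin 3, i ≤ j → (θ.comp (faceMap j.succ)).comp (faceMap i) = (θ.comp (faceMap i.castSucc)).comp (faceMap j) :=
    fun i j h => ContinuousMap.ext fun z => congrArg θ (face_face h z)
  have f00 : (θ.comp (faceMap 1)).comp (faceMap 0) = (θ.comp (faceMap 0)).comp (faceMap 0) := ff 0 0 (by decide)
  have f01 : (θ.comp (faceMap 2)).comp (faceMap 0) = (θ.comp (faceMap 0)).comp (faceMap 1) := ff 0 1 (by decide)
  have f02 : (θ.comp (faceMap 3)).comp (faceMap 0) = (θ.comp (faceMap 0)).comp (faceMap 2) := ff 0 2 (by decide)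
  have f11 : (θ.comp (faceMap 2)).comp (faceMap 1) = (θ.comp (faceMap 1)).comp (faceMap 1) := ff 1 1 (by decide)
  have f12 : (θ.comp (faceMap 3)).comp (faceMap 1) = (θ.comp (faceMap 1)).comp (faceMap 2) := ff 1 2 (by decide)
  have f22 : (θ.comp (faceMap 3)).comp (faceMap 2) = (θ.comp (faceMap 2)).comp (faceMap 2) := ff 2 2 (by decide)
  have q0 : 0 ≠ k → Tr (θ.comp (faceMap 0)) e12 e23 e13 := fun hk => by rw [g0 hk]; exact h0 hk
  have q1 : 1 ≠ k → Tr (θ.comp (faceMap 1)) e02 e23 e03 := fun hk => by rw [g1 hk]; exact h1 hk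
  have q2 : 2 ≠ k → Tr (θ.comp (faceMap 2)) e01 e13 e03 := fun hk => by rw [g2 hk]; exact h2 hk
  have q3 : 3 ≠ k → Tr (θ.comp (faceMap 3)) e01 e12 e02 := fun hk => by rw [g3 hk]; exact h3 hk
  refine ⟨θ, g0, g1, g2, g3, ?_⟩
  unfold Tr at *
  by_cases hk : k = 0
  · subst hk; have := q1 (by decide); have := q2 (by decide); have := q3 (by decide); simp_all
  by_cases hk1 : k = 1
  · subst hk1; have := q0 (by decide); have := q2 (by decide); have := q3 (by decide); simp_all
  by_cases hk2 : k = 2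
  · subst hk2; have := q0 (by decide); have := q1 (by decide); have := q3 (by decide); simp_all
  have := q0 (Ne.symm hk); have := q1 (Ne.symm hk1); have := q2 (Ne.symm hk2)
  simp_all

section
variable {e01 e02 e03 e12 e13 e23 : C(TSimplex 1, X)}
lemma tet1 (h0 : Tri e12 e23 e13) (h2 : Tri e01 e13 e03) (h3 : Tri e01 e12 e02) : Tri e02 e23 e03 := by
  obtain ⟨d0, h0⟩ := h0; obtain ⟨d2, h2⟩ := h2; obtain ⟨d3, h3⟩ := h3
  obtain ⟨θ, -, -, -, -, -, h, -⟩ := horn3 1 (d1 := d0) (fun _ => h0) (fun h => absurd rfl h) (fun _ => h2) (fun _ => h3)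
  exact ⟨_, h⟩
lemma tet2 (h0 : Tri e12 e23 e13) (h1 : Tri e02 e23 e03) (h3 : Tri e01 e12 e02) : Tri e01 e13 e03 := by
  obtain ⟨d0, h0⟩ := h0; obtain ⟨d1, h1⟩ := h1; obtain ⟨d3, h3⟩ := h3
  obtain ⟨θ, -, -, -, -, -, -, h, -⟩ := horn3 2 (d2 := d0) (fun _ => h0) (fun _ => h1) (fun h => absurd rfl h) (fun _ => h3)
  exact ⟨_, h⟩
lemma tet3 (h0 : Tri e12 e23 e13) (h1 : Tri e02 e23 e03) (h2 : Tri e01 e13 e03) : Tri e01 e12 e02 := by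
  obtain ⟨d0, h0⟩ := h0; obtain ⟨d1, h1⟩ := h1; obtain ⟨d2, h2⟩ := h2
  obtain ⟨θ, -, -, -, -, -, -, -, h⟩ := horn3 3 (d3 := d0) (fun _ => h0) (fun _ => h1) (fun _ => h2) (fun h => absurd rfl h)
  exact ⟨_, h⟩
end
lemma vtx (a : C(TSimplex (n + 1), X)) (i k) : a.comp (faceMap i) (vertexPt k) = a (vertexPt (i.succAbove k)) := by
  rw [rf_succ, rf_ap]
lemma Tri.v {a b c : C(TSimplex 1, X)} (h : Tri a b c) : a (vertexPt 1) = b (vertexPt 0) ∧ c (vertexPt 0) = a (vertexPt 0) ∧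
    c (vertexPt 1) = b (vertexPt 1) := by
  obtain ⟨τ, rfl, rfl, rfl⟩ := h
  simp only [vtx]; exact ⟨rfl, rfl, rfl⟩
lemma tri_ex {a b : C(TSimplex 1, X)} (h : a (vertexPt 1) = b (vertexPt 0)) : ∃ c, Tri a b c := by
  obtain ⟨θ, h0, -, h2⟩ := horn2 1 b b a (fun _ h => absurd rfl h) (fun _ _ => h.symm) (fun h => absurd rfl h)
  exact ⟨_, θ, h2 (by decide), h0 (by decide), rfl⟩
lemma tri_ex' {b c : C(TSimplex 1, X)} (h : b (vertexPt 1) = c (vertexPt 1)) : ∃ a, Tri a b c := by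
  obtain ⟨θ, h0, h1, -⟩ := horn2 2 b c b (fun _ _ => h) (fun _ h => absurd rfl h) (fun _ h => absurd rfl h)
  exact ⟨_, θ, rfl, h0 (by decide), h1 (by decide)⟩

def HI (A : Set X) : Prop := ∀ a b c : C(TSimplex 1, A), Tri ((vcm A).comp a) ((vcm A).comp b) ((vcm A).comp c) → Tri a b c
def rel (A : Set X) (e e' : C(TSimplex 1, X)) : Prop := ∃ f : C(TSimplex 1, A), Tri ((vcm A).comp f) e' e
lemma rel.symm {e e' : C(TSimplex 1, X)} (h : rel A e e') : rel A e' e := by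
  obtain ⟨f, h⟩ := h
  obtain ⟨g, hg⟩ := tri_ex' (b := f) (c := kp (f (vertexPt 1))) rfl
  refine ⟨g, tet2 h ?_ (hg.map (vcm A))⟩
  have := tri_l e'
  rw [← h.v.1] at this; exact this
lemma rel.trans {e e' e'' : C(TSimplex 1, X)} (h : rel A e e') (h' : rel A e' e'') : rel A e e'' := by
  obtain ⟨f, h⟩ := h; obtain ⟨g, h'⟩ := h'
  obtain ⟨k, hk⟩ := tri_ex (a := f) (b := g) (Subtype.ext (h.v.1.trans h'.v.2.1))
  exact ⟨k, tet1 h' h (hk.map (vcm A))⟩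
def isB (A : Set X) (e : C(TSimplex 1, X)) : Prop := rel A e (kp (e (vertexPt 1)))
open Classical in
def gam (A : Set X) (e : C(TSimplex 1, X)) : C(TSimplex 1, X) :=
  if isB A e then kp (e (vertexPt 1)) else @Classical.epsilon _ ⟨e⟩ (rel A e)
lemma rel_gam {e e' : C(TSimplex 1, X)} (h : rel A e e') : rel A e (gam A e) := by
  unfold gam; split_ifs with h1
  · exact h1
  · exact Classical.epsilon_spec ⟨_, h⟩
lemma gam_eq {e e' : C(TSimplex 1, X)} (h : rel A e e') : gam A e = gam A e' := by
  have h1 : e (vertexPt 1) = e' (vertexPt 1) := by obtain ⟨f, h⟩ := h; exact h.v.2.2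
  have h2 : rel A e = rel A e' := funext fun x => propext ⟨h.symm.trans, h.trans⟩
  unfold gam isB; rw [h1, h2]
instance [Nonempty A] : Nonempty C(TSimplex n, A) := ⟨ContinuousMap.const _ (Classical.arbitrary A)⟩
def uu (A : Set X) [Nonempty A] (e : C(TSimplex 1, X)) : C(TSimplex 1, A) :=
  Classical.epsilon fun f => (vcm A).comp f = e ∨ ((¬ ∃ f, (vcm A).comp f = e) ∧ Tri ((vcm A).comp f) (gam A e) e)
lemma isB_in (f : C(TSimplex 1, A)) : isB A ((vcm A).comp f) := ⟨f, tri_r _⟩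
lemma vc_inj {f g : C(TSimplex n, A)} (h : (vcm A).comp f = (vcm A).comp g) : f = g :=
  ContinuousMap.ext fun x => vcm_inj A (DFunLike.congr_fun h x)
lemma uu_in [Nonempty A] (f : C(TSimplex 1, A)) : uu A ((vcm A).comp f) = f := by
  have := Classical.epsilon_spec (p := fun g => (vcm A).comp g = (vcm A).comp f ∨ ((¬ ∃ g, (vcm A).comp g = (vcm A).comp f) ∧
    Tri ((vcm A).comp g) (gam A ((vcm A).comp f)) ((vcm A).comp f))) ⟨f, Or.inl rfl⟩
  rcases this with h | ⟨h, -⟩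
  · exact vc_inj h
  · exact absurd ⟨f, rfl⟩ h
lemma uu_tri [Nonempty A] {e e' : C(TSimplex 1, X)} (h : rel A e e') : Tri ((vcm A).comp (uu A e)) (gam A e) e := by
  by_cases h1 : ∃ f : C(TSimplex 1, A), (vcm A).comp f = e
  · obtain ⟨f, rfl⟩ := h1
    rw [uu_in, gam, if_pos (isB_in f)]; exact tri_r _
  · obtain ⟨f, hf⟩ := rel_gam h
    have := Classical.epsilon_spec (p := fun f => (vcm A).comp f = e ∨ ((¬ ∃ f, (vcm A).comp f = e) ∧ Tri ((vcm A).comp f) (gam A e) e)) ⟨f, Or.inr ⟨h1, hf⟩⟩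
    rcases this with h2 | ⟨-, h2⟩
    · exact absurd ⟨_, h2⟩ h1
    · exact h2
lemma rel_B {a b c : C(TSimplex 1, X)} (h : isB A a) (ht : Tri a b c) : rel A c b := by
  obtain ⟨f, hf⟩ := h
  refine ⟨f, tet2 (tri_l b) ht ?_⟩
  rwa [← ht.v.1]
lemma tri_B [Nonempty A] {a b c : C(TSimplex 1, X)} (hi : HI A) (h : isB A a) (ht : Tri a b c) : Tri (uu A a) (uu A b) (uu A c) := by
  have h1 := rel_B h ht
  have h2 := uu_tri h1
  have h3 := uu_tri h1.symm
  have h4 := uu_tri h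
  rw [gam, if_pos h] at h4
  rw [gam_eq h1] at h2
  refine hi _ _ _ (tet3 h3 h2 (tet2 (tri_l b) ht ?_))
  rwa [← ht.v.1]

lemma isB_symm {σ : C(TSimplex n, X)} {i j} (h : isB A (eg σ i j)) : isB A (eg σ j i) := by
  have := (rel_B h (tri_rf σ i j i)).symm
  rwa [eg_self, show vertexPt i = vertexPt (![j, i] 1) from rfl, ← rf_ap] at this
lemma isB_trans {σ : C(TSimplex n, X)} {i j k} (h : isB A (eg σ i j)) (h' : isB A (eg σ j k)) : isB A (eg σ i k) := by
  have := (rel_B h (tri_rf σ i j k)).trans h'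
  rwa [rf_ap, show ![j, k] 1 = ![i, k] 1 from rfl, ← rf_ap] at this
end
end
noncomputable section
open Finset
open Topology
section
variable {X Y : Type} [TopologicalSpace X] [TopologicalSpace Y] {m n l : ℕ} {A : Set X} {B : Set Y}

open Classical in
lemma rn_eq {c : SChain ℝ n X} {s : Finset (SingSimplex n X)} (h : c.support ⊆ s) :
    relNorm A c = ∑ σ ∈ s, (if Set.range ⇑σ ⊆ A then 0 else 1) * |c σ| := by
  rw [relNorm, Finset.sum_filter]
  refine Finset.sum_subset_zero_on_sdiff h (fun σ hσ => ?_) fun σ _ => ?_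
  · simp at hσ; simp [hσ]
  · split_ifs <;> simp_all
lemma rn_nonneg (c : SChain ℝ n X) : 0 ≤ relNorm A c := Finset.sum_nonneg fun _ _ => norm_nonneg _
lemma rn_zero : relNorm A (0 : SChain ℝ n X) = 0 := by simp [relNorm]
open Classical in
lemma rn_add (c d : SChain ℝ n X) : relNorm A (c + d) ≤ relNorm A c + relNorm A d := by
  rw [rn_eq (s := c.support ∪ d.support) Finsupp.support_add, rn_eq Finset.subset_union_left, rn_eq Finset.subset_union_right, ← Finset.sum_add_distrib]
  refine Finset.sum_le_sum fun σ _ => ?_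
  rw [← mul_add]
  exact mul_le_mul_of_nonneg_left (abs_add_le _ _) (by split_ifs <;> norm_num)
lemma rn_smul (a : ℝ) (c : SChain ℝ n X) : relNorm A (a • c) = |a| * relNorm A c := by
  rw [rn_eq Finsupp.support_smul, rn_eq subset_rfl, Finset.mul_sum]
  refine Finset.sum_congr rfl fun σ _ => ?_
  rw [Finsupp.smul_apply, smul_eq_mul, abs_mul]; ring
open Classical in
lemma rn_single (σ : SingSimplex n X) (a : ℝ) : relNorm A (Finsupp.single σ a) = (if Set.range ⇑σ ⊆ A then 0 else 1) * |a| := by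
  rw [rn_eq Finsupp.support_single_subset, Finset.sum_singleton, Finsupp.single_eq_same]
lemma rn_single_le (σ : SingSimplex n X) (a : ℝ) : relNorm A (Finsupp.single σ a) ≤ |a| := by
  rw [rn_single]; split_ifs <;> simp
lemma rn_sum {ι : Type*} (s : Finset ι) (f : ι → SChain ℝ n X) : relNorm A (∑ i ∈ s, f i) ≤ ∑ i ∈ s, relNorm A (f i) := by
  classical
  induction s using Finset.induction_on with
  | empty => simp [rn_zero]
  | insert i s hi ih => rw [sum_insert hi, sum_insert hi]; exact (rn_add _ _).trans (by linarith)
lemma rn_neg (c : SChain ℝ n X) : relNorm A (-c) = relNorm A c := by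
  rw [← neg_one_smul ℝ c, rn_smul]; simp
open Classical in
lemma rn_lin (F : SChain ℝ n X →ₗ[ℝ] SChain ℝ m Y) {k : ℝ} (h : ∀ σ, relNorm B (F (Finsupp.single σ 1)) ≤ k * (if Set.range ⇑σ ⊆ A then 0 else 1))
    (c : SChain ℝ n X) : relNorm B (F c) ≤ k * relNorm A c := by
  conv_lhs => rw [← Finsupp.sum_single c, Finsupp.sum, map_sum]
  refine (rn_sum _ _).trans ?_
  rw [rn_eq (c := c) subset_rfl, Finset.mul_sum]
  refine Finset.sum_le_sum fun σ _ => ?_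
  rw [show (Finsupp.single σ (c σ) : SChain ℝ n X) = c σ • Finsupp.single σ 1 by simp, map_smul, rn_smul]
  nlinarith [h σ, abs_nonneg (c σ)]
lemma rn_map {f : C(X, Y)} (hf : Set.MapsTo f A B) (c : SChain ℝ n X) : relNorm B (cmap ℝ f c) ≤ relNorm A c := by
  classical
  rw [← one_mul (relNorm A c)]
  refine rn_lin (cmap ℝ f) (fun σ => ?_) c
  rw [cmap_single, rn_single, abs_one, mul_one, one_mul]
  split_ifs with h1 h2 h2 <;> norm_num
  refine h1 ?_
  rintro _ ⟨x, rfl⟩; exact hf (h2 ⟨x, rfl⟩)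
lemma lin_mem {V : Type*} [AddCommGroup V] [Module ℝ V] (F : SChain ℝ n X →ₗ[ℝ] V) (Z : Submodule ℝ V) (h : ∀ σ, F (Finsupp.single σ 1) ∈ Z)
    (c : SChain ℝ n X) : F c ∈ Z := by
  rw [← Finsupp.sum_single c, Finsupp.sum, map_sum]
  refine sum_mem fun σ _ => ?_
  rw [show (Finsupp.single σ (c σ) : SChain ℝ n X) = c σ • Finsupp.single σ 1 by simp, map_smul]
  exact Z.smul_mem _ (h σ)

def Z0 (X : Type) [TopologicalSpace X] : Submodule ℝ (SChain ℝ 2 X) where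
  carrier := {c | ∀ ε > 0, ∃ s, relNorm ∅ s ≤ ε ∧ c - s ∈ nul ℝ 2 (∅ : Set X)}
  zero_mem' ε hε := ⟨0, by rw [rn_zero]; exact hε.le, by simp⟩
  add_mem' {c d} hc hd ε hε := by
    obtain ⟨s, h1, h2⟩ := hc (ε / 2) (by positivity); obtain ⟨t, h3, h4⟩ := hd (ε / 2) (by positivity)
    exact ⟨s + t, (rn_add _ _).trans (by linarith), by rw [add_sub_add_comm]; exact add_mem h2 h4⟩
  smul_mem' a c hc ε hε := by
    obtain ⟨s, h1, h2⟩ := hc (ε / (|a| + 1)) (by positivity)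
    refine ⟨a • s, ?_, by rw [← smul_sub]; exact Submodule.smul_mem _ _ h2⟩
    rw [rn_smul]
    rw [le_div_iff₀ (by positivity)] at h1
    nlinarith [rn_nonneg (A := ∅) s]
lemma nul_Z0 {c : SChain ℝ 2 X} (h : c ∈ nul ℝ 2 (∅ : Set X)) : c ∈ Z0 X := fun ε hε =>
  ⟨0, by rw [rn_zero]; exact hε.le, by simpa using h⟩
abbrev sg (σ : SingSimplex n X) : SChain ℝ n X := Finsupp.single σ 1
lemma bd3 (θ : C(TSimplex 3, X)) : sbdry ℝ (sg θ) = sg (θ.comp (faceMap 0)) - sg (θ.comp (faceMap 1)) + sg (θ.comp (faceMap 2)) - sg (θ.comp (faceMap 3)) := by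
  rw [sbdry_single, Fin.sum_univ_four]; simp; abel
lemma dbl {t t' : C(TSimplex 2, X)} {a b c} (h : Tr t a b c) (h' : Tr t' a b c) : ∃ t'', Tr t'' a b c ∧
    sg t'' - sg t - (2 : ℝ) • (sg t' - sg t) ∈ nul ℝ 2 (∅ : Set X) := by
  obtain ⟨s, hs⟩ := tri_r b
  obtain ⟨θ, h0, -, h2, h3, -, hy, -⟩ := horn3 1 (d1 := t) (e02 := c) (fun _ => hs) (fun h => absurd rfl h) (fun _ => h') (fun _ => h)
  obtain ⟨η, g0, g1, -, g3, -, -, hz, -⟩ := horn3 2 (d2 := t) (fun _ => hs) (fun _ => hy) (fun h => absurd rfl h) (fun _ => h')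
  refine ⟨_, hz, ?_⟩
  have : sg (η.comp (faceMap 2)) - sg t - (2 : ℝ) • (sg t' - sg t) = sbdry ℝ (sg η - sg θ) := by
    rw [map_sub, bd3, bd3, h0 (by decide), h2 (by decide), h3 (by decide), g0 (by decide), g1 (by decide), g3 (by decide)]
    module
  rw [this]; exact bd_nul _
lemma same_Z0 {t t' : C(TSimplex 2, X)} {a b c} (h : Tr t a b c) (h' : Tr t' a b c) : sg t' - sg t ∈ Z0 X := by
  have key : ∀ k : ℕ, ∃ t'', Tr t'' a b c ∧ sg t'' - sg t - (2 ^ k : ℝ) • (sg t' - sg t) ∈ nul ℝ 2 (∅ : Set X) := by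
    intro k
    induction k with
    | zero => exact ⟨t', h', by simp⟩
    | succ k ih =>
      obtain ⟨s, hs, h1⟩ := ih
      obtain ⟨r, hr, h2⟩ := dbl h hs
      refine ⟨r, hr, ?_⟩
      have := add_mem h2 (Submodule.smul_mem _ (2 : ℝ) h1)
      convert this using 1
      rw [pow_succ]; module
  intro ε hε
  obtain ⟨k, hk⟩ := exists_pow_lt_of_lt_one (show 0 < ε / 2 by positivity) (show (1 / 2 : ℝ) < 1 by norm_num)
  obtain ⟨s, hs, h1⟩ := key k
  refine ⟨((1 / 2 : ℝ) ^ k) • (sg s - sg t), ?_, ?_⟩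
  · rw [rn_smul, sub_eq_add_neg]
    have h2 := rn_add (A := ∅) (sg s) (- sg t)
    rw [rn_neg] at h2
    have h3 := rn_single_le (A := ∅) s 1; have h4 := rn_single_le (A := ∅) t 1
    rw [abs_one] at h3 h4
    rw [abs_of_nonneg (by positivity)]
    have : (0 : ℝ) < (1 / 2) ^ k := by positivity
    nlinarith
  · have := Submodule.smul_mem _ (-(1 / 2 : ℝ) ^ k) h1
    convert this using 1
    have e : ((1 / 2 : ℝ) ^ k) * 2 ^ k = 1 := by rw [← mul_pow]; norm_num
    rw [smul_sub (-_) _ (_ • _), smul_smul, neg_mul, e]; module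
lemma sph_Z0 {d0 d1 d2 d3 : C(TSimplex 2, X)} {e01 e02 e03 e12 e13 e23}
    (h0 : Tr d0 e12 e23 e13) (h1 : Tr d1 e02 e23 e03) (h2 : Tr d2 e01 e13 e03) (h3 : Tr d3 e01 e12 e02) :
    sg d0 - sg d1 + sg d2 - sg d3 ∈ Z0 X := by
  obtain ⟨θ, g0, g1, g2, -, -, -, -, h⟩ := horn3 3 (fun _ => h0) (fun _ => h1) (fun _ => h2) (fun _ => h3)
  have h4 := add_mem (nul_Z0 (bd_nul (sg θ))) (same_Z0 h3 h)
  rw [bd3, g0 (by decide), g1 (by decide), g2 (by decide)] at h4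
  convert h4 using 1; abel

lemma eg_rf (σ : C(TSimplex n, X)) (ψ : Fin (m + 1) → Fin (n + 1)) (i j) : eg (rf σ ψ) i j = eg σ (ψ i) (ψ j) := by
  rw [eg, rf_rf]; congr 1; funext k; fin_cases k <;> rfl
def TT (A : Set X) [Nonempty A] (σ : C(TSimplex n, X)) (i j k : Fin (n + 1)) : C(TSimplex 2, A) :=
  Classical.epsilon fun t => Tr t (uu A (eg σ i j)) (uu A (eg σ j k)) (uu A (eg σ i k))
lemma tt_tr [Nonempty A] (hi : HI A) {σ : C(TSimplex n, X)} {i j} (h : isB A (eg σ i j)) (k) :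
    Tr (TT A σ i j k) (uu A (eg σ i j)) (uu A (eg σ j k)) (uu A (eg σ i k)) :=
  Classical.epsilon_spec (tri_B hi h (tri_rf σ i j k))
open Classical in
def PP (A : Set X) [Nonempty A] (σ : C(TSimplex n, X)) (i j k : Fin (n + 1)) : SChain ℝ 2 A :=
  if isB A (eg σ i j) ∧ isB A (eg σ j k) then sg (TT A σ i j k) else if isB A (eg σ i j) then (1 / 5 : ℝ) • sg (TT A σ i j k)
  else if isB A (eg σ j k) then (1 / 5 : ℝ) • sg (TT A σ j k i) else if isB A (eg σ i k) then (-1 / 5 : ℝ) • sg (TT A σ i k j) else 0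
lemma pp_rf [Nonempty A] (σ : C(TSimplex n, X)) (ψ : Fin (m + 1) → Fin (n + 1)) (i j k) : PP A (rf σ ψ) i j k = PP A σ (ψ i) (ψ j) (ψ k) := by
  unfold PP TT
  rw [eg_rf σ ψ i j, eg_rf σ ψ j k, eg_rf σ ψ i k, eg_rf σ ψ k i, eg_rf σ ψ j i, eg_rf σ ψ k j]
lemma rn_sg (a : ℝ) (t : C(TSimplex n, X)) : relNorm A (a • sg t) ≤ |a| := by
  rw [rn_smul]; have := rn_single_le (A := A) t 1; rw [abs_one] at this; nlinarith [abs_nonneg a]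
lemma pp_le [Nonempty A] (σ : C(TSimplex n, X)) (i j k) (h : ¬ (isB A (eg σ i j) ∧ isB A (eg σ j k))) : relNorm ∅ (PP A σ i j k) ≤ 1 / 5 := by
  rw [PP, if_neg h]
  split_ifs
  · exact (rn_sg _ _).trans (by norm_num [abs_of_pos])
  · exact (rn_sg _ _).trans (by norm_num [abs_of_pos])
  · exact (rn_sg _ _).trans (by norm_num [abs_div])
  · rw [rn_zero]; norm_num
lemma sph [Nonempty A] (hi : HI A) {σ : C(TSimplex n, X)} {i j k} (h : isB A (eg σ i j)) (h' : isB A (eg σ j k)) (l) :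
    sg (TT A σ j k l) - sg (TT A σ i k l) + sg (TT A σ i j l) - sg (TT A σ i j k) ∈ Z0 A :=
  sph_Z0 (tt_tr hi h' l) (tt_tr hi (isB_trans h h') l) (tt_tr hi h l) (tt_tr hi h k)
lemma qq [Nonempty A] (hi : HI A) (σ : C(TSimplex 3, X)) : ∃ Q : SChain ℝ 2 A, relNorm ∅ Q ≤ 4 / 5 ∧ (Set.range σ ⊆ A → Q = 0) ∧
    PP A σ 1 2 3 - PP A σ 0 2 3 + PP A σ 0 1 3 - PP A σ 0 1 2 - Q ∈ Z0 A := by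
  have tr := fun i j k => isB_trans (A := A) (σ := σ) (i := i) (j := j) (k := k)
  have sy := fun i j => isB_symm (A := A) (σ := σ) (i := i) (j := j)
  have r0 : relNorm ∅ (0 : SChain ℝ 2 A) ≤ 4 / 5 := by rw [rn_zero]; norm_num
  have r4 : ∀ t : C(TSimplex 2, A), relNorm ∅ ((4 / 5 : ℝ) • sg t) ≤ 4 / 5 := fun t => (rn_sg _ _).trans (by norm_num [abs_of_pos])
  have r4' : ∀ t : C(TSimplex 2, A), relNorm ∅ ((-4 / 5 : ℝ) • sg t) ≤ 4 / 5 := fun t => (rn_sg _ _).trans (by norm_num [abs_div])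
  by_cases hA : Set.range σ ⊆ A
  · let f : C(TSimplex 3, A) := ⟨fun x => ⟨σ x, hA ⟨x, rfl⟩⟩, by fun_prop⟩
    have hb : ∀ i j, isB A (eg σ i j) := fun i j => isB_in (eg f i j)
    refine ⟨0, r0, fun _ => rfl, ?_⟩
    have := sph hi (hb 0 1) (hb 1 2) 3
    simpa [PP, hb] using this
  suffices H : ∃ Q : SChain ℝ 2 A, relNorm ∅ Q ≤ 4 / 5 ∧ PP A σ 1 2 3 - PP A σ 0 2 3 + PP A σ 0 1 3 - PP A σ 0 1 2 - Q ∈ Z0 A by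
    obtain ⟨Q, h1, h2⟩ := H; exact ⟨Q, h1, fun h => absurd h hA, h2⟩
  have t3 : ∀ i j k, isB A (eg σ i j) → isB A (eg σ j k) → isB A (eg σ i k) := tr
  by_cases h3 : isB A (eg σ 0 1) ∧ isB A (eg σ 1 2)
  · obtain ⟨h01, h12⟩ := h3
    have h02 := tr _ _ _ h01 h12
    by_cases h23 : isB A (eg σ 2 3)
    · have h13 := tr _ _ _ h12 h23
      refine ⟨0, r0, ?_⟩
      have := sph hi h01 h12 3
      simpa [PP, h01, h12, h23, h13, h02] using this
    have h13 : ¬ isB A (eg σ 1 3) := fun h => h23 (tr _ _ _ (sy _ _ h12) h)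
    refine ⟨_, r4' (TT A σ 0 1 2), ?_⟩
    have := Submodule.smul_mem _ (1 / 5 : ℝ) (sph hi h01 h12 3)
    simp only [PP, h01, h12, h23, h13, h02, and_false, and_true, if_true, if_false]
    convert this using 1; module
  by_cases h0 : isB A (eg σ 1 2) ∧ isB A (eg σ 2 3)
  · obtain ⟨h12, h23⟩ := h0
    have h13 := tr _ _ _ h12 h23
    have h01 : ¬ isB A (eg σ 0 1) := fun h => h3 ⟨h, h12⟩
    have h02 : ¬ isB A (eg σ 0 2) := fun h => h01 (tr _ _ _ h (sy _ _ h12))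
    refine ⟨_, r4 (TT A σ 1 2 3), ?_⟩
    have := Submodule.smul_mem _ (-1 / 5 : ℝ) (sph hi h12 h23 0)
    simp only [PP, h01, h12, h23, h13, h02, and_false, and_true, false_and, if_true, if_false]
    convert this using 1; module
  by_cases h1 : isB A (eg σ 0 2) ∧ isB A (eg σ 2 3)
  · obtain ⟨h02, h23⟩ := h1
    have h03 := tr _ _ _ h02 h23
    have h12 : ¬ isB A (eg σ 1 2) := fun h => h0 ⟨h, h23⟩
    have h01 : ¬ isB A (eg σ 0 1) := fun h => h12 (tr _ _ _ (sy _ _ h) h02)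
    have h13 : ¬ isB A (eg σ 1 3) := fun h => h12 (tr _ _ _ h (sy _ _ h23))
    refine ⟨_, r4' (TT A σ 0 2 3), ?_⟩
    have := Submodule.smul_mem _ (1 / 5 : ℝ) (sph hi h02 h23 1)
    simp only [PP, h01, h12, h23, h13, h02, h03, and_false, and_true, false_and, if_true, if_false]
    convert this using 1; module
  by_cases h2 : isB A (eg σ 0 1) ∧ isB A (eg σ 1 3)
  · obtain ⟨h01, h13⟩ := h2
    have h03 := tr _ _ _ h01 h13
    have h12 : ¬ isB A (eg σ 1 2) := fun h => h3 ⟨h01, h⟩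
    have h02 : ¬ isB A (eg σ 0 2) := fun h => h12 (tr _ _ _ (sy _ _ h01) h)
    have h23 : ¬ isB A (eg σ 2 3) := fun h => h12 (tr _ _ _ h13 (sy _ _ h))
    refine ⟨_, r4 (TT A σ 0 1 3), ?_⟩
    have := Submodule.smul_mem _ (-1 / 5 : ℝ) (sph hi h01 h13 2)
    simp only [PP, h01, h12, h23, h13, h02, h03, and_false, and_true, false_and, if_true, if_false]
    convert this using 1; module
  refine ⟨_, ?_, by rw [sub_self]; exact zero_mem _⟩
  have a0 := pp_le σ 1 2 3 h0; have a1 := pp_le σ 0 2 3 h1; have a2 := pp_le σ 0 1 3 h2; have a3 := pp_le σ 0 1 2 h3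
  simp only [sub_eq_add_neg]
  refine (rn_add _ _).trans ?_
  have b1 := rn_add (A := ∅) (PP A σ 1 2 3 + -PP A σ 0 2 3) (PP A σ 0 1 3)
  have b2 := rn_add (A := ∅) (PP A σ 1 2 3) (-PP A σ 0 2 3)
  simp only [rn_neg] at *
  linarith
lemma T7 (hi : HI A) {z : SChain ℝ 3 X} {b : SChain ℝ 2 A} (hb : cmap ℝ (vcm A) b = sbdry ℝ z) {ε : ℝ} (hε : 0 < ε) :
    ∃ z2 : SChain ℝ 2 A, b - z2 ∈ nul ℝ 2 ∅ ∧ relNorm ∅ z2 ≤ 4 / 5 * relNorm A z + ε := by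
  classical
  rcases isEmpty_or_nonempty A with hA | hA
  · refine ⟨0, ?_, by rw [rn_zero]; have := rn_nonneg (A := A) z; positivity⟩
    haveI : IsEmpty C(TSimplex 2, A) := ⟨fun f => hA.elim (f (vertexPt 0))⟩
    rw [Subsingleton.elim b 0, sub_zero]; exact zero_mem _
  choose Q q1 q2 q3 using qq (A := A) hi
  let P : SChain ℝ 2 X →ₗ[ℝ] SChain ℝ 2 A := Finsupp.lsum ℝ fun τ => LinearMap.toSpanSingleton ℝ _ (PP A τ 0 1 2)
  have hP : ∀ τ, P (sg τ) = PP A τ 0 1 2 := fun τ => by simp [P]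
  let F : SChain ℝ 3 X →ₗ[ℝ] SChain ℝ 2 A := Finsupp.lsum ℝ fun τ => LinearMap.toSpanSingleton ℝ _ (Q τ)
  have hF : ∀ τ, F (sg τ) = Q τ := fun τ => by simp [F]
  have h1 : (P ∘ₗ cmap ℝ (vcm A) - LinearMap.id : SChain ℝ 2 A →ₗ[ℝ] SChain ℝ 2 A) b ∈ Z0 A := lin_mem _ _ (fun t => by
    rw [LinearMap.sub_apply, LinearMap.comp_apply, cmap_single, hP, LinearMap.id_apply]
    have hb : ∀ i j, isB A (eg ((vcm A).comp t) i j) := fun i j => isB_in (eg t i j)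
    rw [PP, if_pos ⟨hb _ _, hb _ _⟩]
    refine same_Z0 (a := eg t 0 1) (b := eg t 1 2) (c := eg t 0 2) ?_ ?_
    · have := tr_rf t 0 1 2
      rwa [show ![(0 : Fin 3), 1, 2] = id by funext x; fin_cases x <;> rfl, rf_id] at this
    · have := tt_tr hi (hb 0 1) 2
      have e : ∀ i j, uu A (eg ((vcm A).comp t) i j) = eg t i j := fun i j => uu_in (eg t i j)
      rwa [e, e, e] at this) b
  have h2 : (P ∘ₗ sbdry ℝ - F : SChain ℝ 3 X →ₗ[ℝ] SChain ℝ 2 A) z ∈ Z0 A := lin_mem _ _ (fun σ => by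
    rw [LinearMap.sub_apply, LinearMap.comp_apply, hF]
    refine cast (congrArg (· ∈ Z0 A) ?_) (q3 σ)
    rw [show sbdry ℝ (Finsupp.single σ 1) = _ from bd3 σ]
    simp only [map_sub, map_add, hP, rf_succ, pp_rf]; rfl) z
  rw [LinearMap.sub_apply, LinearMap.comp_apply, hb, LinearMap.id_apply] at h1
  rw [LinearMap.sub_apply, LinearMap.comp_apply] at h2
  obtain ⟨s, hs, h3⟩ := sub_mem h2 h1 ε hε
  refine ⟨F z + s, ?_, (rn_add _ _).trans (add_le_add (rn_lin F (fun σ => ?_) z) hs)⟩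
  · convert h3 using 1; abel
  · rw [hF]; split_ifs with h
    · rw [q2 σ h, rn_zero]; norm_num
    · rw [mul_one]; exact q1 σ
end
end
noncomputable section
open Finset
open Topology
section
variable {X Y : Type} [TopologicalSpace X] [TopologicalSpace Y] {m n l : ℕ} {A : Set X} {B : Set Y}

lemma hi_loop (h : ∀ l : C(TSimplex 1, A), l (vertexPt 0) = l (vertexPt 1) → Tri ((vcm A).comp l) (kp (l (vertexPt 0) : X)) (kp (l (vertexPt 0) : X)) →
    Tri l (kp (l (vertexPt 0))) (kp (l (vertexPt 0)))) : HI A := by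
  intro a b c ht
  have ha : (a (vertexPt 1) : A) = b (vertexPt 0) := Subtype.ext ht.v.1
  obtain ⟨d, hd⟩ := tri_ex ha
  have hcd : d (vertexPt 1) = c (vertexPt 1) := Subtype.ext (by
    have := ht.v.2.2; exact (congrArg Subtype.val hd.v.2.2).trans this.symm)
  obtain ⟨e, he⟩ := tri_ex' hcd
  have h0 : (c (vertexPt 0) : A) = a (vertexPt 0) := Subtype.ext ht.v.2.1
  have k1 := tet2 (hd.map (vcm A)) ht (tri_l ((vcm A).comp a))
  have e0 : e (vertexPt 0) = a (vertexPt 0) := he.v.2.1.symm.trans h0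
  have d0 : d (vertexPt 0) = a (vertexPt 0) := hd.v.2.1
  have k2 : Tri ((vcm A).comp e) (kp (a (vertexPt 0) : X)) (kp (a (vertexPt 0) : X)) := by
    refine tet3 ?_ k1 (he.map (vcm A))
    have := tri_l ((vcm A).comp d)
    rwa [show ((vcm A).comp d) (vertexPt 0) = (a (vertexPt 0) : X) from congrArg Subtype.val d0] at this
  have k3 := h e (by rw [he.v.1, e0, d0]) (by rw [e0]; exact k2)
  rw [e0] at k3
  have k4 : Tri (kp (a (vertexPt 0))) d c := by
    refine tet1 ?_ he k3
    have := tri_l d; rwa [d0] at this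
  exact tet1 hd k4 (tri_l a)

instance : T2Space (TSimplex n) := inferInstanceAs (T2Space {x // _})
def p1 (t : unitInterval) : TSimplex 1 := ⟨![1 - t.1, t.1], by
  refine ⟨fun i => ?_, by simp⟩
  fin_cases i
  · simpa using t.2.2
  · simpa using t.2.1⟩
def ph (q : unitInterval × unitInterval) : TSimplex 2 := ⟨![(1 - q.1.1) * (1 - q.2.1), (1 - q.1.1) * q.2.1, q.1.1], by
  have h1 := q.1.2; have h2 := q.2.2
  refine ⟨fun i => ?_, by simp [Fin.sum_univ_three]; ring⟩
  fin_cases i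
  · exact mul_nonneg (by linarith [h1.2]) (by linarith [h2.2])
  · exact mul_nonneg (by linarith [h1.2]) h2.1
  · exact h1.1⟩
lemma p1_c : Continuous p1 := Continuous.subtype_mk (continuous_pi fun i => by fin_cases i <;> simp <;> fun_prop) _
lemma ph_c : Continuous ph := Continuous.subtype_mk (continuous_pi fun i => by fin_cases i <;> simp <;> fun_prop) _
lemma ph_0 (t) : ph (0, t) = faceMap 2 (p1 t) := by
  refine Subtype.ext (funext fun k => ?_)
  fin_cases k
  · exact Eq.trans (by simp [ph]; rfl) (face_co 2 (p1 t) 0).symm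
  · exact Eq.trans (by simp [ph]; rfl) (face_co 2 (p1 t) 1).symm
  · exact Eq.trans (by simp [ph]) (face_co0 2 (p1 t)).symm
lemma p1_s (y : TSimplex 1) : p1 ⟨y.1 1, y.2.1 1, by have := y.2.2; rw [Fin.sum_univ_two] at this; linarith [y.2.1 0]⟩ = y := by
  refine Subtype.ext (funext fun k => ?_)
  have := y.2.2; rw [Fin.sum_univ_two] at this
  fin_cases k
  · change 1 - y.1 1 = y.1 0; linarith
  · rfl
lemma p1_0 : p1 0 = vertexPt 0 := Subtype.ext (funext fun k => by fin_cases k <;> simp [p1, vertexPt])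
lemma p1_1 : p1 1 = vertexPt 1 := Subtype.ext (funext fun k => by fin_cases k <;> simp [p1, vertexPt])
lemma ph_s : Function.Surjective ph := fun x => by
  have hs := x.2.2; rw [Fin.sum_univ_three] at hs
  have h0 := x.2.1 0; have h1 := x.2.1 1; have h2 := x.2.1 2
  by_cases h : x.1 2 = 1
  · refine ⟨(1, 0), Subtype.ext (funext fun k => ?_)⟩
    fin_cases k
    · change (1 - (1 : ℝ)) * _ = x.1 0; linarith
    · change (1 - (1 : ℝ)) * _ = x.1 1; linarith
    · exact h.symm
  · have h3 : 0 < 1 - x.1 2 := by rcases lt_or_eq_of_le (show x.1 2 ≤ 1 by linarith) with h' | h' <;> [linarith; exact absurd h' h]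
    refine ⟨(⟨x.1 2, h2, by linarith⟩, ⟨x.1 1 / (1 - x.1 2), by positivity, by rw [div_le_one h3]; linarith⟩), Subtype.ext (funext fun k => ?_)⟩
    fin_cases k
    · change (1 - x.1 2) * (1 - x.1 1 / (1 - x.1 2)) = x.1 0; field_simp; linarith
    · change (1 - x.1 2) * (x.1 1 / (1 - x.1 2)) = x.1 1; field_simp
    · rfl
lemma tri_hom {x : X} {γ : Path x x} {e : C(TSimplex 1, X)} (he : ∀ t, e (p1 t) = γ t) : Tri e (kp x) (kp x) ↔ γ.Homotopic (Path.refl x) := by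
  constructor
  · rintro ⟨τ, h2, h0, h1⟩
    have hz : ∀ q, q.2 = 0 → τ (ph q) = x := fun q hq => by
      rw [← face_dg 1 (show (ph q).1 1 = 0 by simp [ph, hq])]; exact DFunLike.congr_fun h1 _
    have ho : ∀ q, q.2 = 1 → τ (ph q) = x := fun q hq => by
      rw [← face_dg 0 (show (ph q).1 0 = 0 by simp [ph, hq])]; exact DFunLike.congr_fun h0 _
    refine ⟨⟨⟨⟨fun q => τ (ph q), τ.continuous.comp ph_c⟩, fun t => ?_, fun t => ?_⟩, fun s t ht => ?_⟩⟩
    · change τ (ph (0, t)) = _; rw [ph_0]; exact (DFunLike.congr_fun h2 _).trans (he t)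
    · change τ (ph (1, t)) = x
      rw [show ph (1, t) = ph (1, 0) from Subtype.ext (by simp [ph])]; exact hz _ rfl
    · rcases ht with rfl | rfl
      · exact (hz _ rfl).trans (by simp)
      · exact (ho _ rfl).trans (by simp)
  · rintro ⟨H⟩
    let Φ : C(unitInterval × unitInterval, TSimplex 2) := ⟨ph, ph_c⟩
    have hq : IsQuotientMap Φ := (ph_c.isClosedMap).isQuotientMap ph_c ph_s
    have hx : ∀ q, q.1 = 1 ∨ q.2 = 0 ∨ q.2 = 1 → H q = x := by
      rintro ⟨s, t⟩ (rfl | rfl | rfl)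
      · simp
      · simp
      · simp
    have hf : Function.FactorsThrough H.toContinuousMap Φ := fun q q' h => by
      have e := congrArg Subtype.val h
      have e1 : (1 - q.1.1) * q.2.1 = (1 - q'.1.1) * q'.2.1 := congrFun e 1
      have e2 : q.1.1 = q'.1.1 := congrFun e 2
      by_cases hs : q.1 = 1
      · exact (hx _ (Or.inl hs)).trans (hx _ (Or.inl ((Subtype.ext e2).symm.trans hs))).symm
      · have hs' : (1 : ℝ) - q.1 ≠ 0 := fun h => hs (Subtype.ext (by change (q.1 : ℝ) = 1; linarith))
        rw [← e2] at e1
        rw [Prod.ext (Subtype.ext e2) (Subtype.ext (mul_left_cancel₀ hs' e1))]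
    let τ : C(TSimplex 2, X) := hq.lift H.toContinuousMap hf
    have hτ : ∀ q, τ (ph q) = H q := fun q => DFunLike.congr_fun (hq.lift_comp H.toContinuousMap hf) q
    refine ⟨τ, ContinuousMap.ext fun y => ?_, ContinuousMap.ext fun y => ?_, ContinuousMap.ext fun y => ?_⟩
    · rw [← p1_s y, ContinuousMap.comp_apply, ← ph_0, hτ, he]; simp
    · obtain ⟨q, hq⟩ := ph_s (faceMap 0 y)
      rw [ContinuousMap.comp_apply, ← hq, hτ]
      have := congrArg (fun z => z.1 0) hq
      rw [show ((faceMap 0 y).1 0 : ℝ) = 0 from face_co0 _ _] at this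
      refine hx _ ?_
      rcases mul_eq_zero.1 (show (1 - q.1.1) * (1 - q.2.1) = 0 from this) with h | h
      · exact Or.inl (Subtype.ext (by change q.1.1 = 1; linarith))
      · exact Or.inr (Or.inr (Subtype.ext (by change q.2.1 = 1; linarith)))
    · obtain ⟨q, hq⟩ := ph_s (faceMap 1 y)
      rw [ContinuousMap.comp_apply, ← hq, hτ]
      have := congrArg (fun z => z.1 1) hq
      rw [show ((faceMap 1 y).1 1 : ℝ) = 0 from face_co0 _ _] at this
      refine hx _ ?_
      rcases mul_eq_zero.1 (show (1 - q.1.1) * q.2.1 = 0 from this) with h | h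
      · exact Or.inl (Subtype.ext (by change q.1.1 = 1; linarith))
      · exact Or.inr (Or.inl (Subtype.ext h))
lemma hi_of_bi (h : BoundaryIrreducible n X) : HI (intBoundary n X) := by
  set A := intBoundary n X
  refine hi_loop fun l hl ht => ?_
  obtain ⟨⟨x, hx⟩, hl0⟩ : ∃ x, l (vertexPt 0) = x := ⟨_, rfl⟩
  rw [hl0] at ht ⊢
  have hr : ∀ y, (l y : X) ∈ connectedComponentIn A x := fun y =>
    (isPreconnected_range ((vcm A).comp l).continuous).subset_connectedComponentIn ⟨vertexPt 0, by simp [hl0]; rfl⟩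
      (by rintro _ ⟨y, rfl⟩; exact (l y).2) ⟨y, rfl⟩
  let γ : Path (X := ↥(connectedComponentIn A x)) ⟨x, mem_connectedComponentIn hx⟩ ⟨x, mem_connectedComponentIn hx⟩ :=
    ⟨⟨fun t => ⟨l (p1 t), hr _⟩, by
      have := p1_c; fun_prop⟩, Subtype.ext (by simp [p1_0, hl0]), Subtype.ext (by simp [p1_1, ← hl, hl0])⟩
  have h1 := h x hx γ ((tri_hom (e := (vcm A).comp l) fun t => rfl).1 ht)
  let e : C(TSimplex 1, ↥(connectedComponentIn A x)) := ⟨fun y => ⟨l y, hr y⟩, by fun_prop⟩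
  have h2 := (tri_hom (e := e) fun t => rfl).2 h1
  exact h2.map ⟨fun y => (⟨y.1, connectedComponentIn_subset _ _ y.2⟩ : A), by fun_prop⟩

lemma hi_pull (hi : HI A) {p : C(Y, X)} (h2 : ∀ (f : C(TSimplex 2, X)) (y : Y), p y = f (vertexPt 0) → ∃ g : C(TSimplex 2, Y), p.comp g = f ∧ g (vertexPt 0) = y)
    (h1 : ∀ g g' : C(TSimplex 1, Y), p.comp g = p.comp g' → g (vertexPt 0) = g' (vertexPt 0) → g = g') : HI (p ⁻¹' A) := by
  intro a b c ht
  let q : C(p ⁻¹' A, A) := ⟨fun y => ⟨p y.1, y.2⟩, by fun_prop⟩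
  obtain ⟨τ, t2, t0, t1⟩ := hi (q.comp a) (q.comp b) (q.comp c) (ht.map p)
  have tv : τ (vertexPt 0) = q (a (vertexPt 0)) := by
    have := DFunLike.congr_fun t2 (vertexPt 0); rwa [vtx] at this
  obtain ⟨g, hg, hg0⟩ := h2 ((vcm A).comp τ) (a (vertexPt 0)) (congrArg Subtype.val tv).symm
  have hgA : ∀ y, g y ∈ p ⁻¹' A := fun y => by
    rw [Set.mem_preimage, show p (g y) = τ y from DFunLike.congr_fun hg y]; exact (τ y).2
  have e2 : g.comp (faceMap 2) = (vcm _).comp a := h1 _ _ (by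
    rw [← ContinuousMap.comp_assoc, hg, ContinuousMap.comp_assoc, t2]; rfl) (by rw [vtx]; exact hg0)
  have e1 : g.comp (faceMap 1) = (vcm _).comp c := h1 _ _ (by
    rw [← ContinuousMap.comp_assoc, hg, ContinuousMap.comp_assoc, t1]; rfl) (by rw [vtx]; exact hg0.trans ht.v.2.1.symm)
  have e0 : g.comp (faceMap 0) = (vcm _).comp b := h1 _ _ (by
    rw [← ContinuousMap.comp_assoc, hg, ContinuousMap.comp_assoc, t0]; rfl) (by
      have := DFunLike.congr_fun e2 (vertexPt 1); rw [vtx] at this ⊢; exact this.trans ht.v.1)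
  refine ⟨⟨fun y => ⟨g y, hgA y⟩, by fun_prop⟩, ?_, ?_, ?_⟩
  · exact ContinuousMap.ext fun y => Subtype.ext (DFunLike.congr_fun e2 y)
  · exact ContinuousMap.ext fun y => Subtype.ext (DFunLike.congr_fun e0 y)
  · exact ContinuousMap.ext fun y => Subtype.ext (DFunLike.congr_fun e1 y)
lemma hi_clopen (hi : HI A) {S : Set X} (hS : IsClopen S) : HI {x : S | (x : X) ∈ A} := by
  refine hi_pull (p := vcm S) hi (fun f y hy => ?_) fun g g' h _ => vc_inj h
  have : ∀ x, f x ∈ S := fun x => (isPreconnected_range f.continuous).subset_isClopen hS ⟨_, ⟨vertexPt 0, rfl⟩, hy ▸ y.2⟩ ⟨x, rfl⟩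
  exact ⟨⟨fun x => ⟨f x, this x⟩, by fun_prop⟩, rfl, Subtype.ext hy.symm⟩
lemma cvx_ts : Convex ℝ {x : Fin (n + 1) → ℝ | (∀ i, 0 ≤ x i) ∧ ∑ i, x i = 1} := convex_stdSimplex ℝ _
instance : LocallyPathConnectedSpace (TSimplex n) := (cvx_ts (n := n)).locallyPathConnectedSpace
instance : ContractibleSpace (TSimplex n) := (cvx_ts (n := n)).contractibleSpace ⟨_, (vertexPt 0 : TSimplex n).2⟩
lemma cov_ex {p : C(Y, X)} (hp : IsCoveringMap p) {t : TSimplex n} (f : C(TSimplex n, X)) (y : Y) (h : p y = f t) : ∃ g : C(TSimplex n, Y), p.comp g = f ∧ g t = y := by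
  obtain ⟨g, hg, -⟩ := hp.existsUnique_continuousMap_lifts f t y h
  exact ⟨g, DFunLike.coe_injective hg.2, hg.1⟩
lemma cov_un {p : C(Y, X)} (hp : IsCoveringMap p) (g g' : C(TSimplex n, Y)) (h : p.comp g = p.comp g') (t : TSimplex n) (h0 : g t = g' t) : g = g' :=
  DFunLike.coe_injective (hp.eq_of_comp_eq g.continuous g'.continuous (funext fun x => DFunLike.congr_fun h x) t h0)
lemma hi_cover (hi : HI A) {p : C(Y, X)} (hp : IsCoveringMap p) : HI (p ⁻¹' A) :=
  hi_pull hi (cov_ex hp) fun g g' h h0 => cov_un hp g g' h _ h0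
end
end
noncomputable section
open Finset
open Topology
section
variable {R : Type} [CommRing R] {X Y Z W : Type} [TopologicalSpace X] [TopologicalSpace Y] [TopologicalSpace Z] [TopologicalSpace W] {m n : ℕ} {A : Set X} {B : Set Y}

def itr : SChain ℤ n X →+ SChain ℝ n X := Finsupp.mapRange.addMonoidHom (Int.castAddHom ℝ)
lemma itr_single (σ : SingSimplex n X) (k : ℤ) : itr (Finsupp.single σ k) = Finsupp.single σ (k : ℝ) := by simp [itr]
lemma itr_ap (c : SChain ℤ n X) (σ) : itr c σ = (c σ : ℝ) := rfl
lemma itr_smul (k : ℤ) (c : SChain ℤ n X) : itr (k • c) = (k : ℝ) • itr c := by rw [map_zsmul, Int.cast_smul_eq_zsmul]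
lemma itr_bd (c : SChain ℤ (n + 1) X) : sbdry ℝ (itr c) = itr (sbdry ℤ c) := by
  have : (sbdry ℝ).toAddMonoidHom.comp itr = itr.comp (sbdry ℤ : SChain ℤ (n + 1) X →ₗ[ℤ] _).toAddMonoidHom := Finsupp.addHom_ext fun σ k => by
    simp only [AddMonoidHom.comp_apply, LinearMap.toAddMonoidHom_coe, itr_single, sbdry_single, map_sum, map_zsmul]
  exact DFunLike.congr_fun this c
lemma itr_cmap (f : C(X, Y)) (c : SChain ℤ n X) : cmap ℝ f (itr c) = itr (cmap ℤ f c) := by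
  have : (cmap ℝ f).toAddMonoidHom.comp itr = itr.comp (cmap ℤ f : SChain ℤ n X →ₗ[ℤ] _).toAddMonoidHom := Finsupp.addHom_ext fun σ k => by
    simp [itr_single]
  exact DFunLike.congr_fun this c
lemma itr_mem {c : SChain ℤ n X} (h : c ∈ suppOn ℤ n A) : itr c ∈ suppOn ℝ n A :=
  (Finsupp.mem_supported' ℝ _).2 fun σ hσ => by rw [itr_ap, (Finsupp.mem_supported' ℤ c).1 h σ hσ, Int.cast_zero]
lemma itr_nul {c : SChain ℤ n X} (h : c ∈ nul ℤ n A) : itr c ∈ nul ℝ n A := by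
  obtain ⟨a, ha, w, rfl⟩ := mem_nul.1 h
  rw [map_add, ← itr_bd]; exact add_mem (supp_nul (itr_mem ha)) (bd_nul _)

lemma sv_le {c : SChain ℤ n X} {z : SChain ℝ n X} (hc : IsFundCycle n A c) (h : z - itr c ∈ nul ℝ n A) : simVolOr n X A ≤ relNorm A z :=
  csInf_le ⟨0, by rintro _ ⟨z, -, rfl⟩; exact rn_nonneg z⟩ ⟨z, ⟨c, hc, relH_iff.2 h⟩, rfl⟩
lemma le_sv {r : ℝ} (hn : ∃ c, IsFundCycle n A c) (h : ∀ c z, IsFundCycle n A c → z - itr c ∈ nul ℝ n A → r ≤ relNorm A z) : r ≤ simVolOr n X A := by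
  obtain ⟨c, hc⟩ := hn
  exact le_csInf ⟨_, itr c, ⟨c, hc, relH_iff.2 (show itr c - itr c ∈ _ by simp)⟩, rfl⟩ (by rintro _ ⟨z, ⟨c, hc, hz⟩, rfl⟩; exact h c z hc (relH_iff.1 hz))
lemma sv_nn : 0 ≤ simVolOr n X A := Real.sInf_nonneg (by rintro _ ⟨z, -, rfl⟩; exact rn_nonneg z)
def cvs (n : ℕ) (X : Type) [TopologicalSpace X] (A : Set X) : Set ℝ := {r : ℝ | ∃ (Y : TopCat.{0}) (p : ↥Y → X), IsDoubleCover p ∧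
    HomOrientable n ↥Y (p ⁻¹' A) ∧ r = simVolOr n ↥Y (p ⁻¹' A)}
lemma svc_or (h : HomOrientable n X A) : simVolConn n X A = simVolOr n X A := by simp [simVolConn, h]
lemma svc_no (h : ¬ HomOrientable n X A) : simVolConn n X A = 1 / 2 * sInf (cvs n X A) := by simp [simVolConn, h, cvs]
lemma svc_nn : 0 ≤ simVolConn n X A := by
  by_cases h : HomOrientable n X A
  · rw [svc_or h]; exact sv_nn
  · rw [svc_no h]; exact mul_nonneg (by norm_num) (Real.sInf_nonneg (by rintro _ ⟨Y, p, -, -, rfl⟩; exact sv_nn))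
lemma svc_le (h : ¬ HomOrientable n X A) {p : Y → X} (hp : IsDoubleCover p) (hY : HomOrientable n Y (p ⁻¹' A)) : simVolConn n X A ≤ 1 / 2 * simVolOr n Y (p ⁻¹' A) := by
  rw [svc_no h]
  exact mul_le_mul_of_nonneg_left (csInf_le ⟨0, by rintro _ ⟨Y, p, -, -, rfl⟩; exact sv_nn⟩ ⟨TopCat.of Y, p, hp, hY, rfl⟩) (by norm_num)
lemma le_svc (hG : Good (m + 1) X A) [ConnectedSpace X] (h : ¬ HomOrientable (m + 1) X A) {r : ℝ}
    (hr : ∀ (Y : Type) [TopologicalSpace Y] (p : Y → X), IsDoubleCover p → HomOrientable (m + 1) Y (p ⁻¹' A) → 2 * r ≤ simVolOr (m + 1) Y (p ⁻¹' A)) : r ≤ simVolConn (m + 1) X A := by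
  obtain ⟨-, Y, p, hp, hY⟩ := ori_ex hG h
  have : 2 * r ≤ sInf (cvs (m + 1) X A) := le_csInf ⟨_, Y, p, hp, hY, rfl⟩ (by rintro _ ⟨Y, p, hp, hY, rfl⟩; exact hr Y p hp hY)
  rw [svc_no h]; linarith

/-! homeomorphism invariance -/
lemma fund_homeo (e : X ≃ₜ Y) (h : A = e ⁻¹' B) {c : SChain ℤ n X} (hc : IsFundCycle n A c) : IsFundCycle n B (cmap ℤ (e : C(X, Y)) c) := by
  have m1 : Set.MapsTo (e : C(X, Y)) A B := fun x hx => by rw [h] at hx; exact hx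
  have m2 : Set.MapsTo (e.symm : C(Y, X)) B A := fun x hx => by rw [h]; simpa using hx
  refine ⟨cyc_map (f := (e : C(X, Y))) m1 hc.1, fun z hz => ?_⟩
  obtain ⟨k, hk⟩ := hc.2 _ (cyc_map (f := (e.symm : C(Y, X))) m2 hz)
  refine ⟨k, relH_iff.2 ?_⟩
  have := nul_map (f := (e : C(X, Y))) m1 (relH_iff.1 hk)
  rwa [map_sub, cmap_cmap, map_smul, show (e : C(X, Y)).comp (e.symm : C(Y, X)) = ContinuousMap.id Y from ContinuousMap.ext fun y => e.apply_symm_apply y, cmap_id] at this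
lemma ho_homeo (e : X ≃ₜ Y) (h : A = e ⁻¹' B) (hX : HomOrientable n X A) : HomOrientable n Y B := by
  obtain ⟨c, hc, h0⟩ := hX
  refine ⟨_, fund_homeo e h hc, fun hn => h0 (relH_iff.2 ?_)⟩
  have m2 : Set.MapsTo (e.symm : C(Y, X)) B A := fun x hx => by rw [h]; simpa using hx
  have := nul_map (f := (e.symm : C(Y, X))) m2 (relH_iff.1 hn)
  rw [sub_zero]; rwa [sub_zero, cmap_cmap, show (e.symm : C(Y, X)).comp (e : C(X, Y)) = ContinuousMap.id X from ContinuousMap.ext fun y => e.symm_apply_apply y, cmap_id] at this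
lemma sv_homeo (e : X ≃ₜ Y) (h : A = e ⁻¹' B) (hX : HomOrientable n X A) : simVolOr n Y B ≤ simVolOr n X A := by
  have m1 : Set.MapsTo (e : C(X, Y)) A B := fun x hx => by rw [h] at hx; exact hx
  obtain ⟨c, hc, -⟩ := hX
  refine le_sv ⟨c, hc⟩ fun c z hc hz => (sv_le (fund_homeo e h hc) (z := cmap ℝ (e : C(X, Y)) z) ?_).trans (rn_map m1 z)
  rw [← itr_cmap, ← map_sub]; exact nul_map (f := (e : C(X, Y))) m1 hz
lemma cvs_sub (e : X ≃ₜ Y) (h : A = e ⁻¹' B) : cvs n X A ⊆ cvs n Y B := by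
  subst h
  rintro _ ⟨Z, p, hp, hZ, rfl⟩
  refine ⟨Z, e ∘ p, ⟨hp.1.homeomorph_comp e, fun y => ?_⟩, hZ, rfl⟩
  rw [← hp.2 (e.symm y), show (e ∘ p) ⁻¹' {y} = p ⁻¹' {e.symm y} by ext z; simp [e.eq_symm_apply]]
lemma svc_homeo (e : X ≃ₜ Y) (h : A = e ⁻¹' B) : simVolConn n X A = simVolConn n Y B := by
  have h' : B = e.symm ⁻¹' A := by rw [h]; ext; simp
  by_cases hX : HomOrientable n X A
  · have hY := ho_homeo e h hX
    rw [svc_or hX, svc_or hY]; exact le_antisymm (sv_homeo e.symm h' hY) (sv_homeo e h hX)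
  · rw [svc_no hX, svc_no fun hY => hX (ho_homeo e.symm h' hY), (cvs_sub e h).antisymm (cvs_sub e.symm h')]

/-! restriction to clopen pieces -/
structure CE (ι : C(Y, X)) : Prop where
  emb : IsEmbedding ι
  clo : IsClopen (Set.range ι)
lemma CE.vcm {S : Set X} (h : IsClopen S) : CE (_root_.vcm S) := ⟨IsEmbedding.subtypeVal, by rwa [show Set.range (_root_.vcm S) = S from Subtype.range_val]⟩
lemma CE.comp {i : C(Z, Y)} {j : C(Y, X)} (hj : CE j) (hi : CE i) : CE (j.comp i) := by
  refine ⟨hj.emb.comp hi.emb, ?_⟩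
  have h1 : IsOpenEmbedding j := ⟨hj.emb, hj.clo.2⟩
  have h2 : IsClosedEmbedding j := ⟨hj.emb, hj.clo.1⟩
  rw [ContinuousMap.coe_comp, Set.range_comp]
  exact ⟨h2.isClosedMap _ hi.clo.1, h1.isOpenMap _ hi.clo.2⟩
lemma CE.ci {ι : C(Y, X)} (h : CE ι) : Function.Injective (fun σ : SingSimplex n Y => ι.comp σ) := fun _ _ e =>
  ContinuousMap.ext fun x => h.emb.injective (DFunLike.congr_fun e x)
def rs {ι : C(Y, X)} (h : CE ι) : SChain R n X →ₗ[R] SChain R n Y := Finsupp.lcomapDomain _ h.ci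
lemma rs_in {ι : C(Y, X)} (h : CE ι) (τ : SingSimplex n Y) (a : R) : rs h (Finsupp.single (ι.comp τ) a) = Finsupp.single τ a :=
  Finsupp.comapDomain_single _ _ _ _
lemma rs_out {ι : C(Y, X)} (h : CE ι) {σ : SingSimplex n X} (hs : ∀ τ, ι.comp τ ≠ σ) (a : R) : rs h (Finsupp.single σ a) = 0 :=
  Finsupp.ext fun τ => Finsupp.single_eq_of_ne (hs τ)
lemma rs_cmap {ι : C(Y, X)} (h : CE ι) (v : SChain R n Y) : rs h (cmap R ι v) = v := by
  have : (rs h).comp (cmap R ι) = (LinearMap.id : SChain R n Y →ₗ[R] _) := chain_ext fun σ => by simp [rs_in]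
  exact LinearMap.congr_fun this v
lemma rs_lift {ι : C(Y, X)} (h : CE ι) {σ : SingSimplex n X} (t) (ht : σ t ∈ Set.range ι) : ∃ τ, ι.comp τ = σ := by
  have hr : ∀ x, σ x ∈ Set.range ι := fun x => (isPreconnected_range σ.continuous).subset_isClopen h.clo ⟨_, ⟨t, rfl⟩, ht⟩ ⟨x, rfl⟩
  choose g hg using hr
  exact ⟨⟨g, h.emb.continuous_iff.2 (by rw [show ι ∘ g = σ from funext hg]; exact σ.continuous)⟩, ContinuousMap.ext hg⟩
lemma rs_bd {ι : C(Y, X)} (h : CE ι) (z : SChain R (n + 1) X) : sbdry R (rs h z) = rs h (sbdry R z) := by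
  have : (sbdry R).comp (rs h) = (rs h).comp (sbdry R : SChain R (n + 1) X →ₗ[R] _) := chain_ext fun σ => by
    by_cases hs : ∃ τ, ι.comp τ = σ
    · obtain ⟨τ, rfl⟩ := hs
      simp [rs_in, ContinuousMap.comp_assoc]
    · have hf : ∀ i, rs h (Finsupp.single (σ.comp (faceMap i)) (1 : R)) = 0 := fun i => rs_out h (fun τ hτ =>
        hs (rs_lift h (faceMap i (vertexPt 0)) ⟨τ (vertexPt 0), DFunLike.congr_fun hτ _⟩)) 1
      simp only [LinearMap.comp_apply, rs_out h (not_exists.1 hs), sbdry_single, map_sum, map_zsmul, hf, map_zero, smul_zero, sum_const_zero]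
  exact LinearMap.congr_fun this z
lemma rs_cyc {ι : C(Y, X)} (h : CE ι) {z : SChain R (n + 1) X} (hz : z ∈ cyc R (n + 1) ∅) : rs h z ∈ cyc R (n + 1) ∅ := by
  rw [mem_cyc_succ] at hz ⊢; rw [rs_bd, supp_empty hz]; simp
lemma rs_nul {ι : C(Y, X)} (h : CE ι) {z : SChain R n X} (hz : z ∈ nul R n ∅) : rs h z ∈ nul R n ∅ := by
  obtain ⟨a, ha, w, rfl⟩ := mem_nul.1 hz
  rw [supp_empty ha, zero_add, ← rs_bd]; exact bd_nul _
lemma rs_nat {ι : C(Y, X)} (h : CE ι) {p : C(W, X)} {i : C(Z, W)} (h' : CE i) {q : C(Z, Y)} (hq : p.comp i = ι.comp q) (hr : ∀ w, p w ∈ Set.range ι → w ∈ Set.range i)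
    (z : SChain R n W) : rs h (cmap R p z) = cmap R q (rs h' z) := by
  have : (rs h).comp (cmap R p) = (cmap R q).comp (rs h' : SChain R n W →ₗ[R] _) := chain_ext fun σ => by
    by_cases hs : ∃ τ, i.comp τ = σ
    · obtain ⟨τ, rfl⟩ := hs
      simp only [LinearMap.comp_apply, cmap_single, rs_in]
      rw [← ContinuousMap.comp_assoc, hq, ContinuousMap.comp_assoc, rs_in]
    · simp only [LinearMap.comp_apply, cmap_single, rs_out h' (not_exists.1 hs), map_zero]
      refine rs_out h (fun τ hτ => hs (rs_lift h' (vertexPt 0) (hr _ ⟨τ (vertexPt 0), DFunLike.congr_fun hτ _⟩))) 1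
  exact LinearMap.congr_fun this z
lemma rs_rs {i : C(Z, Y)} {j : C(Y, X)} (hj : CE j) (hi : CE i) (z : SChain R n X) : rs hi (rs hj z) = rs (hj.comp hi) z := Finsupp.ext fun _ => rfl
lemma itr_rs {ι : C(Y, X)} (h : CE ι) (z : SChain ℤ n X) : rs h (itr z) = itr (rs h z) := Finsupp.ext fun _ => rfl
lemma rn_emp {c : SChain ℝ n X} : relNorm ∅ c = ∑ σ ∈ c.support, |c σ| := by
  classical
  rw [rn_eq subset_rfl]
  refine Finset.sum_congr rfl fun σ _ => ?_
  rw [if_neg (fun h => h ⟨vertexPt 0, rfl⟩), one_mul]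
lemma rs_norm {κ : Type} (s : Finset κ) {B : κ → Type} [∀ k, TopologicalSpace (B k)] {ι : ∀ k, C(B k, X)} (h : ∀ k, CE (ι k))
    (hd : ∀ k l x y, ι k x = ι l y → k = l) (z : SChain ℝ n X) : ∑ k ∈ s, relNorm ∅ (rs (h k) z) ≤ relNorm ∅ z := by
  classical
  simp only [rn_emp]
  rw [Finset.sum_sigma']
  have hi : Set.InjOn (fun q : (Σ k, SingSimplex n (B k)) => (ι q.1).comp q.2) ↑(s.sigma fun k => (rs (h k) z).support) := by
    rintro ⟨k, σ⟩ - ⟨l, τ⟩ - e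
    obtain rfl := hd k l _ _ (DFunLike.congr_fun e (vertexPt 0))
    exact congrArg _ ((h k).ci e)
  rw [show ∑ q ∈ s.sigma fun k => (rs (h k) z).support, |(rs (h q.1) z) q.2| = ∑ q ∈ s.sigma fun k => (rs (h k) z).support, |z ((ι q.1).comp q.2)| from rfl,
    ← Finset.sum_image (f := fun σ => |z σ|) hi]
  refine Finset.sum_le_sum_of_subset_of_nonneg (fun σ hσ => ?_) fun _ _ _ => abs_nonneg _
  simp only [Finset.mem_image, Finset.mem_sigma] at hσ
  obtain ⟨q, ⟨-, h2⟩, rfl⟩ := hσ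
  exact Finsupp.mem_support_iff.2 (show rs (h q.1) z q.2 ≠ 0 from Finsupp.mem_support_iff.1 h2)
end
end
noncomputable section
open Finset
open Topology
section
variable {R : Type} [CommRing R] {X Y Z W : Type} [TopologicalSpace X] [TopologicalSpace Y] [TopologicalSpace Z] [TopologicalSpace W] {m n : ℕ} {A : Set X} {B : Set Y}

lemma K1 (h : Good (m + 1) X A) [ConnectedSpace X] {b : SChain ℤ (m + 1) X} (hb : b ∈ cyc ℤ (m + 1) A) (h0 : b ∉ nul ℤ (m + 1) A) {w : SChain ℝ (m + 1) X}
    (hw : itr b - w ∈ nul ℝ (m + 1) A) : HomOrientable (m + 1) X A ∧ simVolOr (m + 1) X A ≤ relNorm A w := by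
  refine ⟨h.ho hb h0, ?_⟩
  obtain ⟨c, hc⟩ := h.fund
  obtain ⟨k, hk⟩ := hc.2 b hb
  rw [relH_iff] at hk
  have hk0 : k ≠ 0 := by rintro rfl; exact h0 (by simpa using hk)
  have hkr : (k : ℝ) ≠ 0 := by exact_mod_cast hk0
  have h1 := itr_nul hk
  rw [map_sub, itr_smul] at h1
  have h2 := Submodule.smul_mem _ (k : ℝ)⁻¹ (sub_mem h1 hw)
  rw [show (k : ℝ)⁻¹ • (itr b - (k : ℝ) • itr c - (itr b - w)) = (k : ℝ)⁻¹ • w - itr c by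
    rw [show itr b - (k : ℝ) • itr c - (itr b - w) = w - (k : ℝ) • itr c by abel, smul_sub, inv_smul_smul₀ hkr]] at h2
  refine (sv_le hc h2).trans ?_
  rw [rn_smul, abs_inv]
  have : (1 : ℝ) ≤ |(k : ℝ)| := by exact_mod_cast Int.one_le_abs hk0
  exact mul_le_of_le_one_left (rn_nonneg w) (inv_le_one_of_one_le₀ this)
lemma clo_good (h : Good n X ∅) {ι : C(Y, X)} (hi : CE ι) : Good n Y ∅ := by
  haveI := h.t2; haveI := h.cpt
  haveI : T2Space Y := hi.emb.t2Space
  haveI : CompactSpace Y := (IsClosedEmbedding.mk hi.emb hi.clo.1).compactSpace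
  exact h.pull (IsOpenEmbedding.mk hi.emb hi.clo.2).isLocalHomeomorph

lemma JJ (h : Good 3 X A) [ConnectedSpace X] (hi : HI A) {c : SChain ℤ 3 X} (hc : c ∈ cyc ℤ 3 A) (h0 : c ∉ nul ℤ 3 A) {z : SChain ℝ 3 X} (hz : z - itr c ∈ nul ℝ 3 A)
    {ε : ℝ} (hε : 0 < ε) : ∃ (b : SChain ℤ 2 A) (w : SChain ℝ 2 A), b ∈ cyc ℤ 2 ∅ ∧ cmap ℤ (vcm A) b = sbdry ℤ c ∧ itr b - w ∈ nul ℝ 2 ∅ ∧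
      relNorm ∅ w ≤ 4 / 5 * relNorm A z + ε ∧ ∀ (Z : Type) [TopologicalSpace Z] [Nonempty Z] (ι : C(Z, A)) (hι : CE ι), rs hι b ∉ nul ℤ 2 ∅ := by
  obtain ⟨b, hb⟩ := lift_sub A (mem_cyc_succ.1 hc)
  obtain ⟨a, ha, v, hv⟩ := mem_nul.1 hz
  obtain ⟨a', rfl⟩ := lift_sub A ha
  have hbz : cmap ℝ (vcm A) (itr b + sbdry ℝ a') = sbdry ℝ z := by
    have := congrArg (sbdry ℝ) hv
    rw [map_add, show sbdry ℝ (sbdry ℝ v) = 0 from sbdryN_sbdry (n := 3) v, add_zero, map_sub, itr_bd, sbdry_cmap] at this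
    rw [map_add, itr_cmap, hb, this]; abel
  obtain ⟨w, hw, hn⟩ := T7 hi hbz hε
  have hbc : b ∈ cyc ℤ 2 ∅ := by
    rw [mem_cyc_succ, cmap_inj (R := ℤ) (vcm_inj A) (show cmap ℤ (vcm A) (sbdry ℤ b) = cmap ℤ (vcm A) 0 by
      rw [← sbdry_cmap, hb, map_zero]; exact sbdryN_sbdry (n := 2) c)]; simp
  refine ⟨b, w, hbc, hb, ?_, hn, fun Z _ _ ι hι hnul => h0 ?_⟩
  · rw [show itr b - w = itr b + sbdry ℝ a' - w - sbdry ℝ a' by abel]; exact sub_mem hw (bd_nul _)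
  · obtain ⟨e, he, u, hu⟩ := mem_nul.1 hnul
    rw [supp_empty he, zero_add] at hu
    refine h.bdn (B := Set.range ((vcm A).comp ι)) (w := cmap ℤ ((vcm A).comp ι) u) (by rintro _ ⟨y, rfl⟩; exact (ι y).2) (Set.range_nonempty _)
      (cmap_mem (f := (vcm A).comp ι) (A := Set.univ) (B := Set.range ((vcm A).comp ι)) (fun x _ => Set.mem_range_self x) (suppOn_univ u)) ?_
    rw [mem_cyc_succ, map_sub, sbdry_cmap, hu, ← hb, ← cmap_cmap, ← map_sub]
    refine cmap_mem (f := vcm A) (A := (Set.range ι)ᶜ) (B := A \ Set.range ((vcm A).comp ι)) (fun x hx => ⟨x.2, fun ⟨y, hy⟩ => hx ⟨y, Subtype.ext hy⟩⟩) ?_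
    refine (Finsupp.mem_supported' ℤ _).2 fun σ hσ => ?_
    obtain ⟨t, ht⟩ : ∃ t, σ t ∈ Set.range ι := by
      by_contra hcon; push Not at hcon; exact hσ (by rintro _ ⟨t, rfl⟩; exact hcon t)
    obtain ⟨τ, rfl⟩ := rs_lift hι t ht
    have := DFunLike.congr_fun (show rs hι (b - cmap ℤ ι (rs hι b)) = 0 by rw [map_sub, rs_cmap, sub_self]) τ
    exact this

/-! transfer -/
def LS (p : C(Y, X)) (σ : SingSimplex n X) : Set (SingSimplex n Y) := {g | p.comp g = σ}
lemma ls_bij {p : C(Y, X)} (hp : IsCoveringMap p) (σ : SingSimplex n X) (t) : Set.BijOn (fun g => g t) (LS p σ) (p ⁻¹' {σ t}) :=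
  ⟨fun g hg => DFunLike.congr_fun hg t, fun g hg g' hg' e => cov_un hp g g' (hg.trans hg'.symm) t e, fun y hy => by
    obtain ⟨g, h1, h2⟩ := cov_ex hp σ y hy; exact ⟨g, h1, h2⟩⟩
lemma ls_face {p : C(Y, X)} (hp : IsCoveringMap p) (σ : SingSimplex (n + 1) X) (i) : Set.BijOn (fun g => g.comp (faceMap i)) (LS p σ) (LS p (σ.comp (faceMap i))) :=
  ⟨fun g hg => by rw [← show p.comp g = σ from hg]; rfl, fun g hg g' hg' e => cov_un hp g g' (hg.trans hg'.symm) (faceMap i (vertexPt 0)) (DFunLike.congr_fun e _), fun f hf => by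
    obtain ⟨g, h1, h2⟩ := cov_ex hp (t := faceMap i (vertexPt 0)) σ (f (vertexPt 0)) (DFunLike.congr_fun hf _)
    exact ⟨g, h1, cov_un hp _ _ (by rw [← ContinuousMap.comp_assoc, h1]; exact hf.symm) (vertexPt 0) h2⟩⟩
lemma ls_card {p : C(Y, X)} (hp : IsDoubleCover p) (σ : SingSimplex n X) : (LS p σ).ncard = 2 := by
  rw [← hp.2 (σ (vertexPt 0)), ← Set.ncard_image_of_injOn (ls_bij hp.1 σ (vertexPt 0)).injOn, (ls_bij hp.1 σ (vertexPt 0)).image_eq]; rfl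
lemma ls_fin {p : C(Y, X)} (hp : IsDoubleCover p) (σ : SingSimplex n X) : (LS p σ).Finite := Set.finite_of_ncard_ne_zero (by rw [ls_card hp]; norm_num)
def tra (p : C(Y, X)) : SChain ℤ n X →ₗ[ℤ] SChain ℤ n Y :=
  Finsupp.lsum ℤ fun σ => LinearMap.toSpanSingleton ℤ _ (∑ᶠ g ∈ LS p σ, Finsupp.single g (1 : ℤ))
lemma tra_single (p : C(Y, X)) (σ : SingSimplex n X) : tra p (Finsupp.single σ 1) = ∑ᶠ g ∈ LS p σ, Finsupp.single g (1 : ℤ) := by simp [tra]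
lemma tra_map {p : C(Y, X)} (hp : IsDoubleCover p) (c : SChain ℤ n X) : cmap ℤ p (tra p c) = (2 : ℤ) • c := by
  have : (cmap ℤ p).comp (tra p) = (2 : ℤ) • (LinearMap.id : SChain ℤ n X →ₗ[ℤ] _) := chain_ext fun σ => by
    rw [LinearMap.comp_apply, tra_single, finsum_mem_eq_finite_toFinset_sum _ (ls_fin hp σ), map_sum,
      Finset.sum_congr rfl (g := fun _ => Finsupp.single σ (1 : ℤ)) fun g hg => by rw [cmap_single, show p.comp g = σ from (Set.Finite.mem_toFinset (ls_fin hp σ)).1 hg], Finset.sum_const,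
      ← Set.ncard_eq_toFinset_card _ (ls_fin hp σ), ls_card hp]
    simp
  exact LinearMap.congr_fun this c
lemma tra_bd {p : C(Y, X)} (hp : IsDoubleCover p) (c : SChain ℤ (n + 1) X) : sbdry ℤ (tra p c) = tra p (sbdry ℤ c) := by
  have : (sbdry ℤ).comp (tra p) = (tra p).comp (sbdry ℤ : SChain ℤ (n + 1) X →ₗ[ℤ] _) := chain_ext fun σ => by
    rw [LinearMap.comp_apply, tra_single, finsum_mem_eq_finite_toFinset_sum _ (ls_fin hp σ), map_sum, LinearMap.comp_apply]
    simp only [sbdry_single, map_sum, map_zsmul]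
    rw [Finset.sum_comm]
    refine Finset.sum_congr rfl fun i _ => ?_
    rw [← Finset.smul_sum, tra_single, ← finsum_mem_eq_of_bijOn _ (ls_face hp.1 σ i) (fun g _ => rfl), finsum_mem_eq_finite_toFinset_sum _ (ls_fin hp σ)]
  exact LinearMap.congr_fun this c

lemma dc_closed {p : C(Y, X)} [T2Space X] [CompactSpace X] (hp : IsDoubleCover p) [ConnectedSpace X] {S : Set Y} (hS : IsClopen S) (hn : S.Nonempty) : p '' S = Set.univ := by
  haveI := dc_cpt hp
  exact IsClopen.eq_univ ⟨p.continuous.isClosedMap _ hS.1, hp.1.isOpenMap _ hS.2⟩ (hn.image _)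

lemma LL (h : Good (m + 1) X ∅) [ConnectedSpace X] {p : C(Y, X)} (hp : IsDoubleCover p) {b : SChain ℤ (m + 1) Y} (hb : b ∈ cyc ℤ (m + 1) ∅) (hpb : cmap ℤ p b ∈ nul ℤ (m + 1) ∅)
    (hS : ∀ (Z : Type) [TopologicalSpace Z] [Nonempty Z] (ι : C(Z, Y)) (hι : CE ι), rs hι b ∉ nul ℤ (m + 1) ∅) {w : SChain ℝ (m + 1) Y} (hw : itr b - w ∈ nul ℝ (m + 1) ∅) :
    2 * simVolConn (m + 1) X ∅ ≤ relNorm ∅ w := by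
  haveI := h.t2; haveI := h.cpt; haveI := dc_t2 hp; haveI := dc_cpt hp
  have hY : Good (m + 1) Y ∅ := h.dc hp
  have hne : Nonempty Y := by
    by_contra hc; rw [not_nonempty_iff] at hc
    have := hp.2 (Classical.arbitrary X); rw [Nat.card_of_isEmpty] at this; norm_num at this
  by_cases hcY : PreconnectedSpace Y
  · haveI : ConnectedSpace Y := ⟨hne⟩
    have hci : CE (ContinuousMap.id Y) := ⟨IsEmbedding.id, by rw [ContinuousMap.coe_id, Set.range_id]; exact isClopen_univ⟩
    have h0 : b ∉ nul ℤ (m + 1) ∅ := fun hn => hS Y _ hci (rs_nul hci hn)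
    obtain ⟨ho, hle⟩ := K1 hY hb h0 hw
    have hX : ¬ HomOrientable (m + 1) X ∅ := by
      rintro ⟨c, hc, hc0⟩
      have hcc : c ∈ cyc ℤ (m + 1) ∅ := hc.1
      obtain ⟨f, hf⟩ := hY.fund
      obtain ⟨k, hk⟩ := hf.2 b hb
      obtain ⟨l, hl⟩ := hf.2 (tra p c) (mem_cyc_succ.2 (by rw [tra_bd hp, supp_empty (mem_cyc_succ.1 hcc)]; simp))
      rw [relH_iff] at hk hl hc0
      have hk0 : k ≠ 0 := by rintro rfl; exact h0 (by simpa using hk)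
      have h1 : k • tra p c - l • b ∈ nul ℤ (m + 1) ∅ := by
        have := sub_mem (Submodule.smul_mem _ k hl) (Submodule.smul_mem _ l hk)
        rwa [smul_sub, smul_sub, smul_comm k l f, sub_sub_sub_cancel_right] at this
      have h2 := nul_map (f := p) (B := ∅) (fun x hx => hx) h1
      rw [map_sub, map_smul, map_smul, tra_map hp] at h2
      have h3 := add_mem h2 (Submodule.smul_mem _ l hpb)
      rw [sub_add_cancel, smul_smul] at h3
      exact hc0 (by rw [sub_zero]; exact h.tf hcc (mul_ne_zero hk0 two_ne_zero) h3)
    have := svc_le hX hp ho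
    rw [Set.preimage_empty] at this; linarith
  · obtain ⟨S, hSc, hS1, hS2⟩ : ∃ S : Set Y, IsClopen S ∧ S.Nonempty ∧ Sᶜ.Nonempty := by
      rw [preconnectedSpace_iff_clopen] at hcY; push Not at hcY
      obtain ⟨S, h1, h2, h3⟩ := hcY
      exact ⟨S, h1, h2, Set.nonempty_compl.2 h3⟩
    have key : ∀ T : Set Y, ∀ hT : IsClopen T, T.Nonempty → Tᶜ.Nonempty → simVolConn (m + 1) X ∅ ≤ relNorm ∅ (rs (CE.vcm hT) w) := by
      intro T hT h1 h2
      have hs : Function.Surjective (p.comp (vcm T)) := fun x => by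
        obtain ⟨y, hy, rfl⟩ := (dc_closed hp hT h1).ge (Set.mem_univ x); exact ⟨⟨y, hy⟩, rfl⟩
      have hi : Function.Injective (p.comp (vcm T)) := fun y y' e => by
        obtain ⟨y2, h3, h4⟩ := (dc_closed hp hT.compl h2).ge (Set.mem_univ (p y))
        rcases dc_two hp (show p y = p y' from e) h4.symm with h | h | h
        · exact Subtype.ext h
        · exact absurd y.2 (by rw [h]; exact h3)
        · exact absurd y'.2 (by rw [h]; exact h3)
      haveI : CompactSpace T := isCompact_iff_compactSpace.1 hT.1.isCompact
      let e : T ≃ₜ X := (p.comp (vcm T)).continuous.homeoOfEquivCompactToT2 (f := Equiv.ofBijective _ ⟨hi, hs⟩)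
      haveI : ConnectedSpace T := e.symm.surjective.connectedSpace e.symm.continuous
      obtain ⟨ho, hl⟩ := K1 (clo_good hY (CE.vcm hT)) (rs_cyc (CE.vcm hT) hb) (hS _ _ (CE.vcm hT)) (w := rs (CE.vcm hT) w) (by
        rw [← itr_rs, ← map_sub]; exact rs_nul _ hw)
      rw [← svc_homeo e (A := ∅) rfl, svc_or ho]; exact hl
    have k1 := key S hSc hS1 hS2
    have k2 := key Sᶜ hSc.compl hS2 (by rwa [compl_compl])
    have k3 := rs_norm (Finset.univ : Finset Bool) (B := fun k => ↥(bif k then S else Sᶜ)) (ι := fun k => vcm _)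
      (fun k => CE.vcm (by cases k; exacts [hSc.compl, hSc])) (by
        rintro (_ | _) (_ | _) ⟨x, hx⟩ ⟨y, hy⟩ h
        · rfl
        · exact absurd (show y ∈ S from hy) (by rw [← show x = y from h]; exact hx)
        · exact absurd (show x ∈ S from hx) (by rw [show x = y from h]; exact hy)
        · rfl) w
    rw [Fintype.sum_bool] at k3
    change relNorm ∅ (rs (CE.vcm hSc) w) + relNorm ∅ (rs (CE.vcm hSc.compl) w) ≤ _ at k3
    linarith
end
end
noncomputable section
open Finset
open Topology
section
variable {R : Type} [CommRing R] {X Y Z W : Type} [TopologicalSpace X] [TopologicalSpace Y] [TopologicalSpace Z] [TopologicalSpace W] {m n : ℕ} {A : Set X} {B : Set Y}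

lemma dc_res {p : Y → X} (hp : IsDoubleCover p) (t : Set X) : IsDoubleCover (t.restrictPreimage p) :=
  ⟨hp.1.restrictPreimage t, fun x => by
    rw [← hp.2 x.1]
    exact Nat.card_congr ⟨fun y => ⟨y.1.1, congrArg Subtype.val y.2⟩, fun y => ⟨⟨y.1, show p y ∈ t by rw [show p y = x from y.2]; exact x.2⟩, Subtype.ext y.2⟩, fun _ => rfl, fun _ => rfl⟩⟩

lemma T8 (h : Good 3 X A) [ConnectedSpace X] (hi : HI A) (h2 : Good 2 A ∅) {κ : Type} (s : Finset κ) {B : κ → Set A} (hB : ∀ k, IsClopen (B k)) (hc : ∀ k, ConnectedSpace (B k))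
    (hd : ∀ k l x, x ∈ B k → x ∈ B l → k = l) : 5 / 4 * ∑ k ∈ s, simVolConn 2 (B k) ∅ ≤ simVolConn 3 X A := by
  haveI := h.t2; haveI := h.cpt
  by_cases ho : HomOrientable 3 X A
  · rw [svc_or ho]
    refine le_sv ⟨_, ho.choose_spec.1⟩ fun c z hcf hz => ?_
    have h0 : c ∉ nul ℤ 3 A := fun hn => by
      obtain ⟨c', h1, h2⟩ := ho
      obtain ⟨k, hk⟩ := hcf.2 c' h1.1
      rw [relH_iff] at hk h2
      exact h2 (by rw [sub_zero, ← sub_add_cancel c' (k • c)]; exact add_mem hk (Submodule.smul_mem _ k hn))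
    have key : ∑ k ∈ s, simVolConn 2 (B k) ∅ ≤ 4 / 5 * relNorm A z := le_of_forall_pos_le_add fun ε hε => by
      obtain ⟨b, w, hb, -, hw, hn, hS⟩ := JJ h hi hcf.1 h0 hz hε
      refine le_trans (Finset.sum_le_sum fun k _ => ?_) ((rs_norm s (fun k => CE.vcm (hB k)) (fun k l x y e => hd k l _ x.2 (by rw [show (x : A) = y from e]; exact y.2)) w).trans hn)
      haveI := hc k
      obtain ⟨ho, hl⟩ := K1 (clo_good h2 (CE.vcm (hB k))) (rs_cyc (CE.vcm (hB k)) hb) (hS _ _ (CE.vcm (hB k))) (w := rs (CE.vcm (hB k)) w) (by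
        rw [← itr_rs, ← map_sub]; exact rs_nul _ hw)
      rw [svc_or ho]; exact hl
    linarith
  · refine le_svc h ho fun Y _ p hp hY => le_sv ⟨_, hY.choose_spec.1⟩ fun c z hcf hz => ?_
    have hall := (ori_ex h ho).1
    have h0 : c ∉ nul ℤ 3 (p ⁻¹' A) := fun hn => by
      obtain ⟨c', h1, h2⟩ := hY
      obtain ⟨k, hk⟩ := hcf.2 c' h1.1
      rw [relH_iff] at hk h2
      exact h2 (by rw [sub_zero, ← sub_add_cancel c' (k • c)]; exact add_mem hk (Submodule.smul_mem _ k hn))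
    haveI := dc_conn hall hp hcf.1 h0
    let P : C(Y, X) := ⟨p, hp.1.continuous⟩
    let q : C(p ⁻¹' A, A) := ⟨A.restrictPreimage p, hp.1.continuous.restrictPreimage⟩
    let C := fun k => q ⁻¹' B k
    have hC : ∀ k, IsClopen (C k) := fun k => (hB k).preimage q.continuous
    have key : 2 * ∑ k ∈ s, simVolConn 2 (B k) ∅ ≤ 4 / 5 * relNorm (p ⁻¹' A) z := le_of_forall_pos_le_add fun ε hε => by
      obtain ⟨b, w, hb, hbc, hw, hn, hS⟩ := JJ (h.dc hp) (hi_cover hi (p := P) hp.1) hcf.1 h0 hz hε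
      have hqb : cmap ℤ q b ∈ nul ℤ 2 ∅ := by
        obtain ⟨a, ha, v, hv⟩ := mem_nul.1 (hall _ (cyc_map (f := P) (B := A) (fun x hx => hx) hcf.1))
        obtain ⟨a', rfl⟩ := lift_sub A ha
        have e : cmap ℤ q b = sbdry ℤ a' := cmap_inj (vcm_inj A) (by
          have := congrArg (sbdry ℤ) hv
          rw [map_add, show sbdry ℤ (sbdry ℤ v) = 0 from sbdryN_sbdry (n := 3) v, add_zero, sbdry_cmap, sbdry_cmap, ← hbc, cmap_cmap] at this
          rw [this, cmap_cmap]; rfl)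
        rw [e]; exact bd_nul _
      rw [Finset.mul_sum]
      refine le_trans (Finset.sum_le_sum fun k _ => ?_) ((rs_norm s (fun k => CE.vcm (hC k)) (fun k l x y e => hd k l _ x.2 (by rw [show (x : p ⁻¹' A) = y from e]; exact y.2)) w).trans hn)
      haveI := hc k
      refine LL (clo_good h2 (CE.vcm (hB k))) (p := ⟨(B k).restrictPreimage q, q.continuous.restrictPreimage⟩) (dc_res (dc_res hp A) (B k)) (b := rs (CE.vcm (hC k)) b) (rs_cyc _ hb) ?_ ?_ ?_
      · rw [← rs_nat (CE.vcm (hB k)) (CE.vcm (hC k)) (p := q) rfl (fun w hw => by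
          obtain ⟨x, hx⟩ := hw; exact ⟨⟨w, show q w ∈ B k by rw [← hx]; exact x.2⟩, rfl⟩)]
        exact rs_nul _ hqb
      · intro Z _ _ ι hι; rw [rs_rs]; exact hS Z _ _
      · rw [← itr_rs, ← map_sub]; exact rs_nul _ hw
    linarith
end
end
noncomputable section
open Finset
open Topology
section
variable {X Y : Type} [TopologicalSpace X] [TopologicalSpace Y] {m n : ℕ} {A : Set X} {B : Set Y}
def lcn (X : Type) [TopologicalSpace X] : Prop := ∀ x : X, ∃ U ∈ 𝓝 x, IsPreconnected U
lemma lcn.disc (h : lcn X) : DiscreteTopology (ConnectedComponents X) := by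
  refine discreteTopology_iff_isOpen_singleton.2 fun c => ?_
  rw [← ConnectedComponents.isQuotientMap_coe.isOpen_preimage]
  obtain ⟨x, rfl⟩ := ConnectedComponents.surjective_coe c
  rw [connectedComponents_preimage_singleton]
  refine isOpen_iff_mem_nhds.2 fun y hy => ?_
  obtain ⟨U, hU, hc⟩ := h y
  rw [connectedComponent_eq hy]
  exact Filter.mem_of_superset hU (hc.subset_connectedComponent (mem_of_mem_nhds hU))
lemma lcn.fin (h : lcn X) [CompactSpace X] : Finite (ConnectedComponents X) := by
  haveI := h.disc; exact finite_of_compact_of_discrete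
lemma lcn.clo (h : lcn X) (c : ConnectedComponents X) : IsClopen {x : X | ConnectedComponents.mk x = c} := by
  haveI := h.disc; exact (isClopen_discrete {c}).preimage ConnectedComponents.continuous_coe
lemma cc_conn (c : ConnectedComponents X) : ConnectedSpace {x : X // ConnectedComponents.mk x = c} := by
  obtain ⟨x, rfl⟩ := ConnectedComponents.surjective_coe c
  refine (isConnected_iff_connectedSpace (s := {y | ConnectedComponents.mk y = ConnectedComponents.mk x})).1 ?_
  have := isConnected_connectedComponent (x := x)
  rwa [← connectedComponents_preimage_singleton] at this
lemma leu_lcn (h : LEu n X) : lcn X := fun x => by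
  obtain ⟨j, h1, h2⟩ := h x
  exact ⟨_, h1.isOpen_range.mem_nhds ⟨0, h2⟩, isPreconnected_range j.continuous⟩
lemma cs_homeo (e : Y ≃ₜ X) [ConnectedSpace Y] : ConnectedSpace X := e.surjective.connectedSpace e.continuous
lemma mfd_lcn (h : IsManifoldWithBoundary n X) : lcn X := fun x => by
  obtain ⟨U, hx, hU, ⟨⟨e⟩⟩ | ⟨⟨e⟩⟩⟩ := h.2.2 x
  · exact ⟨U, hU.mem_nhds hx, (isConnected_iff_connectedSpace.2 (cs_homeo e.symm)).2⟩
  · haveI : ConnectedSpace {y : EuclideanSpace ℝ (Fin n) // 0 ≤ ∑ i, y i} := (isConnected_iff_connectedSpace (s := {y : EuclideanSpace ℝ (Fin n) | 0 ≤ ∑ i, y i})).1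
      ⟨⟨0, by simp⟩, Convex.isPreconnected fun a (ha : 0 ≤ ∑ i, a i) b (hb : 0 ≤ ∑ i, b i) s t hs ht _ => by
        change 0 ≤ ∑ i, (s * a i + t * b i)
        rw [Finset.sum_add_distrib, ← Finset.mul_sum, ← Finset.mul_sum]
        exact add_nonneg (mul_nonneg hs ha) (mul_nonneg ht hb)⟩
    exact ⟨U, hU.mem_nhds hx, (isConnected_iff_connectedSpace.2 (cs_homeo e.symm)).2⟩

lemma T8s (h : Good 3 X A) (h2 : LEu 2 A) (hX : lcn X) (hi : HI A) : 5 / 4 * SimVol 2 A ∅ ≤ SimVol 3 X A := by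
  haveI := h.t2; haveI := h.cpt
  haveI : CompactSpace A := isCompact_iff_compactSpace.1 h.cl.isCompact
  haveI := hX.fin
  have hA := leu_lcn h2
  haveI := hA.fin
  haveI := Fintype.ofFinite (ConnectedComponents X)
  haveI := Fintype.ofFinite (ConnectedComponents A)
  let φ : ConnectedComponents A → ConnectedComponents X := (vcm A).continuous.connectedComponentsMap
  classical
  rw [SimVol, SimVol, finsum_eq_sum_of_fintype, finsum_eq_sum_of_fintype, ← Fintype.sum_fiberwise φ, Finset.mul_sum]
  refine Finset.sum_le_sum fun c _ => ?_
  let X' := {x : X // ConnectedComponents.mk x = c}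
  let A' : Set X' := {x | (x : X) ∈ A}
  have hcl := hX.clo c
  haveI : ConnectedSpace X' := cc_conn c
  haveI : CompactSpace X' := isCompact_iff_compactSpace.1 hcl.1.isCompact
  have hG : Good 3 X' A' := h.pull (p := Subtype.val) hcl.2.isOpenEmbedding_subtypeVal.isLocalHomeomorph
  let f : C(A', A) := ⟨fun a => ⟨((a : X') : X), a.2⟩, (continuous_subtype_val.comp continuous_subtype_val).subtype_mk _⟩
  have hf : CE f := ⟨IsEmbedding.of_comp f.continuous continuous_subtype_val (show IsEmbedding (fun a : A' => (a.1.1 : X)) from IsEmbedding.subtypeVal.comp IsEmbedding.subtypeVal), by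
    rw [show Set.range f = vcm A ⁻¹' {x : X | ConnectedComponents.mk x = c} from Set.ext fun a => ⟨by rintro ⟨a, rfl⟩; exact a.1.2, fun ha => ⟨⟨⟨a.1, ha⟩, a.2⟩, rfl⟩⟩]
    exact hcl.preimage (vcm A).continuous⟩
  let B : {d // φ d = c} → Set A' := fun d => {a | ConnectedComponents.mk (f a) = d.1}
  have e : ∀ d, B d ≃ₜ {a : A // ConnectedComponents.mk a = d.1} := fun d =>
    { toFun := fun a => ⟨f a.1, a.2⟩
      invFun := fun a => ⟨⟨⟨a.1.1, (congrArg φ a.2).trans d.2⟩, a.1.2⟩, a.2⟩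
      left_inv := fun _ => rfl
      right_inv := fun _ => rfl }
  have := T8 hG (hi_clopen hi hcl) (clo_good (leu_good h2) hf) (κ := {d // φ d = c}) Finset.univ (B := B) (fun d => (hA.clo d.1).preimage f.continuous)
    (fun d => by haveI := cc_conn d.1; exact cs_homeo (e d).symm) (fun k l x hk hl => Subtype.ext (hk.symm.trans hl))
  refine le_trans (le_of_eq ?_) this
  congr 1
  exact Finset.sum_congr rfl fun d _ => (svc_homeo (e d) (by rw [Set.eq_empty_of_forall_notMem (s := (e d) ⁻¹' _)]; intro x hx; exact hx)).symm
lemma Part1 [CompactSpace X] (h : IsManifoldWithBoundary 3 X) (hi : HI (intBoundary 3 X)) : 5 / 4 * SimVol 2 (intBoundary 3 X) ∅ ≤ SimVol 3 X (intBoundary 3 X) :=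
  T8s (mfd_good h) (bd_leu h) (mfd_lcn h) hi
end
end
noncomputable section
open Finset
open Topology
section
variable {R : Type} [CommRing R] {X Y : Type} [TopologicalSpace X] [TopologicalSpace Y] {k l m n : ℕ}
def res (θ : C(TSimplex k, X)) (g : Fin (n + 1) → Fin (k + 1)) : C(TSimplex n, X) := θ.comp (bar (vertexPt ∘ g))
lemma res_res (θ : C(TSimplex k, X)) (g : Fin (n + 1) → Fin (k + 1)) (h : Fin (m + 1) → Fin (n + 1)) : res (res θ g) h = res θ (g ∘ h) := by
  rw [res, res, ContinuousMap.comp_assoc, bar_comp]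
  exact congrArg (fun v => θ.comp (bar v)) (funext fun j => bar_apply_vertex _ _)
lemma res_face (θ : C(TSimplex (n + 1), X)) (i) : θ.comp (faceMap i) = res θ i.succAbove := by rw [faceMap_eq_bar]; rfl
def sx (θ : C(TSimplex k, X)) (u : Fin (n + 1) → Fin (k + 1) × Bool) : C(TSimplex n, X × unitInterval) :=
  (θ.prodMap (ContinuousMap.id _)).comp (bar fun j => (vertexPt (u j).1, b2I (u j).2))
lemma sx_face (θ : C(TSimplex k, X)) (u : Fin (n + 2) → Fin (k + 1) × Bool) (i) : (sx θ u).comp (faceMap i) = sx θ (u ∘ i.succAbove) := by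
  rw [sx, ContinuousMap.comp_assoc, bar_face]; rfl
lemma sx_nat (θ : C(TSimplex k, X)) (g : Fin (l + 1) → Fin (k + 1)) (u : Fin (n + 1) → Fin (l + 1) × Bool) : sx (res θ g) u = sx θ (Prod.map g id ∘ u) := by
  refine ContinuousMap.ext fun x => ?_
  simp only [sx, res, ContinuousMap.comp_apply, bar_prod, ContinuousMap.prodMap_apply]
  refine Prod.ext (congrArg θ ?_) rfl
  rw [← ContinuousMap.comp_apply, show Prod.fst ∘ (fun j => ((vertexPt (u j).1 : TSimplex l), b2I (u j).2)) = fun j => vertexPt (u j).1 from rfl, bar_comp]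
  exact congrArg (fun v => bar v x) (funext fun j => bar_apply_vertex _ _)
lemma sx_lev (θ : C(TSimplex k, X)) (b : Bool) (g : Fin (n + 1) → Fin (k + 1)) : sx θ (fun j => (g j, b)) = (inI (b2I b)).comp (res θ g) := by
  refine ContinuousMap.ext fun x => ?_
  simp only [sx, res, ContinuousMap.comp_apply, bar_prod, ContinuousMap.prodMap_apply]
  exact Prod.ext rfl (bar_const _ x)
def s1 (σ : SingSimplex n X) : SChain ℝ n X := Finsupp.single σ 1
lemma s1_bd (θ : C(TSimplex k, X)) (u : Fin (n + 2) → Fin (k + 1) × Bool) : sbdry ℝ (s1 (sx θ u)) = ∑ i : Fin (n + 2), ((-1 : ℤ) ^ (i : ℕ)) • s1 (sx θ (u ∘ i.succAbove)) := by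
  simp only [s1, sbdry_single, sx_face]
lemma s1_map (f : C(X, Y)) (σ : SingSimplex n X) : cmap ℝ f (s1 σ) = s1 (f.comp σ) := cmap_single f σ 1
def NN (θ : C(TSimplex k, X)) (x y : Fin (k + 1)) : SChain ℝ 2 (X × unitInterval) := s1 (sx θ ![(x, false), (y, false), (y, true)]) - s1 (sx θ ![(x, false), (x, true), (y, true)])
lemma NN_res (θ : C(TSimplex k, X)) (g : Fin (n + 1) → Fin (k + 1)) (x y) : NN (res θ g) x y = NN θ (g x) (g y) := by
  have h : ∀ a b c : Fin (n + 1) × Bool, Prod.map g id ∘ ![a, b, c] = ![Prod.map g id a, Prod.map g id b, Prod.map g id c] := by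
    intros; funext j; fin_cases j <;> rfl
  simp only [NN, sx_nat, h]; rfl
def KK (θ : C(TSimplex 3, X)) : SChain ℝ 3 (X × unitInterval) :=
  s1 (sx θ ![(0, false), (1, false), (2, false), (2, true)]) - s1 (sx θ ![(0, false), (1, false), (3, false), (3, true)]) + s1 (sx θ ![(0, false), (1, false), (2, true), (3, true)])
    - s1 (sx θ ![(0, false), (0, true), (2, true), (3, true)]) + s1 (sx θ ![(1, false), (1, true), (2, true), (3, true)])
lemma KK_bd (θ : C(TSimplex 3, X)) : sbdry ℝ (KK θ) = cmap ℝ (inI 0) (s1 (res θ ![0, 1, 3]) - s1 (res θ ![0, 1, 2])) + cmap ℝ (inI 1) (s1 (res θ ![1, 2, 3]) - s1 (res θ ![0, 2, 3]))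
    + (NN θ 1 2 - NN θ 0 2) - (NN θ 1 3 - NN θ 0 3) := by
  have e : ∀ (a b c d : Fin 4 × Bool), sbdry ℝ (s1 (sx θ ![a, b, c, d])) = s1 (sx θ ![b, c, d]) - s1 (sx θ ![a, c, d]) + s1 (sx θ ![a, b, d]) - s1 (sx θ ![a, b, c]) := fun a b c d => by
    rw [s1_bd]
    have h0 : (![a, b, c, d] ∘ (0 : Fin 4).succAbove) = ![b, c, d] := by funext j; fin_cases j <;> rfl
    have h1 : (![a, b, c, d] ∘ (1 : Fin 4).succAbove) = ![a, c, d] := by funext j; fin_cases j <;> rfl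
    have h2 : (![a, b, c, d] ∘ (2 : Fin 4).succAbove) = ![a, b, d] := by funext j; fin_cases j <;> rfl
    have h3 : (![a, b, c, d] ∘ (3 : Fin 4).succAbove) = ![a, b, c] := by funext j; fin_cases j <;> rfl
    rw [Fin.sum_univ_four, h0, h1, h2, h3]; norm_num; abel
  have f : ∀ (t : Bool) (a b c : Fin 4), cmap ℝ (inI (b2I t)) (s1 (res θ ![a, b, c])) = s1 (sx θ ![(a, t), (b, t), (c, t)]) := fun t a b c => by
    rw [s1_map, ← sx_lev]; congr 2; funext j; fin_cases j <;> rfl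
  have f0 := f false; have f1 := f true
  simp only [b2I, if_true, Bool.false_eq_true, if_false] at f0 f1
  simp only [KK, NN, map_add, map_sub, e, f0, f1]
  abel
lemma KK_nm (θ : C(TSimplex 3, X)) (A : Set (X × unitInterval)) : relNorm A (KK θ) ≤ 5 := by
  have h : ∀ σ : SingSimplex 3 (X × unitInterval), relNorm A (s1 σ) ≤ 1 := fun σ => (rn_single_le (A := A) σ 1).trans (by simp)
  have hs : ∀ a b : SChain ℝ 3 (X × unitInterval), relNorm A (a - b) ≤ relNorm A a + relNorm A b := fun a b => by
    rw [sub_eq_add_neg, ← rn_neg b]; exact rn_add _ _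
  unfold KK
  refine (rn_add _ _).trans ((add_le_add ((hs _ _).trans (add_le_add ((rn_add _ _).trans (add_le_add (hs _ _) le_rfl)) le_rfl)) le_rfl).trans ?_)
  linarith [h (sx θ ![(0, false), (1, false), (2, false), (2, true)]), h (sx θ ![(0, false), (1, false), (3, false), (3, true)]), h (sx θ ![(0, false), (1, false), (2, true), (3, true)]),
    h (sx θ ![(0, false), (0, true), (2, true), (3, true)]), h (sx θ ![(1, false), (1, true), (2, true), (3, true)])]
end
end
noncomputable section
open Finset
open Topology
section
variable {R : Type} [CommRing R] {X Y : Type} [TopologicalSpace X] [TopologicalSpace Y] {k l m n : ℕ}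
lemma ext2 {s t : C(TSimplex 2, X)} (h : s.comp (faceMap 2) = t.comp (faceMap 2)) : ∃ θ : C(TSimplex 3, X), res θ ![0, 1, 2] = s ∧ res θ ![0, 1, 3] = t := by
  obtain ⟨d0, -, h1, h2⟩ := horn2 0 (s.comp (faceMap 0)) (t.comp (faceMap 0)) (s.comp (faceMap 0)) (fun h => absurd rfl h) (fun h => absurd rfl h) (fun _ _ => by
    rw [vtx, vtx]; have := congrArg (fun f => f (vertexPt 1)) h; simp only [vtx] at this; exact this.symm)
  obtain ⟨θ, -, -, h2, h3, -⟩ := horn3 1 (d0 := d0) (d1 := s) (d2 := t) (d3 := s) (e01 := s.comp (faceMap 2)) (e02 := s.comp (faceMap 1)) (e23 := d0.comp (faceMap 0))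
    (e03 := t.comp (faceMap 1)) (fun _ => ⟨h2 (by decide), rfl, h1 (by decide)⟩) (fun h => absurd rfl h) (fun _ => ⟨h.symm, rfl, rfl⟩) (fun _ => ⟨rfl, rfl, rfl⟩)
  refine ⟨θ, ?_, ?_⟩
  · rw [← h3 (by decide), res_face]; congr 1; funext j; fin_cases j <;> rfl
  · rw [← h2 (by decide), res_face]; congr 1; funext j; fin_cases j <;> rfl
open Classical in
lemma cpl {F E : Type*} [Fintype F] (e : F → E) (p q : F → ℝ) (hp : ∀ f, 0 ≤ p f) (hq : ∀ f, 0 ≤ q f)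
    (h : ∀ x, (∑ f, if e f = x then p f else 0) = ∑ f, if e f = x then q f else 0) :
    ∃ m : F → F → ℝ, (∀ f g, 0 ≤ m f g) ∧ (∀ f g, m f g ≠ 0 → e f = e g) ∧ (∀ f, ∑ g, m f g = p f) ∧ ∀ g, ∑ f, m f g = q g := by
  let W := fun x => ∑ f, if e f = x then p f else 0
  have hW : ∀ x, 0 ≤ W x := fun x => sum_nonneg fun f _ => by split_ifs; exacts [hp f, le_rfl]
  have h1 : ∀ (r : F → ℝ) (hr : ∀ f, 0 ≤ r f) (f), (∑ g, if e g = e f then r g else 0) = 0 → r f = 0 := fun r hr f h0 => by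
    have := (sum_eq_zero_iff_of_nonneg (fun g _ => by split_ifs; exacts [hr g, le_rfl])).1 h0 f (mem_univ f)
    simpa using this
  refine ⟨fun f g => if e f = e g then p f * q g / W (e f) else 0, fun f g => ?_, fun f g hm => by_contra fun hc => hm (if_neg hc), fun f => ?_, fun g => ?_⟩
  · dsimp only; split_ifs; exacts [div_nonneg (mul_nonneg (hp f) (hq g)) (hW _), le_rfl]
  · have : ∀ g, (if e f = e g then p f * q g / W (e f) else 0) = p f / W (e f) * (if e g = e f then q g else 0) := fun g => by
      simp only [eq_comm (a := e f)]; split_ifs <;> ring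
    rw [sum_congr rfl fun g _ => this g, ← mul_sum, ← h]
    by_cases hw : W (e f) = 0
    · rw [h1 p hp f hw]; simp
    · exact div_mul_cancel₀ _ hw
  · have : ∀ f, (if e f = e g then p f * q g / W (e f) else 0) = q g / W (e g) * (if e f = e g then p f else 0) := fun f => by
      split_ifs with hh; rw [hh]; ring; ring
    rw [sum_congr rfl fun f _ => this f, ← mul_sum]
    by_cases hw : W (e g) = 0
    · rw [h1 q hq g (by rw [← h]; exact hw)]; simp
    · exact div_mul_cancel₀ _ hw
def bI (X : Type) : Set (X × unitInterval) := {p | p.2 = 0 ∨ p.2 = 1}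
lemma inI0_mem (c : SChain R n X) : cmap R (inI 0) c ∈ suppOn R n (bI X) := cmap_mem' (B := bI X) (f := inI 0) (fun x => Or.inl rfl) c
lemma inI1_mem (c : SChain R n X) : cmap R (inI 1) c ∈ suppOn R n (bI X) := cmap_mem' (B := bI X) (f := inI 1) (fun x => Or.inr rfl) c
lemma lemE {v : SChain R (n + 1) (X × unitInterval)} {u : SChain R (n + 1) X} {t : SChain R n X} (h : sbdry R v = cmap R (inI 0) (sbdry R u) + cmap R (inI 1) t) :
    v ∈ nul R (n + 1) (bI X) := by
  have hc : v - cmap R (inI 0) u ∈ cyc R (n + 1) (Set.range (inI 1 : C(X, X × unitInterval))) := by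
    rw [mem_cyc_succ, map_sub, sbdry_cmap, h, add_sub_cancel_left]; exact cmap_mem' (f := inI 1) (B := Set.range _) (fun x => ⟨x, rfl⟩) t
  have := hinv (B := bI X) (⟨fun q => (q.1.1, max q.1.2 q.2), by fun_prop⟩ : C((X × unitInterval) × unitInterval, X × unitInterval)) (ContinuousMap.id _) ⟨fun q => (q.1, 1), by fun_prop⟩
    (fun x => Prod.ext rfl (max_eq_left x.2.2.1)) (fun x => Prod.ext rfl (max_eq_right x.2.2.2)) (by rintro _ ⟨y, rfl⟩ t; exact Or.inr (max_eq_left t.2.2)) hc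
  rw [cmap_id] at this
  have h2 := sub_mem (supp_nul (cmap_mem' (B := bI X) (f := (⟨fun q => (q.1, 1), by fun_prop⟩ : C(X × unitInterval, X × unitInterval))) (fun x => Or.inr rfl) (v - cmap R (inI 0) u))) this
  have h3 := add_mem h2 (supp_nul (inI0_mem (R := R) u))
  convert h3 using 1; abel
/-- flags -/
def vv (a b c : Fin 3) : LC ℝ 2 (TSimplex 2) := Finsupp.single (vertexPt ∘ ![a, b, c]) 1
lemma opr_vv (a b c : Fin 3) (σ : SingSimplex 2 X) : opr (vv a b c) (Finsupp.single σ 1) = s1 (res σ ![a, b, c]) := by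
  rw [opr_single, vv, lreal_single, cmap_single]; rfl
def PH : LC ℝ 2 (TSimplex 2) := vv 1 2 0 - vv 0 2 1 + vv 0 1 2
lemma PH_ex {z : SChain ℝ 2 X} (hz : sbdry ℝ z = 0) : ∃ u, opr PH z = (3 : ℝ) • z + sbdry ℝ u := by
  let S : LC ℝ 2 (TSimplex 1) := Finsupp.single (vertexPt ∘ ![0, 1, 0]) 1 + Finsupp.single (vertexPt ∘ ![0, 0, 0]) 1
  let S' := ∑ i : Fin 3, ((-1 : ℤ) ^ (i : ℕ)) • lmp ℝ (faceMap i) S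
  have hS : opr S' z = 0 := by rw [← opr_sbdry, hz, map_zero]
  have e : S' = vv 1 2 1 + vv 1 1 1 - (vv 0 2 0 + vv 0 0 0) + (vv 0 1 0 + vv 0 0 0) := by
    have f : ∀ (i : Fin 3) (a b c : Fin 2), (faceMap i ∘ vertexPt ∘ ![a, b, c] : Fin 3 → _) = vertexPt ∘ ![i.succAbove a, i.succAbove b, i.succAbove c] := fun i a b c => by
      rw [← Function.comp_assoc, face_vertex]; funext j; fin_cases j <;> rfl
    simp only [S', S, Fin.sum_univ_three, map_add, lmp_single, f, vv]
    have a : (0 : Fin 3).succAbove (0 : Fin 2) = 1 := rfl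
    have b : (0 : Fin 3).succAbove (1 : Fin 2) = 2 := rfl
    have c : (1 : Fin 3).succAbove (0 : Fin 2) = 0 := rfl
    have d : (1 : Fin 3).succAbove (1 : Fin 2) = 2 := rfl
    have g : (2 : Fin 3).succAbove (0 : Fin 2) = 0 := rfl
    have h : (2 : Fin 3).succAbove (1 : Fin 2) = 1 := rfl
    simp only [a, b, c, d, g, h]; norm_num; abel
  have hi : iot ℝ 2 = vv 0 1 2 := by
    rw [iot, vv]; congr 1; funext j; fin_cases j <;> rfl
  have hb : lbd ℝ (PH - (3 : ℝ) • iot ℝ 2 + S') = 0 := by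
    have f : ∀ a b c : Fin 3, lbd ℝ (vv a b c) = Finsupp.single (vertexPt ∘ ![b, c]) 1 - Finsupp.single (vertexPt ∘ ![a, c]) 1 + Finsupp.single (vertexPt ∘ ![a, b]) 1 := fun a b c => by
      have h0 : ((vertexPt ∘ ![a, b, c] : Fin 3 → TSimplex 2) ∘ (0 : Fin 3).succAbove) = vertexPt ∘ ![b, c] := by funext j; fin_cases j <;> rfl
      have h1 : ((vertexPt ∘ ![a, b, c] : Fin 3 → TSimplex 2) ∘ (1 : Fin 3).succAbove) = vertexPt ∘ ![a, c] := by funext j; fin_cases j <;> rfl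
      have h2 : ((vertexPt ∘ ![a, b, c] : Fin 3 → TSimplex 2) ∘ (2 : Fin 3).succAbove) = vertexPt ∘ ![a, b] := by funext j; fin_cases j <;> rfl
      rw [vv, lbd_single, Fin.sum_univ_three, h0, h1, h2]; norm_num; abel
    rw [e, hi, PH]; simp only [map_add, map_sub, map_smul, f]; module
  have h := sbdry_opr (lcone ℝ (vertexPt 0) (PH - (3 : ℝ) • iot ℝ 2 + S')) z
  rw [lbd_lcone, hb, map_zero, sub_zero] at h
  have ad : ∀ (a b : LC ℝ 2 (TSimplex 2)), opr (a + b) z = opr a z + opr b z := fun a b => by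
    rw [← LinearMap.add_apply]; congr 1; exact chain_ext fun σ => by simp
  have sm : ∀ (r : ℝ) (b : LC ℝ 2 (TSimplex 2)), opr (r • b) z = r • opr b z := fun r b => by
    rw [← LinearMap.smul_apply]; congr 1; exact chain_ext fun σ => by simp
  refine ⟨(opr ((lcone ℝ (vertexPt 0)) (PH - (3 : ℝ) • iot ℝ 2 + S'))) z, ?_⟩
  rw [h, ad, sub_eq_add_neg, ad, ← neg_smul, sm, opr_iot, hS]; module
lemma fl_sum {M : Type*} [AddCommGroup M] [Module ℝ M] (z : SChain ℝ 2 X) (H : SingSimplex 2 X → Fin 3 → M) :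
    ∑ f : z.support × Fin 3, (z f.1.1 * (-1) ^ (f.2 : ℕ)) • H f.1.1 f.2 = Finsupp.linearCombination ℝ (fun σ => ∑ i : Fin 3, ((-1 : ℝ) ^ (i : ℕ)) • H σ i) z := by
  rw [Fintype.sum_prod_type, Finsupp.linearCombination_apply, Finsupp.sum, ← Finset.sum_coe_sort z.support fun σ => z σ • ∑ i : Fin 3, ((-1 : ℝ) ^ (i : ℕ)) • H σ i]
  simp only [smul_sum, mul_smul]
lemma fl_bd {M : Type*} [AddCommGroup M] [Module ℝ M] {z : SChain ℝ 2 X} (hz : sbdry ℝ z = 0) (G : SingSimplex 1 X → M) :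
    ∑ f : z.support × Fin 3, (z f.1.1 * (-1) ^ (f.2 : ℕ)) • G (f.1.1.comp (faceMap f.2)) = 0 := by
  rw [fl_sum z fun σ i => G (σ.comp (faceMap i))]
  rw [← map_zero (Finsupp.linearCombination ℝ G), ← hz]
  refine LinearMap.congr_fun (g := (Finsupp.linearCombination ℝ G).comp (sbdry ℝ)) (chain_ext fun σ => ?_) z
  simp only [LinearMap.comp_apply, sbdry_single, Finsupp.linearCombination_single, one_smul, map_sum, map_zsmul]
  refine sum_congr rfl fun i _ => ?_
  rw [← Int.cast_smul_eq_zsmul ℝ]; push_cast; rfl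
def tf (σ : SingSimplex 2 X) (i : Fin 3) : SingSimplex 2 X := res σ ![i.succAbove 0, i.succAbove 1, i]
lemma tf_e (σ : SingSimplex 2 X) (i : Fin 3) : (tf σ i).comp (faceMap 2) = σ.comp (faceMap i) := by
  rw [res_face, tf, res_res, res_face]; congr 1; funext j; fin_cases j <;> rfl
lemma WW {z : SChain ℝ 2 X} (hz : sbdry ℝ z = 0) : ∃ w u t, relNorm (bI X) w ≤ 5 / 2 * relNorm ∅ z ∧ sbdry ℝ w = cmap ℝ (inI 0) (sbdry ℝ u - z) + cmap ℝ (inI 1) t := by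
  classical
  let F := z.support × Fin 3
  let ω : F → ℝ := fun f => z f.1.1 * (-1) ^ (f.2 : ℕ)
  let e : F → SingSimplex 1 X := fun f => f.1.1.comp (faceMap f.2)
  let τ : F → SingSimplex 2 X := fun f => tf f.1.1 f.2
  have hpq : ∀ a : ℝ, max a 0 - max (-a) 0 = a := fun a => by
    rcases le_total a 0 with h | h
    · rw [max_eq_right h, max_eq_left (by linarith)]; ring
    · rw [max_eq_left h, max_eq_right (by linarith)]; ring
  have hpa : ∀ a : ℝ, max a 0 + max (-a) 0 = |a| := fun a => by
    rcases le_total a 0 with h | h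
    · rw [max_eq_right h, max_eq_left (by linarith), abs_of_nonpos h]; ring
    · rw [max_eq_left h, max_eq_right (by linarith), abs_of_nonneg h]; ring
  obtain ⟨m, m0, me, m1, m2⟩ := cpl e (fun f => max (ω f) 0) (fun f => max (-ω f) 0) (fun _ => le_max_right _ _) (fun _ => le_max_right _ _) (fun x => by
    have := fl_bd hz (fun y => if y = x then (1 : ℝ) else 0)
    rw [← sub_eq_zero, ← sum_sub_distrib]; refine Eq.trans ?_ this
    refine sum_congr rfl fun f _ => ?_
    change _ = ω f • (if e f = x then (1 : ℝ) else 0)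
    split_ifs
    · rw [hpq, smul_eq_mul, mul_one]
    · simp)
  have hm : ∀ {M : Type} [AddCommGroup M] [Module ℝ M] (G : F → M), ∑ f, ∑ g, m f g • (G f - G g) = ∑ f, ω f • G f := fun {M} _ _ G => by
    simp only [smul_sub, sum_sub_distrib, ← sum_smul, m1]
    rw [sum_comm]; simp only [← sum_smul, m2]
    rw [← sum_sub_distrib]; exact sum_congr rfl fun f _ => by rw [← sub_smul, hpq]
  have hθ : ∀ f g, ∃ θ : C(TSimplex 3, X), e f = e g → res θ ![0, 1, 2] = τ f ∧ res θ ![0, 1, 3] = τ g := fun f g => by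
    by_cases h : e f = e g
    · obtain ⟨θ, h⟩ := ext2 (s := τ f) (t := τ g) (by rw [tf_e, tf_e]; exact h)
      exact ⟨θ, fun _ => h⟩
    · obtain ⟨θ, -⟩ := ext2 (s := τ f) rfl
      exact ⟨θ, fun h' => absurd h' h⟩
  choose θ hθ using hθ
  let T := ∑ f, ∑ g, m f g • (s1 (res (θ f g) ![1, 2, 3]) - s1 (res (θ f g) ![0, 2, 3]))
  let V : SingSimplex 2 X → SChain ℝ 2 (X × unitInterval) := fun t => NN t 1 2 - NN t 0 2
  let w0 := ∑ f, ∑ g, m f g • KK (θ f g)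
  have hV : ∑ f, ω f • V (τ f) = 0 := by
    rw [← fl_bd hz (fun y => NN y 0 1 - NN y 1 0), fl_sum z fun σ i => V (tf σ i), fl_sum z fun σ i => NN (σ.comp (faceMap i)) 0 1 - NN (σ.comp (faceMap i)) 1 0]
    congr 2; funext σ
    simp only [V, tf, NN_res, res_face, Fin.sum_univ_three]
    have a : (0 : Fin 3).succAbove (0 : Fin 2) = 1 := rfl
    have b : (0 : Fin 3).succAbove (1 : Fin 2) = 2 := rfl
    have c : (1 : Fin 3).succAbove (0 : Fin 2) = 0 := rfl
    have d : (1 : Fin 3).succAbove (1 : Fin 2) = 2 := rfl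
    have g : (2 : Fin 3).succAbove (0 : Fin 2) = 0 := rfl
    have h : (2 : Fin 3).succAbove (1 : Fin 2) = 1 := rfl
    simp [a, b, c, d, g, h]; abel
  have hP : ∑ f, ω f • s1 (τ f) = opr PH z := by
    rw [fl_sum z fun σ i => s1 (tf σ i)]
    refine LinearMap.congr_fun (g := opr PH) (chain_ext fun σ => ?_) z
    have : opr PH (Finsupp.single σ 1) = opr (vv 1 2 0) (Finsupp.single σ 1) - opr (vv 0 2 1) (Finsupp.single σ 1) + opr (vv 0 1 2) (Finsupp.single σ (1 : ℝ)) := by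
      simp only [opr_single, PH, map_add, map_sub]
    rw [this, opr_vv, opr_vv, opr_vv, Finsupp.linearCombination_single, one_smul, Fin.sum_univ_three]
    norm_num; rw [← sub_eq_add_neg]; rfl
  have hb : sbdry ℝ w0 = -cmap ℝ (inI 0) (opr PH z) + cmap ℝ (inI 1) T := by
    have h : ∀ f g, m f g • sbdry ℝ (KK (θ f g)) = -cmap ℝ (inI 0) (m f g • (s1 (τ f) - s1 (τ g))) + cmap ℝ (inI 1) (m f g • (s1 (res (θ f g) ![1, 2, 3]) - s1 (res (θ f g) ![0, 2, 3]))) +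
        m f g • (V (τ f) - V (τ g)) := fun f g => by
      by_cases h : m f g = 0
      · simp [h]
      obtain ⟨h1, h2⟩ := hθ f g (me f g h)
      simp only [KK_bd, V, ← h1, ← h2, NN_res, map_smul, map_sub]
      rw [← smul_neg, ← smul_add, ← smul_add]; congr 1
      change _ = _ + _ + (NN (θ f g) 1 2 - NN (θ f g) 0 2 - (NN (θ f g) 1 3 - NN (θ f g) 0 3))
      abel
    simp only [w0, map_sum, map_smul]
    simp only [h, sum_add_distrib, sum_neg_distrib, ← map_sum]
    rw [hm (fun f => s1 (τ f)), hm (fun f => V (τ f)), hV, hP, add_zero]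
  obtain ⟨u, hu⟩ := PH_ex hz
  refine ⟨(1 / 3 : ℝ) • w0, (-1 / 3 : ℝ) • u, (1 / 3 : ℝ) • T, ?_, ?_⟩
  · have h1 : relNorm (bI X) w0 ≤ ∑ f, ∑ g, m f g * 5 := (rn_sum _ _).trans (sum_le_sum fun f _ => (rn_sum _ _).trans (sum_le_sum fun g _ => by
      rw [rn_smul, abs_of_nonneg (m0 f g)]; exact mul_le_mul_of_nonneg_left (KK_nm _ _) (m0 f g)))
    have h2 : ∑ f, ∑ g, m f g * 5 = (∑ f, max (ω f) 0) * 5 := by simp only [← sum_mul, m1]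
    have h3 : ∑ f, max (ω f) 0 = ∑ f, max (-ω f) 0 := by
      simp only [← m1, ← m2]; exact sum_comm
    have h4 : ∑ f, max (ω f) 0 + ∑ f, max (-ω f) 0 = 3 * relNorm ∅ z := by
      rw [← sum_add_distrib, rn_emp]; simp only [hpa, ω, abs_mul, abs_pow, abs_neg, abs_one, one_pow, mul_one]
      rw [Fintype.sum_prod_type]; simp only [sum_const, card_univ, Fintype.card_fin, ← Finset.sum_coe_sort z.support fun σ => |z σ|]
      rw [mul_sum]; simp
    rw [rn_smul, abs_of_nonneg (by norm_num)]; linarith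
  · rw [map_smul, hb, hu]
    simp only [map_sub, map_add, map_smul, map_zero]; module
end
end
noncomputable section
open Finset
open Topology
section
variable {R : Type} [CommRing R] {X Y : Type} [TopologicalSpace X] [TopologicalSpace Y] {k l m n : ℕ}
abbrev lvl (b : Bool) : C(X, bI X) := ⟨fun x => ⟨(x, b2I b), by cases b; exacts [Or.inl rfl, Or.inr rfl]⟩, by fun_prop⟩
lemma lvl_r (b : Bool) : Set.range (lvl b : C(X, bI X)) = {q | q.1.2 = b2I b} := by
  ext q; constructor
  · rintro ⟨x, rfl⟩; rfl
  · intro h; exact ⟨q.1.1, Subtype.ext (Prod.ext rfl h.symm)⟩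
lemma b2_ne : b2I false ≠ b2I true := by simp [b2I]
lemma lvl_ce (b : Bool) : CE (lvl b : C(X, bI X)) := by
  have hc : ∀ b : Bool, IsClosed {q : bI X | q.1.2 = b2I b} := fun b => isClosed_eq (by fun_prop) continuous_const
  refine ⟨IsEmbedding.of_comp (lvl b).continuous (g := fun q : bI X => q.1.1) (by fun_prop) IsEmbedding.id, ?_⟩
  rw [lvl_r]
  refine ⟨hc b, ?_⟩
  rw [← isClosed_compl_iff]; convert hc (!b) using 1
  ext q
  rcases q.2 with h | h <;> cases b <;> simp [h, b2I]
lemma lvl_z (c : SChain R n X) : rs (lvl_ce true) (cmap R (lvl false) c) = 0 := by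
  refine LinearMap.congr_fun (f := (rs (lvl_ce true)).comp (cmap R (lvl false))) (g := 0) (chain_ext fun σ => ?_) c
  rw [LinearMap.comp_apply, cmap_single]
  refine rs_out _ (fun τ h => ?_) _
  have := congrArg (fun f => (f (vertexPt 0)).1.2) h
  exact b2_ne this.symm
lemma prism_nul {c : SChain R (n + 1) X} (hc : sbdry R c = 0) (h : prism R c ∈ nul R (n + 2) (bI X)) : c ∈ nul R (n + 1) ∅ := by
  obtain ⟨a, ha, w, hw⟩ := mem_nul.1 h
  obtain ⟨a', rfl⟩ := lift_sub _ ha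
  have e : sbdry R a' = cmap R (lvl true) c - cmap R (lvl false) c := by
    apply cmap_inj (R := R) (vcm_inj (bI X))
    have := congrArg (sbdry R) hw
    rw [map_add, sbdry_sbdry, add_zero, sbdry_prism, hc, map_zero, sub_zero, sbdry_cmap] at this
    rw [this, map_sub, cmap_cmap, cmap_cmap]; congr 2
  have := congrArg (rs (lvl_ce true)) e
  rw [← rs_bd, map_sub, rs_cmap, lvl_z, sub_zero] at this
  rw [← this]; exact bd_nul _
lemma emp_cyc {c : SChain R (n + 1) X} (h : c ∈ cyc R (n + 1) ∅) : sbdry R c = 0 := supp_empty (mem_cyc_succ.1 h)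
lemma ho_nn (h : HomOrientable n X ∅) {c : SChain ℤ n X} (hc : IsFundCycle n ∅ c) : c ∉ nul ℤ n ∅ := fun h0 => by
  obtain ⟨d, hd, hd'⟩ := h
  obtain ⟨k, hk⟩ := hc.2 d hd.1
  rw [relH_iff] at hk hd'
  rw [sub_zero] at hd'
  have := add_mem hk ((nul ℤ n (∅ : Set X)).smul_mem k h0)
  rw [sub_add_cancel] at this; exact hd' this
lemma pOr (hG : Good 3 (X × unitInterval) (bI X)) [ConnectedSpace X] (ho : HomOrientable 2 X ∅) :
    HomOrientable 3 (X × unitInterval) (bI X) ∧ simVolOr 3 (X × unitInterval) (bI X) ≤ 5 / 2 * simVolOr 2 X ∅ := by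
  have key : ∀ (c : SChain ℤ 2 X) (z : SChain ℝ 2 X), IsFundCycle 2 ∅ c → z - itr c ∈ nul ℝ 2 ∅ →
      HomOrientable 3 (X × unitInterval) (bI X) ∧ simVolOr 3 (X × unitInterval) (bI X) ≤ 5 / 2 * relNorm ∅ z := fun c z hc hz => by
    have c0 : sbdry ℤ c = 0 := emp_cyc hc.1
    obtain ⟨a, ha, y, hy⟩ := mem_nul.1 hz
    rw [supp_empty ha, zero_add] at hy
    have z0 : sbdry ℝ z = 0 := by
      rw [← sub_add_cancel z (itr c), ← hy, map_add, sbdry_sbdry, itr_bd, c0, map_zero, zero_add]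
    obtain ⟨w, u, t, hw, hb⟩ := WW z0
    have hp : sbdry ℤ (prism ℤ c) = cmap ℤ (inI 1) c - cmap ℤ (inI 0) c := by rw [sbdry_prism, c0, map_zero, sub_zero]
    have := K1 hG (b := prism ℤ c) (w := w) (mem_cyc_succ.2 (by rw [hp]; exact sub_mem (inI1_mem c) (inI0_mem c))) (fun h => ho_nn ho hc (prism_nul c0 h))
      (lemE (u := y - u) (t := itr c - t) (by
        rw [map_sub, itr_bd, hp, hb, map_sub itr, ← itr_cmap, ← itr_cmap]; simp only [map_sub, map_add, hy]; abel))
    exact ⟨this.1, this.2.trans hw⟩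
  obtain ⟨c, hc, -⟩ := id ho
  refine ⟨(key c (itr c) hc (by rw [sub_self]; exact zero_mem _)).1, ?_⟩
  have := le_sv (r := 2 / 5 * simVolOr 3 (X × unitInterval) (bI X)) ⟨c, hc⟩ fun c z hc hz => by linarith [(key c z hc hz).2]
  linarith
lemma HI_I : HI (bI X) := by
  rintro a b c ⟨τ, h1, h2, h3⟩
  have hcon : ∀ f : C(TSimplex 1, bI X), ∀ s t, (f s).1.2 = (f t).1.2 := fun f s t => by
    have hf := (lvl_ce (X := X) true).clo.preimage f.continuous
    rw [lvl_r] at hf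
    have : ∀ s t, (f s).1.2 = 1 → (f t).1.2 = 1 := fun s t h => by
      have := (isClopen_iff.1 hf).resolve_left (fun h' => (h' ▸ (show s ∈ f ⁻¹' {q | q.1.2 = b2I true} from h) : s ∈ (∅ : Set _)))
      exact (this ▸ Set.mem_univ t : t ∈ f ⁻¹' {q | q.1.2 = b2I true})
    rcases (f s).2 with h | h
    · rcases (f t).2 with h' | h'
      · rw [h, h']
      · rw [this t s h', h']
    · rw [this s t h, h]
  have v : ∀ (f : C(TSimplex 1, bI X)) (i) (h : τ.comp (faceMap i) = (vcm _).comp f) (j), (f (vertexPt j)).1.2 = (τ (vertexPt (i.succAbove j))).2 := fun f i h j => by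
    rw [← vtx, h]; rfl
  have a0 := v a 2 h1 0; have b0 := v b 0 h2 0; have c0 := v c 1 h3 0
  have a1 := v a 2 h1 1
  have ht : ∀ s, (a s).1.2 = (τ (vertexPt 0)).2 := fun s => (hcon a s _).trans a0
  have hb : ∀ s, (b s).1.2 = (τ (vertexPt 0)).2 := fun s => ((hcon b s _).trans b0).trans (a1.symm.trans (ht _))
  have hc : ∀ s, (c s).1.2 = (τ (vertexPt 0)).2 := fun s => (hcon c s _).trans c0
  have hm : (τ (vertexPt 0)).2 = 0 ∨ (τ (vertexPt 0)).2 = 1 := by rw [← ht (vertexPt 0)]; exact (a (vertexPt 0)).2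
  refine ⟨⟨fun x => ⟨((τ x).1, (τ (vertexPt 0)).2), hm⟩, by fun_prop⟩, ?_, ?_, ?_⟩
  · ext1 x; exact Subtype.ext (Prod.ext (congrArg (fun f => (f x).1) h1) (ht x).symm)
  · ext1 x; exact Subtype.ext (Prod.ext (congrArg (fun f => (f x).1) h2) (hb x).symm)
  · ext1 x; exact Subtype.ext (Prod.ext (congrArg (fun f => (f x).1) h3) (hc x).symm)
lemma lh_prod {p : Y → X} (hp : IsLocalHomeomorph p) : IsLocalHomeomorph (Prod.map p (id : unitInterval → unitInterval)) := fun q => by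
  obtain ⟨e, he, rfl⟩ := hp q.1
  exact ⟨e.prod (OpenPartialHomeomorph.refl _), ⟨he, trivial⟩, rfl⟩
lemma dc_prod [T2Space X] [CompactSpace X] {p : Y → X} (hp : IsDoubleCover p) : IsDoubleCover (Prod.map p (id : unitInterval → unitInterval)) := by
  haveI := dc_t2 hp; haveI := dc_cpt hp
  refine ⟨isLocalHomeomorph_iff_isCoveringMap.1 (lh_prod hp.1.isLocalHomeomorph), fun x => ?_⟩
  rw [← hp.2 x.1]
  exact Nat.card_congr ⟨fun y => ⟨y.1.1, congrArg Prod.fst y.2⟩, fun y => ⟨(y.1, x.2), Prod.ext y.2 rfl⟩, fun y => Subtype.ext (Prod.ext rfl (congrArg Prod.snd y.2).symm), fun _ => rfl⟩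
lemma pCo (hG : Good 3 (X × unitInterval) (bI X)) (h2 : Good 2 X ∅) [ConnectedSpace X] : simVolConn 3 (X × unitInterval) (bI X) ≤ 5 / 2 * simVolConn 2 X ∅ := by
  haveI := h2.t2; haveI := h2.cpt
  by_cases ho : HomOrientable 2 X ∅
  · obtain ⟨h1, h⟩ := pOr hG ho
    rwa [svc_or h1, svc_or ho]
  have hn : ¬ HomOrientable 3 (X × unitInterval) (bI X) := by
    rintro ⟨c, hc, h0⟩
    rw [relH_iff, sub_zero] at h0
    obtain ⟨b, -, hb, -, -, -, h⟩ := JJ hG HI_I hc.1 h0 (z := itr c) (by rw [sub_self]; exact zero_mem _) one_pos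
    exact ho (h2.ho (rs_cyc (lvl_ce true) hb) (h X (lvl true) (lvl_ce true)))
  have := le_svc (r := 2 / 5 * simVolConn 3 (X × unitInterval) (bI X)) h2 ho fun Y _ p hp hY => by
    haveI : ConnectedSpace Y := by
      obtain ⟨c, hc, h0⟩ := hY
      rw [relH_iff, sub_zero] at h0
      exact dc_conn (ori_ex h2 ho).1 hp hc.1 h0
    have hd := dc_prod hp
    obtain ⟨h1, h⟩ := pOr (X := Y) (hG.dc hd : Good 3 _ (Prod.map p id ⁻¹' bI X)) hY
    have := svc_le hn hd (show HomOrientable 3 _ (Prod.map p id ⁻¹' bI X) from h1)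
    change _ ≤ 1 / 2 * simVolOr 3 (Y × unitInterval) (bI Y) at this
    change _ ≤ simVolOr 2 Y ∅
    linarith
  linarith
end
end
noncomputable section
open Finset
open Topology
section
variable {X Y : Type} [TopologicalSpace X] [TopologicalSpace Y] {m n : ℕ}
lemma sv_re {K : Type} {B : K → Type} [∀ k, TopologicalSpace (B k)] [∀ k, ConnectedSpace (B k)] {ι : ∀ k, C(B k, X)} (h : ∀ k, CE (ι k))
    (hd : ∀ k l x y, ι k x = ι l y → k = l) (hs : ∀ x, ∃ k, x ∈ Set.range (ι k)) (A : Set X) :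
    SimVol n X A = ∑ᶠ k, simVolConn n (B k) (ι k ⁻¹' A) := by
  let o : ∀ k, B k := fun k => Classical.arbitrary _
  have hr : ∀ k, {x : X | ConnectedComponents.mk x = ConnectedComponents.mk (ι k (o k))} = Set.range (ι k) := fun k => by
    rw [← (isPreconnected_range (ι k).continuous).subset_connectedComponent ⟨o k, rfl⟩ |>.antisymm ((h k).clo.connectedComponent_subset ⟨o k, rfl⟩) |>.symm, ← connectedComponents_preimage_singleton]; rfl
  refine (finsum_eq_of_bijective (fun k => ConnectedComponents.mk (ι k (o k))) ⟨fun k l e => ?_, fun c => ?_⟩ fun k => ?_).symm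
  · have : ι k (o k) ∈ Set.range (ι l) := by rw [← hr l]; exact e
    obtain ⟨y, hy⟩ := this
    exact hd _ _ _ _ hy.symm
  · obtain ⟨x, rfl⟩ := ConnectedComponents.surjective_coe c
    obtain ⟨k, hk⟩ := hs x
    rw [← hr k] at hk; exact ⟨k, hk.symm⟩
  · exact svc_homeo ((h k).emb.toHomeomorph.trans (Homeomorph.setCongr (hr k).symm)) rfl
lemma CE.prod {ι : C(Y, X)} (h : CE ι) : CE (ι.prodMap (ContinuousMap.id unitInterval)) := by
  refine ⟨h.emb.prodMap IsEmbedding.id, ?_⟩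
  convert h.clo.preimage (continuous_fst (Y := unitInterval)) using 1
  ext ⟨x, t⟩; constructor
  · rintro ⟨y, hy⟩; exact ⟨y.1, congrArg Prod.fst hy⟩
  · rintro ⟨y, hy⟩; exact ⟨(y, t), Prod.ext hy rfl⟩
lemma pSv [T2Space X] [CompactSpace X] (h2 : LEu 2 X) (hG : Good 3 (X × unitInterval) (bI X)) :
    SimVol 3 (X × unitInterval) (bI X) ≤ 5 / 4 * SimVol 2 (bI X) ∅ := by
  have hX := leu_lcn h2
  haveI := hX.fin
  haveI := Fintype.ofFinite (ConnectedComponents X)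
  let S : ConnectedComponents X → Set X := fun c => {x | ConnectedComponents.mk x = c}
  have hc : ∀ c, CE (vcm (S c)) := fun c => CE.vcm (hX.clo c)
  haveI : ∀ c, ConnectedSpace (S c) := fun c => cc_conn c
  have hd : ∀ k l (x : S k) (y : S l), vcm (S k) x = vcm (S l) y → k = l := fun k l x y e => x.2.symm.trans ((congrArg _ e).trans y.2)
  have hl : ∀ (k l : ConnectedComponents X × Bool) (x : S k.1) (y : S l.1), (lvl k.2).comp (vcm (S k.1)) x = (lvl l.2).comp (vcm (S l.1)) y → k = l := fun k l x y e => Prod.ext (hd _ _ x y (congrArg (fun q => q.1.1) e)) (by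
    have : b2I k.2 = b2I l.2 := congrArg (fun q : bI X => q.1.2) e
    revert this; cases k.2 <;> cases l.2 <;> simp [b2I])
  rw [sv_re (n := 3) (K := ConnectedComponents X) (B := fun c => S c × unitInterval) (fun c => (hc c).prod)
    (fun k l x y e => hd k l x.1 y.1 (congrArg Prod.fst e)) (fun x => ⟨_, (⟨x.1, rfl⟩, x.2), rfl⟩),
    sv_re (n := 2) (K := ConnectedComponents X × Bool) (B := fun k => S k.1) (fun k => (lvl_ce k.2).comp (hc k.1)) hl (fun x => ⟨(ConnectedComponents.mk x.1.1, if x.1.2 = 0 then false else true), ⟨x.1.1, rfl⟩, by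
      refine Subtype.ext (Prod.ext rfl ?_)
      rcases x.2 with h | h <;> simp [h, b2I]⟩),
    finsum_eq_sum_of_fintype, finsum_eq_sum_of_fintype, Fintype.sum_prod_type, Finset.mul_sum]
  refine Finset.sum_le_sum fun c _ => ?_
  haveI := isCompact_iff_compactSpace.1 (hX.clo c).1.isCompact
  have := pCo (X := S c) (hG.pull (lh_prod (hX.clo c).2.isOpenEmbedding_subtypeVal.isLocalHomeomorph)) (clo_good (leu_good h2) (hc c))
  rw [Fintype.sum_bool]
  change simVolConn 3 (S c × unitInterval) (bI (S c)) ≤ 5 / 4 * (simVolConn 2 (S c) ∅ + simVolConn 2 (S c) ∅)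
  linarith
end
end
noncomputable section
open Finset
open Topology
section
variable {X Y : Type} [TopologicalSpace X] [TopologicalSpace Y] {m n : ℕ}
def hI : HS 3 ≃ₜ EE 2 × {t : unitInterval // t < 1} where
  toFun y := (WithLp.toLp 2 ![y.1 0, y.1 1], ⟨⟨(∑ i, y.1 i) / (1 + ∑ i, y.1 i), by have := y.2; positivity, by have := y.2; rw [div_le_one (by positivity)]; linarith⟩,
    show (∑ i, y.1 i) / (1 + ∑ i, y.1 i) < 1 by have := y.2; rw [div_lt_one (by positivity)]; linarith⟩)
  invFun q := ⟨WithLp.toLp 2 ![q.1 0, q.1 1, q.2.1.1 / (1 - q.2.1.1) - q.1 0 - q.1 1], by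
    have h0 := q.2.1.2.1
    have h1 : 0 ≤ 1 - q.2.1.1 := sub_nonneg.2 q.2.1.2.2
    simp [Fin.sum_univ_three]; positivity⟩
  left_inv y := by
    have := y.2
    refine Subtype.ext ?_; ext i; fin_cases i
    · rfl
    · rfl
    · have h : 1 + ∑ i, y.1 i ≠ 0 := by positivity
      simp only [Fin.sum_univ_three] at h
      simp [Fin.sum_univ_three]; field_simp; ring
  right_inv q := by
    have h1 : 1 - q.2.1.1 ≠ 0 := ne_of_gt (sub_pos.2 q.2.2)
    refine Prod.ext ?_ (Subtype.ext (Subtype.ext ?_))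
    · ext i; fin_cases i <;> rfl
    · simp [Fin.sum_univ_three]; field_simp; ring
  continuous_toFun := by
    refine (Continuous.prodMk ((PiLp.continuous_toLp 2 _).comp (continuous_pi fun i => ?_)) (Continuous.subtype_mk (Continuous.subtype_mk ?_ _) _))
    · fin_cases i <;> simp <;> fun_prop
    · refine Continuous.div (by fun_prop) (by fun_prop) fun y => ?_
      have := y.2; positivity
  continuous_invFun := by
    refine Continuous.subtype_mk ((PiLp.continuous_toLp 2 _).comp (continuous_pi fun i => ?_)) _
    fin_cases i <;> simp
    · fun_prop
    · fun_prop
    · refine ((Continuous.div (by fun_prop) (by fun_prop) fun q : EE 2 × {t : unitInterval // t < 1} => ne_of_gt (sub_pos.2 (show (q.2.1.1 : ℝ) < 1 from q.2.2))).sub (by fun_prop)).sub (by fun_prop)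
lemma pch (h : LEu 2 X) (x : X) (t : unitInterval) (ht : t < 1) : ∃ k : C(HS 3, X × unitInterval), IsOpenEmbedding k ∧ ∃ y, k y = (x, t) ∧ (∑ i, y.1 i = 0 ↔ t = 0) := by
  obtain ⟨j, hj, rfl⟩ := h x
  refine ⟨(j.prodMap ⟨_, continuous_subtype_val⟩).comp ⟨hI, hI.continuous⟩, (hj.prodMap (isOpen_Iio (a := (1 : unitInterval))).isOpenEmbedding_subtypeVal).comp hI.isOpenEmbedding, hI.symm (0, ⟨t, ht⟩), ?_, ?_⟩
  · change Prod.map j Subtype.val (hI (hI.symm (0, ⟨t, ht⟩))) = _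
    rw [hI.apply_symm_apply]; rfl
  · have h1 : 1 - t.1 ≠ 0 := ne_of_gt (sub_pos.2 ht)
    simp [hI, Fin.sum_univ_three, h1]
lemma pMf [T2Space X] [SecondCountableTopology X] (h : LEu 2 X) : IsManifoldWithBoundary 3 (X × unitInterval) ∧ intBoundary 3 (X × unitInterval) = bI X := by
  have key : ∀ q : X × unitInterval, ∃ k : C(HS 3, X × unitInterval), IsOpenEmbedding k ∧ ∃ y, k y = q ∧ (∑ i, y.1 i = 0 ↔ q ∈ bI X) := fun ⟨x, t⟩ => by
    by_cases ht : t = 1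
    · subst ht
      obtain ⟨k, hk, y, hy, h⟩ := pch h x 0 (by simp)
      let e : X × unitInterval ≃ₜ X × unitInterval := (Homeomorph.refl X).prodCongr unitInterval.symmHomeomorph
      refine ⟨(⟨e, e.continuous⟩ : C(X × unitInterval, X × unitInterval)).comp k, e.isOpenEmbedding.comp hk, y, ?_, h.trans (by simp [bI])⟩
      change e (k y) = _
      rw [hy]; simp [e]
    · obtain ⟨k, hk, y, hy, h⟩ := pch h x t (lt_of_le_of_ne t.2.2 ht)
      exact ⟨k, hk, y, hy, h.trans (by simp [bI, ht])⟩
  refine ⟨⟨inferInstance, inferInstance, fun q => ?_⟩, Set.ext fun q => ?_⟩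
  · obtain ⟨k, hk, y, hy, -⟩ := key q
    exact ⟨Set.range k, ⟨y, hy⟩, hk.isOpen_range, Or.inr ⟨hk.isEmbedding.toHomeomorph.symm⟩⟩
  · obtain ⟨k, hk, y, rfl, h⟩ := key q
    exact (half_iff hk).trans h
lemma Part2 [T2Space X] [SecondCountableTopology X] [CompactSpace X] (h : LEu 2 X) :
    SimVol 3 (X × unitInterval) (intBoundary 3 (X × unitInterval)) = (5 / 4 : ℝ) * SimVol 2 ↥(intBoundary 3 (X × unitInterval)) (∅ : Set ↥(intBoundary 3 (X × unitInterval))) := by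
  obtain ⟨h1, h2⟩ := pMf h
  have h3 := mfd_good h1
  have h4 := Part1 h1
  rw [h2] at h3 h4 ⊢
  exact le_antisymm (pSv h h3) (h4 HI_I)
end
end
noncomputable section
open Finset
open Topology
section
variable {X Y : Type} [TopologicalSpace X] [TopologicalSpace Y] {m n : ℕ}
def Mo (F : EE 3 → ℝ) (p : EE 3) : Prop := ∃ i : Fin 3, ∃ U ∈ 𝓝 p, ∃ s : ℝ, s ≠ 0 ∧ ∀ a ∈ U, ∀ b ∈ U, (∀ j, j ≠ i → a j = b j) → a i < b i → s * F a < s * F b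
lemma Mo.fr {F : EE 3 → ℝ} {p : EE 3} (h : Mo F p) (hp : F p = 0) : p ∈ frontier {a | F a ≤ 0} := by
  obtain ⟨i, U, hU, s, -, h⟩ := h
  refine ⟨subset_closure hp.le, fun hi => ?_⟩
  have ht : Filter.Tendsto (fun t : ℝ => p + t • EuclideanSpace.single i (1 : ℝ)) (𝓝 0) (𝓝 p) := by
    have : Continuous fun t : ℝ => p + t • EuclideanSpace.single i (1 : ℝ) := by fun_prop
    simpa using this.tendsto 0
  obtain ⟨ε, he, hb⟩ := Metric.eventually_nhds_iff.1 (ht.eventually (Filter.inter_mem hU (mem_interior_iff_mem_nhds.1 hi)))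
  have h1 := @hb (ε / 2) (by simp [abs_of_pos he]; linarith)
  have h2 := @hb (-(ε / 2)) (by simp [abs_of_pos he]; linarith)
  have g1 := h p (mem_of_mem_nhds hU) _ h1.1 (fun j hj => by simp [hj]) (by simp; linarith)
  have g2 := h _ h2.1 p (mem_of_mem_nhds hU) (fun j hj => by simp [hj]) (by simp; linarith)
  have f1 : F _ ≤ 0 := h1.2
  have f2 : F _ ≤ 0 := h2.2
  rw [hp, mul_zero] at g1 g2
  rcases le_or_gt 0 s with hs | hs <;> nlinarith
lemma gr {f : EE 2 → ℝ → ℝ} (hf : Continuous fun q : EE 2 × ℝ => f q.1 q.2) {u₀ : EE 2} {a b : ℝ} {W : Set (EE 2)} (hW : W ∈ 𝓝 u₀) {t₀ : ℝ} (h0 : f u₀ t₀ = 0) (ha : a < t₀) (hb : t₀ < b)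
    (hm : ∀ u ∈ W, StrictMonoOn (f u) (Set.Icc a b)) : ∃ j : C(EE 2, EE 2), IsOpenEmbedding j ∧ j 0 = u₀ ∧ ∃ h : C(EE 2, ℝ), ∀ v t, t ∈ Set.Ioo a b → (f (j v) t = 0 ↔ t = h v) ∧ h v ∈ Set.Ioo a b := by
  have hfc : ∀ t, Continuous fun u => f u t := fun t => hf.comp (by fun_prop : Continuous fun u : EE 2 => (u, t))
  have hA : a ∈ Set.Icc a b := ⟨le_rfl, by linarith⟩
  have hB : b ∈ Set.Icc a b := ⟨by linarith, le_rfl⟩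
  have ht : t₀ ∈ Set.Icc a b := ⟨ha.le, hb.le⟩
  have hm0 := hm u₀ (mem_of_mem_nhds hW)
  obtain ⟨j, h1, h2, h3⟩ := ball_chart (Filter.inter_mem hW (Filter.inter_mem ((isOpen_lt (hfc a) continuous_const).mem_nhds (show f u₀ a < 0 from h0 ▸ hm0 hA ht ha))
    ((isOpen_lt continuous_const (hfc b)).mem_nhds (show 0 < f u₀ b from h0 ▸ hm0 ht hB hb))))
  have h3 : ∀ v, j v ∈ W ∧ f (j v) a < 0 ∧ 0 < f (j v) b := fun v => h3 ⟨v, rfl⟩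
  have hx : ∀ v, ∃ t ∈ Set.Ioo a b, f (j v) t = 0 := fun v =>
    intermediate_value_Ioo (by linarith : a ≤ b) (hf.comp (by fun_prop : Continuous fun t : ℝ => (j v, t))).continuousOn ⟨(h3 v).2.1, (h3 v).2.2⟩
  choose h hh hz using hx
  have hI : ∀ v, h v ∈ Set.Icc a b := fun v => Set.Ioo_subset_Icc_self (hh v)
  refine ⟨j, h1, h2, ⟨h, continuous_iff_continuousAt.2 fun v => tendsto_order.2 ⟨fun c hc => ?_, fun c hc => ?_⟩⟩, fun v t ht => ⟨⟨fun e => (hm _ (h3 v).1).injOn (Set.Ioo_subset_Icc_self ht) (hI v) (e.trans (hz v).symm), fun e => e ▸ hz v⟩, hh v⟩⟩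
  · have hc' : max c a ∈ Set.Icc a b := ⟨le_max_right _ _, (max_lt hc (hh v).1).le.trans (hI v).2⟩
    filter_upwards [(isOpen_lt ((hfc (max c a)).comp j.continuous) continuous_const).mem_nhds (show f (j v) (max c a) < 0 from hz v ▸ hm _ (h3 v).1 hc' (hI v) (max_lt hc (hh v).1))] with w hw
    exact (le_max_left _ _).trans_lt (((hm _ (h3 w).1).lt_iff_lt hc' (hI w)).1 (hz w ▸ hw))
  · have hc' : min c b ∈ Set.Icc a b := ⟨(hI v).1.trans (lt_min hc (hh v).2).le, min_le_right _ _⟩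
    filter_upwards [(isOpen_lt continuous_const ((hfc (min c b)).comp j.continuous)).mem_nhds (show 0 < f (j v) (min c b) from hz v ▸ hm _ (h3 v).1 (hI v) hc' (lt_min hc (hh v).2))] with w hw
    exact (((hm _ (h3 w).1).lt_iff_lt (hI w) hc').1 (hz w ▸ hw)).trans_le (min_le_left _ _)
lemma Mo.leu {F : EE 3 → ℝ} (hF : Continuous F) {S : Set (EE 3)} (hS : S = {a | F a = 0}) (h : ∀ p ∈ S, Mo F p) : LEu 2 S := fun ⟨p, hp⟩ => by
  obtain ⟨i, U, hU, s, hs, h⟩ := h p hp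
  let E : EE 2 × ℝ → EE 3 := fun q => WithLp.toLp 2 (i.insertNth q.2 q.1.ofLp : Fin 3 → ℝ)
  let P : EE 3 → EE 2 := fun a => WithLp.toLp 2 (i.removeNth a.ofLp)
  have cE : Continuous E := (PiLp.continuous_toLp 2 _).comp (Continuous.finInsertNth i continuous_snd (by fun_prop))
  have cP : Continuous P := (PiLp.continuous_toLp 2 _).comp (continuous_pi fun j => by unfold Fin.removeNth; fun_prop)
  have EP : ∀ a, E (P a, a i) = a := fun a => by simp [E, P]
  have PE : ∀ q, P (E q) = q.1 := fun q => by simp [E, P]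
  have Ei : ∀ q, E q i = q.2 := fun q => by simp [E]
  have hp0 : F p = 0 := hS.subset hp
  obtain ⟨W, hW, T, hT, hWT⟩ := mem_nhds_prod_iff.1 (cE.continuousAt.preimage_mem_nhds (show U ∈ 𝓝 (E (P p, p i)) by rwa [EP]))
  obtain ⟨ε, he, hb⟩ := Metric.nhds_basis_closedBall.mem_iff.1 hT
  rw [Real.closedBall_eq_Icc] at hb
  obtain ⟨j, j1, j2, g, hg⟩ := gr (f := fun u t => s * F (E (u, t))) (by fun_prop) hW (t₀ := p i) (by simp only [EP, hp0, mul_zero]) (by linarith : p i - ε < p i) (by linarith : p i < p i + ε) fun u hu x hx y hy hxy =>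
    h _ (hWT ⟨hu, hb hx⟩) _ (hWT ⟨hu, hb hy⟩) (fun k hk => by
      obtain ⟨k, rfl⟩ := Fin.exists_succAbove_eq hk
      simp [E]) (by rwa [Ei, Ei])
  simp only [mul_eq_zero, hs, false_or] at hg
  have hg' : ∀ v, g v ∈ Set.Ioo (p i - ε) (p i + ε) := fun v => (hg v (p i) ⟨by linarith, by linarith⟩).2
  let J : C(EE 2, S) := ⟨fun v => ⟨E (j v, g v), by rw [hS]; exact (hg v _ (hg' v)).1.2 rfl⟩, by fun_prop⟩
  have hr : Set.range J = {a : S | P a.1 ∈ Set.range j ∧ a.1 i ∈ Set.Ioo (p i - ε) (p i + ε)} := by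
    ext a; constructor
    · rintro ⟨v, rfl⟩
      exact ⟨⟨v, (PE (j v, g v)).symm⟩, by change E _ i ∈ _; rw [Ei]; exact hg' v⟩
    · rintro ⟨⟨v, hv⟩, ha⟩
      have ha0 : F a.1 = 0 := hS.subset a.2
      refine ⟨v, Subtype.ext ?_⟩
      have := (hg v _ ha).1.1 (by rw [hv, EP]; exact ha0)
      change E (j v, g v) = _
      rw [← this, hv, EP]
  refine recen (j := J) ⟨IsEmbedding.of_comp J.continuous (g := fun a : S => P a.1) (by fun_prop) ?_, ?_⟩ ?_
  · convert j1.isEmbedding using 1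
    ext1 v; exact PE (j v, g v)
  · rw [hr]; exact (j1.isOpen_range.preimage (cP.comp continuous_subtype_val)).inter (isOpen_Ioo.preimage (by fun_prop))
  · rw [hr]; exact ⟨⟨0, j2⟩, by linarith, by linarith⟩
end
end
noncomputable section
open Finset
open Topology
section
variable {g : ℕ}
def Cg (g : ℕ) : Set ℝ := {c | ∃ k : ℕ, k < g ∧ c = 2 * k}
def wg (g : ℕ) (x : ℝ) : ℝ := Metric.infDist x (Cg g)
lemma Cg_cpt : IsCompact (Cg g) := ((Set.finite_lt_nat g).image (fun k : ℕ => 2 * (k : ℝ))).isCompact.of_isClosed_subset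
  (by convert ((Set.finite_lt_nat g).image (fun k : ℕ => 2 * (k : ℝ))).isClosed using 1; ext c; simp [Cg, eq_comm]) (by rintro c ⟨k, h, rfl⟩; exact ⟨k, h, rfl⟩)
lemma wg_le {c : ℝ} (h : c ∈ Cg g) (x : ℝ) : wg g x ≤ |x - c| := Metric.infDist_le_dist_of_mem h
lemma wg_ex (hg : 0 < g) (x : ℝ) : ∃ c ∈ Cg g, wg g x = |x - c| := Cg_cpt.exists_infDist_eq_dist ⟨0, 0, hg, by simp⟩ x
lemma Cg_d {c d : ℝ} (hc : c ∈ Cg g) (hd : d ∈ Cg g) (h : c < d) : c + 2 ≤ d ∧ c + 2 ∈ Cg g ∧ d - 2 ∈ Cg g := by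
  obtain ⟨k, hk, rfl⟩ := hc
  obtain ⟨l, hl, rfl⟩ := hd
  have : k < l := by exact_mod_cast (by linarith : (k : ℝ) < l)
  obtain ⟨l, rfl⟩ := Nat.exists_eq_add_of_lt this
  push_cast
  have : (0 : ℝ) ≤ l := l.cast_nonneg
  exact ⟨by linarith, ⟨k + 1, by omega, by push_cast; ring⟩, ⟨k + l, by omega, by push_cast; ring⟩⟩
lemma Cg_a {c d : ℝ} (hc : c ∈ Cg g) (hd : d ∈ Cg g) (h : c ≠ d) (x : ℝ) : 2 ≤ |x - c| + |x - d| := by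
  have : 2 ≤ |c - d| := by
    rcases h.lt_or_gt with h | h
    · have := (Cg_d hc hd h).1; rw [abs_of_neg (by linarith)]; linarith
    · have := (Cg_d hd hc h).1; rw [abs_of_pos (by linarith)]; linarith
  have h := abs_sub_le c x d
  rw [abs_sub_comm c x] at h; linarith
def Fg (g : ℕ) (p : EE 3) : ℝ := (p 2) ^ 2 + (√((p 1) ^ 2 + wg g (p 0) ^ 2) - 1) ^ 2 - 1 / 16
lemma wg_c : Continuous (wg g) := Metric.continuous_infDist_pt _
lemma Fg_c : Continuous (Fg g) := by
  have := wg_c (g := g)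
  unfold Fg; fun_prop
lemma d3 (p q : EE 3) : dist p q ≤ 1 / 4 ↔ (p 0 - q 0) ^ 2 + (p 1 - q 1) ^ 2 + (p 2 - q 2) ^ 2 ≤ 1 / 16 := by
  rw [EuclideanSpace.dist_eq, Real.sqrt_le_left (by norm_num), Fin.sum_univ_three, Real.dist_eq, Real.dist_eq, Real.dist_eq, sq_abs, sq_abs, sq_abs]; norm_num
lemma Hg_eq (hg : 0 < g) : HgSet g = {p | Fg g p ≤ 0} := by
  ext p
  obtain ⟨c, hc, hw⟩ := wg_ex hg (p 0)
  have hS := Real.sq_sqrt (show 0 ≤ (p 1) ^ 2 + wg g (p 0) ^ 2 by positivity)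
  have hr0 := Real.sqrt_nonneg ((p 1) ^ 2 + wg g (p 0) ^ 2)
  simp only [Set.mem_setOf_eq, Fg]
  generalize √((p 1) ^ 2 + wg g (p 0) ^ 2) = r at *
  rw [hw, sq_abs] at hS
  constructor
  · rintro ⟨q, ⟨q2, k, hk, hq⟩, hd⟩
    rw [d3, q2, sub_zero] at hd
    have hkC : (2 * k : ℝ) ∈ Cg g := ⟨k, hk, rfl⟩
    have hR := Real.sq_sqrt (show 0 ≤ (p 1) ^ 2 + (p 0 - 2 * k) ^ 2 by positivity)
    have hR0 := Real.sqrt_nonneg ((p 1) ^ 2 + (p 0 - 2 * k) ^ 2)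
    generalize √((p 1) ^ 2 + (p 0 - 2 * k) ^ 2) = R at *
    have h1 : (p 0 - 2 * k) * (q 0 - 2 * k) + p 1 * q 1 ≤ R := abs_le_of_sq_le_sq' (by
      have : ((p 0 - 2 * k) * (q 0 - 2 * k) + p 1 * q 1) ^ 2 + ((p 0 - 2 * k) * q 1 - p 1 * (q 0 - 2 * k)) ^ 2 = R ^ 2 := by rw [hR]; linear_combination ((p 1) ^ 2 + (p 0 - 2 * k) ^ 2) * hq
      linarith [sq_nonneg ((p 0 - 2 * k) * q 1 - p 1 * (q 0 - 2 * k))]) hR0 |>.2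
    have h2 : (r - 1) ^ 2 ≤ (R - 1) ^ 2 := by
      by_cases e : c = 2 * k
      · have : r ^ 2 = R ^ 2 := by rw [hS, hR, e]
        rw [(sq_eq_sq₀ hr0 hR0).1 this]
      · have a1 := Cg_a hc hkC e (p 0)
        have a2 : |p 0 - c| ≤ r := abs_le_of_sq_le_sq (by linarith [sq_nonneg (p 1)]) hr0
        have a3 : |p 0 - 2 * k| ≤ R := abs_le_of_sq_le_sq (by linarith [sq_nonneg (p 1)]) hR0
        have a4 : |p 0 - c| ≤ |p 0 - 2 * k| := hw ▸ wg_le hkC _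
        have a5 : r ≤ R := by
          refine abs_le_of_sq_le_sq' ?_ hR0 |>.2
          have := sq_le_sq.2 a4; linarith
        nlinarith only [mul_nonneg (sub_nonneg.2 a5) (by linarith : 0 ≤ R + r - 2)]
    have h3 : (p 0 - q 0) ^ 2 + (p 1 - q 1) ^ 2 = R ^ 2 + 1 - 2 * ((p 0 - 2 * k) * (q 0 - 2 * k) + p 1 * q 1) := by linear_combination hq - hR
    linarith
  · intro h
    have hr : 3 / 4 ≤ r := by nlinarith [sq_nonneg (p 2)]
    have hr' : r ≠ 0 := by positivity
    obtain ⟨k, hk, rfl⟩ := hc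
    refine ⟨WithLp.toLp 2 ![2 * k + (p 0 - 2 * k) / r, p 1 / r, 0], ⟨rfl, k, hk, ?_⟩, (d3 _ _).2 ?_⟩
    · simp; field_simp; linarith
    · simp
      have : (p 0 - (2 * k + (p 0 - 2 * k) / r)) ^ 2 + (p 1 - p 1 / r) ^ 2 = (r - 1) ^ 2 := by
        have : (p 0 - (2 * k + (p 0 - 2 * k) / r)) ^ 2 + (p 1 - p 1 / r) ^ 2 = ((p 1) ^ 2 + (p 0 - 2 * k) ^ 2) * (1 - 1 / r) ^ 2 := by ring
        rw [this, ← hS]; field_simp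
      linarith
lemma alg {s d r R β γ : ℝ} (h1 : 0 < s * (r - 1)) (h2 : 0 < s * (R - 1)) (hr : 0 ≤ r) (hR : 0 ≤ R) (hb : 0 < d * β) (hc : 0 < d * γ) (hl : β < γ) (h : R ^ 2 - r ^ 2 = γ ^ 2 - β ^ 2) :
    s * d * (r - 1) ^ 2 < s * d * (R - 1) ^ 2 := by
  have k : 0 < (s * (r - 1) + s * (R - 1)) * ((d * β + d * γ) * (γ - β)) := by
    have := sub_pos.2 hl; positivity
  have e : (s * d * (R - 1) ^ 2 - s * d * (r - 1) ^ 2) * (R + r) = (s * (r - 1) + s * (R - 1)) * ((d * β + d * γ) * (γ - β)) := by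
    linear_combination (s * (r - 1) + s * (R - 1)) * d * h
  rw [← e] at k
  have := pos_of_mul_pos_left k (by positivity : 0 ≤ R + r)
  linarith
lemma wloc (hg : 0 < g) {x : ℝ} (h : wg g x = 3 / 4 ∨ wg g x = 5 / 4) : ∃ c, wg g x = |x - c| ∧ ∀ᶠ y in 𝓝 x, wg g y = |y - c| := by
  obtain ⟨c, hc, hw⟩ := wg_ex hg x
  refine ⟨c, hw, ?_⟩
  filter_upwards [Metric.ball_mem_nhds x (show (0 : ℝ) < 1 / 4 by norm_num)] with y hy
  rw [Metric.mem_ball, Real.dist_eq, abs_lt] at hy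
  refine (wg_le hc y).antisymm ?_
  obtain ⟨d, hd, hv⟩ := wg_ex hg y
  rw [hv]
  by_cases e : c = d
  · rw [e]
  rw [hw] at h
  rcases h with h | h
  · have := Cg_a hc hd e y
    have : |y - c| ≤ 1 := by rw [abs_le]; have := abs_le.1 h.le; constructor <;> linarith
    linarith
  · rcases abs_eq (by norm_num : (0 : ℝ) ≤ 5 / 4) |>.1 h with h' | h' <;> rcases lt_or_gt_of_ne e with l | l
    · have := wg_le (Cg_d hc hd l).2.1 x
      rw [hw, h, show x - (c + 2) = -(3 / 4) by linarith] at this; norm_num [abs_div] at this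
    · rw [abs_of_pos (by linarith : 0 < y - c)]; exact le_trans (by linarith) (le_abs_self _)
    · rw [abs_of_neg (by linarith : y - c < 0)]; exact le_trans (by linarith) (neg_le_abs _)
    · have := wg_le (Cg_d hd hc l).2.2 x
      rw [hw, h, show x - (c - 2) = 3 / 4 by linarith] at this; norm_num [abs_div] at this
lemma Fg_mo (hg : 0 < g) {p : EE 3} (hp : Fg g p = 0) : Mo (Fg g) p := by
  by_cases hz : p 2 = 0
  swap
  · refine ⟨2, {a | 0 < p 2 * a 2}, (isOpen_lt continuous_const (by fun_prop)).mem_nhds (mul_self_pos.2 hz), p 2, hz, fun a ha b hb h l => ?_⟩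
    rw [Fg, Fg, h 0 (by decide), h 1 (by decide)]
    change 0 < p 2 * a 2 at ha; change 0 < p 2 * b 2 at hb
    nlinarith [mul_pos (add_pos ha hb) (sub_pos.2 l)]
  let r : EE 3 → ℝ := fun a => √((a 1) ^ 2 + wg g (a 0) ^ 2)
  have cr : Continuous r := by have := wg_c (g := g); fun_prop
  have hr0 : ∀ a, 0 ≤ r a := fun a => Real.sqrt_nonneg _
  have hr2 : ∀ a, r a ^ 2 = (a 1) ^ 2 + wg g (a 0) ^ 2 := fun a => Real.sq_sqrt (by positivity)
  have hs : (r p - 1) ^ 2 = 1 / 16 := by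
    change _ + (r p - 1) ^ 2 - _ = _ at hp; rw [hz] at hp; linarith
  have hs0 : r p - 1 ≠ 0 := fun h => by rw [h] at hs; norm_num at hs
  have hU : {a | 0 < (r p - 1) * (r a - 1)} ∈ 𝓝 p := (isOpen_lt continuous_const (by fun_prop)).mem_nhds (mul_self_pos.2 hs0)
  have key : ∀ (i : Fin 3) (β : EE 3 → ℝ), i ≠ 2 → Continuous β → β p ≠ 0 → ∀ V ∈ 𝓝 p, (∀ a ∈ V, ∀ b ∈ V, (∀ j, j ≠ i → a j = b j) → a i < b i → β a < β b ∧ r b ^ 2 - r a ^ 2 = β b ^ 2 - β a ^ 2) → Mo (Fg g) p := fun i β hi cβ h0 V hV h => by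
    refine ⟨i, _, Filter.inter_mem hV (Filter.inter_mem hU ((isOpen_lt continuous_const (by fun_prop : Continuous fun a => β p * β a)).mem_nhds (mul_self_pos.2 h0))), (r p - 1) * β p, mul_ne_zero hs0 h0, fun a ha b hb hj hl => ?_⟩
    obtain ⟨l, e⟩ := h a ha.1 b hb.1 hj hl
    have := alg ha.2.1 hb.2.1 (hr0 a) (hr0 b) ha.2.2 hb.2.2 l e
    change _ * (_ + (r a - 1) ^ 2 - _) < _ * (_ + (r b - 1) ^ 2 - _)
    rw [hj 2 hi.symm]; linarith
  by_cases hy : p 1 = 0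
  swap
  · refine key 1 (fun a => a 1) (by decide) (by fun_prop) hy _ Filter.univ_mem fun a _ b _ h l => ⟨l, ?_⟩
    rw [hr2, hr2, h 0 (by decide)]; ring
  have h2 := hr2 p
  have hw0 : 0 ≤ wg g (p 0) := Metric.infDist_nonneg
  rw [hy, zero_pow two_ne_zero, zero_add, sq_eq_sq₀ (hr0 p) hw0] at h2
  have hw : wg g (p 0) = 3 / 4 ∨ wg g (p 0) = 5 / 4 := by
    rw [h2] at hs
    have : (wg g (p 0) - 3 / 4) * (wg g (p 0) - 5 / 4) = 0 := by nlinarith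
    rcases mul_eq_zero.1 this with h | h
    · left; linarith
    · right; linarith
  obtain ⟨c, hc, hv⟩ := wloc hg hw
  refine key 0 (fun a => a 0 - c) (by decide) (by fun_prop) (fun h => ?_) _ ((show Continuous fun a : EE 3 => a 0 by fun_prop).continuousAt.eventually hv) fun a ha b hb h l => ⟨sub_lt_sub_right l _, ?_⟩
  · rw [hc, h] at hw; norm_num at hw
  · change wg g (a 0) = _ at ha; change wg g (b 0) = _ at hb
    rw [hr2, hr2, h 1 (by decide), ha, hb, sq_abs, sq_abs]; ring
lemma Sg_eq (hg : 0 < g) : frontier (HgSet g) = {p | Fg g p = 0} := by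
  rw [Hg_eq hg]
  exact (frontier_le_subset_eq Fg_c continuous_const).antisymm fun p hp => (Fg_mo hg hp).fr hp
lemma Sg_leu (hg : 0 < g) : LEu 2 (SurfaceG g) := Mo.leu Fg_c (Sg_eq hg) fun p hp => Fg_mo hg ((Sg_eq hg).subset hp)
lemma Sg_cpt : CompactSpace (SurfaceG g) := by
  refine isCompact_iff_compactSpace.1 (Metric.isCompact_of_isClosed_isBounded isClosed_frontier ?_)
  refine Bornology.IsBounded.subset (Metric.isBounded_closedBall (x := (0 : EE 3)) (r := 2 * g + 3)) (frontier_subset_closure.trans (closure_minimal ?_ Metric.isClosed_closedBall))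
  rintro p ⟨q, ⟨q2, k, hk, hq⟩, hd⟩
  have h1 : |q 0 - 2 * k| ≤ 1 := abs_le_one_iff_mul_self_le_one.2 (by nlinarith [sq_nonneg (q 1)])
  have h2 : |q 1| ≤ 1 := abs_le_one_iff_mul_self_le_one.2 (by nlinarith [sq_nonneg (q 0 - 2 * k)])
  have hk' : (k : ℝ) ≤ g := by exact_mod_cast hk.le
  have h3 : dist q 0 ≤ 2 * g + 2 := by
    rw [EuclideanSpace.dist_eq, Real.sqrt_le_left (by positivity), Fin.sum_univ_three, Real.dist_eq, Real.dist_eq, Real.dist_eq, sq_abs, sq_abs, sq_abs, q2]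
    have := abs_le.1 h1
    have hk0 : (0 : ℝ) ≤ k := k.cast_nonneg
    simp
    nlinarith [abs_le.1 h2, sq_nonneg (q 0 - 2 * k)]
  rw [Metric.mem_closedBall]
  linarith [dist_triangle p q 0]
end
end
end
/-- Every compact aspherical boundary irreducible 3-manifold `M` satisfies
`‖M, ∂M‖ ≥ (5/4)·‖∂M‖`, and this inequality is sharp: equality holds for the products of
closed orientable surfaces of genus `≥ 2` with the interval. -/
theorem simvol_aspherical_boundary_irreducible_sharp :
    (∀ (M : Type) [TopologicalSpace M], CompactSpace M → IsManifoldWithBoundary 3 M →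
      Aspherical M → BoundaryIrreducible 3 M →
      (5 / 4 : ℝ) * SimVol 2 ↥(intBoundary 3 M) (∅ : Set ↥(intBoundary 3 M)) ≤
        SimVol 3 M (intBoundary 3 M)) ∧
    (∀ g : ℕ, 2 ≤ g →
      SimVol 3 (SurfaceG g × unitInterval)
          (intBoundary 3 (SurfaceG g × unitInterval)) =
        (5 / 4 : ℝ) * SimVol 2 ↥(intBoundary 3 (SurfaceG g × unitInterval))
          (∅ : Set ↥(intBoundary 3 (SurfaceG g × unitInterval)))) := by
  exact ⟨fun M _ hc hM _ hb => by haveI := hc; exact Part1 hM (hi_of_bi hb), fun g hg => by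
    haveI := Sg_cpt (g := g); exact Part2 (Sg_leu (by omega))⟩

end
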